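/- Let C = {P_1,…,P_t} be a finite family of t polynomials in ℝ[X_1,…,X_k], let S ⊆ ℝ^k be a bounded C-closed set, let Σ ⊆ Sign(C,S), and let X = ⋃_{σ∈Σ} R(σ). For m with 0 ≤ m ≤ t, let Σ_m (resp. Sign_m(C,S)) denote the sign conditions in Σ (resp. Sign(C,S)) of level m. Given reals ε_1,…,ε_{2t} > 0 and a sign condition σ of level m, define R(σ_+^c) = {x ∈ S : |P(x)| ≤ ε_{2m} for all P with σ(P)=0, P(x) ≥ 0 for all P with σ(P)=1, P(x) ≤ 0 for all P with σ(P)=−1} and R(σ_+^o) = {x ∈ S : |P(x)| < ε_{2m−1} for all P with σ(P)=0, P(x) > 0 for all P with σ(P)=1, P(x) < 0 for all P with σ(P)=−1}. Define X^0 = X and, for 0 ≤ m ≤ t, X^{m+1} = (X^m ∪ ⋃_{σ∈Σ_m} R(σ_+^c)) \ ⋃_{σ∈Sign_m(C,S)∖Σ_m} R(σ_+^o), and set X' = X^{t+1}. Then there exist reals 0 < ε_1 < ε_2 < ⋯ < ε_{2t} such that X' is closed and bounded and X' is homotopy equivalent to X; in particular X and X' have isomorphic singular homology groups in every degree. -/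

import Mathlib

open MvPolynomial Set

/-- The realization `R(σ)` of a sign condition `σ` on the finite family of polynomials
`A = (A 0, …, A (t-1))` in `ℝ[X_1,…,X_k]`. -/
def signRealization {k t : ℕ} (A : Fin t → MvPolynomial (Fin k) ℝ)
    (σ : Fin t → SignType) : Set (Fin k → ℝ) :=
  {x | ∀ i, SignType.sign (eval x (A i)) = σ i}

/-- The level of a sign condition: the number of polynomials to which it assigns the sign `0`. -/
def signLevel {t : ℕ} (σ : Fin t → SignType) : ℕ :=
  (Finset.univ.filter fun i => σ i = 0).card

/-- `Sign(C,S)`: the sign conditions on the family with nonempty realization contained in `S`. -/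
def signCondOn {k t : ℕ} (A : Fin t → MvPolynomial (Fin k) ℝ)
    (S : Set (Fin k → ℝ)) : Set (Fin t → SignType) :=
  {σ | (signRealization A σ).Nonempty ∧ signRealization A σ ⊆ S}

/-- The basic closed set `{P = 0}`, `{P ≥ 0}` or `{P ≤ 0}` according to `r = 0, 1, -1`. -/
def basicClosedSet {k : ℕ} (P : MvPolynomial (Fin k) ℝ) (r : SignType) :
    Set (Fin k → ℝ) :=
  match r with
  | SignType.zero => {x | eval x P = 0}
  | SignType.pos => {x | 0 ≤ eval x P}
  | SignType.neg => {x | eval x P ≤ 0}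

/-- `R(σ_+^c)` for a sign condition `σ` of level `m`: inside `S`, relax the equations to
`|P| ≤ ε_{2m}` and the strict inequalities to weak ones. -/
def gvClosedRelaxation {k t : ℕ} (A : Fin t → MvPolynomial (Fin k) ℝ)
    (S : Set (Fin k → ℝ)) (ε : ℕ → ℝ) (σ : Fin t → SignType) : Set (Fin k → ℝ) :=
  {x ∈ S | (∀ i, σ i = 0 → |eval x (A i)| ≤ ε (2 * signLevel σ)) ∧
           (∀ i, σ i = 1 → 0 ≤ eval x (A i)) ∧
           (∀ i, σ i = -1 → eval x (A i) ≤ 0)}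

/-- `R(σ_+^o)` for a sign condition `σ` of level `m`: inside `S`, relax the equations to
`|P| < ε_{2m-1}` and keep the strict inequalities. -/
def gvOpenRelaxation {k t : ℕ} (A : Fin t → MvPolynomial (Fin k) ℝ)
    (S : Set (Fin k → ℝ)) (ε : ℕ → ℝ) (σ : Fin t → SignType) : Set (Fin k → ℝ) :=
  {x ∈ S | (∀ i, σ i = 0 → |eval x (A i)| < ε (2 * signLevel σ - 1)) ∧
           (∀ i, σ i = 1 → 0 < eval x (A i)) ∧
           (∀ i, σ i = -1 → eval x (A i) < 0)}

/-- The Gabrielov-Vorobjov sequence `X^0 = X`,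
`X^{m+1} = (X^m ∪ ⋃_{σ ∈ Σ_m} R(σ_+^c)) \ ⋃_{σ ∈ Sign_m(C,S) ∖ Σ_m} R(σ_+^o)`. -/
def gvSeq {k t : ℕ} (A : Fin t → MvPolynomial (Fin k) ℝ) (S : Set (Fin k → ℝ))
    (ε : ℕ → ℝ) (Sgns : Set (Fin t → SignType)) (X : Set (Fin k → ℝ)) :
    ℕ → Set (Fin k → ℝ)
  | 0 => X
  | m + 1 =>
      (gvSeq A S ε Sgns X m ∪
        ⋃ σ ∈ {σ ∈ Sgns | signLevel σ = m}, gvClosedRelaxation A S ε σ) \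
      ⋃ σ ∈ {σ ∈ signCondOn A S | signLevel σ = m ∧ σ ∉ Sgns},
        gvOpenRelaxation A S ε σ

/-- The sum over all `r`-element sets of indices of the products of the differences of the
corresponding variables. -/
noncomputable def sumDiffProd (R : Type*) [CommRing R] (d r : ℕ) : MvPolynomial (Fin d) R :=
  ∑ I ∈ Finset.powersetCard r Finset.univ, ∏ p ∈ I.offDiag, (X p.1 - X p.2)

lemma sumDiffProd_isSymmetric (R : Type*) [CommRing R] (d r : ℕ) :
    (sumDiffProd R d r).IsSymmetric := by
  intro e
  simp only [sumDiffProd, map_sum, map_prod, map_sub, rename_X]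
  refine Finset.sum_equiv e.finsetCongr (fun I ↦ by simp) fun I _ ↦ ?_
  refine Finset.prod_equiv (e.prodCongr e) (fun p ↦ ?_) (fun p _ ↦ by simp)
  simp

lemma aeval_sumDiffProd {R S : Type*} [CommRing R] [CommRing S] [Algebra R S] {d : ℕ} (r : ℕ)
    (z : Fin d → S) : aeval z (sumDiffProd R d r) =
      ∑ I ∈ Finset.powersetCard r Finset.univ, ∏ p ∈ I.offDiag, (z p.1 - z p.2) := by
  simp [sumDiffProd]

lemma aeval_sumDiffProd_of_lt {R S : Type*} [CommRing R] [CommRing S] [Algebra R S]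
    [DecidableEq S] {d r : ℕ} (z : Fin d → S) (h : (Finset.univ.image z).card < r) :
    aeval z (sumDiffProd R d r) = 0 := by
  rw [aeval_sumDiffProd]
  refine Finset.sum_eq_zero fun I hI ↦ ?_
  obtain ⟨-, hc⟩ := Finset.mem_powersetCard.1 hI
  obtain ⟨i, hi, j, hj, hij, he⟩ := Finset.exists_ne_map_eq_of_card_lt_of_maps_to
    (hc ▸ h) (f := z) (fun a _ ↦ by simp)
  exact Finset.prod_eq_zero (i := (i, j)) (by simp [hi, hj, hij]) (by simp [he])

lemma aeval_sumDiffProd_card_ne_zero {R S : Type*} [CommRing R] [CommRing S] [IsDomain S]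
    [CharZero S] [Algebra R S] [DecidableEq S] {d : ℕ} (z : Fin d → S) :
    aeval z (sumDiffProd R d (Finset.univ.image z).card) ≠ 0 := by
  rw [aeval_sumDiffProd]
  set W := Finset.univ.image z with hW
  set V := ∏ p ∈ W.offDiag, (p.1 - p.2) with hV
  have hV0 : V ≠ 0 := Finset.prod_ne_zero_iff.2 fun p hp ↦
    sub_ne_zero.2 (Finset.mem_offDiag.1 hp).2.2
  have key : ∀ I ∈ Finset.powersetCard W.card (Finset.univ : Finset (Fin d)),
      ∏ p ∈ I.offDiag, (z p.1 - z p.2) = if I.image z = W then V else 0 := by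
    intro I hI
    obtain ⟨-, hc⟩ := Finset.mem_powersetCard.1 hI
    split_ifs with h
    · have hinj : Set.InjOn z I := Finset.card_image_iff.1 (by rw [h, hc])
      rw [hV, ← h]
      refine Finset.prod_bij (fun p _ ↦ (z p.1, z p.2)) ?_ ?_ ?_ (fun _ _ ↦ rfl)
      · intro p hp
        obtain ⟨h1, h2, h3⟩ := Finset.mem_offDiag.1 hp
        exact Finset.mem_offDiag.2 ⟨Finset.mem_image_of_mem _ h1, Finset.mem_image_of_mem _ h2,
          fun e ↦ h3 (hinj h1 h2 e)⟩
      · intro p hp q hq e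
        obtain ⟨h1, h2, h3⟩ := Finset.mem_offDiag.1 hp
        obtain ⟨k1, k2, k3⟩ := Finset.mem_offDiag.1 hq
        obtain ⟨e1, e2⟩ := Prod.mk.inj e
        exact Prod.ext (hinj h1 k1 e1) (hinj h2 k2 e2)
      · rintro ⟨a, b⟩ hab
        obtain ⟨h1, h2, h3⟩ := Finset.mem_offDiag.1 hab
        obtain ⟨i, hi, rfl⟩ := Finset.mem_image.1 h1
        obtain ⟨j, hj, rfl⟩ := Finset.mem_image.1 h2
        exact ⟨(i, j), Finset.mem_offDiag.2 ⟨hi, hj, fun e ↦ h3 (by simp at e; simp [e])⟩, rfl⟩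
    · have hlt : (I.image z).card < I.card := by
        refine lt_of_le_of_ne Finset.card_image_le fun e ↦ h ?_
        exact Finset.eq_of_subset_of_card_le (Finset.image_subset_image (Finset.subset_univ I))
          (by rw [e, hc])
      obtain ⟨i, hi, j, hj, hij, he⟩ := Finset.exists_ne_map_eq_of_card_lt_of_maps_to
        hlt (f := z) (fun a ha ↦ Finset.mem_image_of_mem z ha)
      exact Finset.prod_eq_zero (i := (i, j)) (by simp [hij]; exact ⟨hi, hj⟩) (by simp [he])
  rw [Finset.sum_congr rfl key, ← Finset.sum_filter, Finset.sum_const, nsmul_eq_mul]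
  refine mul_ne_zero (Nat.cast_ne_zero.2 ?_) hV0
  rw [Finset.card_ne_zero]
  obtain ⟨I, -, hinj, hI⟩ := Finset.exists_subset_injOn_image_eq_of_surjOn (f := z)
    (s := Set.univ) (t := W) (by intro w hw; simpa [W] using hw)
  exact ⟨I, Finset.mem_filter.2 ⟨Finset.mem_powersetCard.2 ⟨Finset.subset_univ _, by
    rw [← hI, Finset.card_image_of_injOn hinj]⟩, hI⟩⟩

lemma Multiset.esymm_map_const_mul {R : Type*} [CommRing R] (s : Multiset R) (c : R) (n : ℕ) :
    (s.map (c * ·)).esymm n = c ^ n * s.esymm n := by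
  rw [Multiset.esymm, Multiset.powersetCard_map, Multiset.map_map, Multiset.esymm,
    ← Multiset.sum_map_mul_left]
  congr 1
  refine Multiset.map_congr rfl fun t ht ↦ ?_
  have := Multiset.prod_map_mul (m := t) (f := fun _ ↦ c) (g := id)
  simpa [(Multiset.mem_powersetCard.1 ht).2] using this

/-- The number of distinct complex roots of a real polynomial of given degree is determined by
the vanishing or not of finitely many polynomial expressions in its coefficients. -/
theorem exists_card_roots_invariants (d : ℕ) :
    ∃ 𝒢 : Finset (MvPolynomial (Fin (d + 1)) ℝ), ∀ f g : Polynomial ℝ, f ≠ 0 → g ≠ 0 →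
      f.natDegree = d → g.natDegree = d →
      (∀ G ∈ 𝒢, eval (fun i : Fin (d + 1) ↦ f.coeff i) G = 0 ↔
        eval (fun i : Fin (d + 1) ↦ g.coeff i) G = 0) →
      (f.map (algebraMap ℝ ℂ)).roots.toFinset.card =
        (g.map (algebraMap ℝ ℂ)).roots.toFinset.card := by
  classical
  have hG : ∀ r, ∃ G : MvPolynomial (Fin d) ℝ,
      (aeval fun i : Fin d ↦ esymm (Fin d) ℝ (i + 1)) G = sumDiffProd ℝ d r := by
    intro r
    obtain ⟨G, hG⟩ := esymmAlgHom_surjective (σ := Fin d) (n := d) ℝ (by simp)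
      ⟨sumDiffProd ℝ d r, sumDiffProd_isSymmetric ℝ d r⟩
    refine ⟨G, ?_⟩
    rw [← esymmAlgHom_apply, hG]
  choose G hG using hG
  let Q : ℕ → MvPolynomial (Fin (d + 1)) ℝ := fun r ↦
    aeval (fun i : Fin d ↦ (-1) ^ (i.1 + 1) * X (Fin.last d) ^ i.1 *
      X (⟨d - (i.1 + 1), by omega⟩ : Fin (d + 1))) (G r)
  have key : ∀ f : Polynomial ℝ, f ≠ 0 → f.natDegree = d → ∃ z : Fin d → ℂ,
      (Finset.univ.image z).card = (f.map (algebraMap ℝ ℂ)).roots.toFinset.card ∧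
      ∀ r, aeval z (sumDiffProd ℝ d r) = 0 ↔ eval (fun i : Fin (d + 1) ↦ f.coeff i) (Q r) = 0 := by
    intro f hf0 hfd
    set F := f.map (algebraMap ℝ ℂ) with hF
    have hinj : Function.Injective (algebraMap ℝ ℂ) := (algebraMap ℝ ℂ).injective
    have hFd : F.natDegree = d := by rw [hF, Polynomial.natDegree_map, hfd]
    have hF0 : F.leadingCoeff ≠ 0 := by
      rw [Polynomial.leadingCoeff_ne_zero]; exact (Polynomial.map_ne_zero_iff hinj).2 hf0
    have hcard : F.roots.card = F.natDegree :=
      Polynomial.splits_iff_card_roots.1 (IsAlgClosed.splits F)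
    obtain ⟨w, hw⟩ : ∃ w : Fin d → ℂ, Multiset.map w Finset.univ.val = F.roots := by
      have hl : F.roots.toList.length = d := by simp [hcard, hFd]
      refine ⟨fun i ↦ F.roots.toList.get (i.cast hl.symm), ?_⟩
      conv_rhs => rw [← Multiset.coe_toList F.roots, ← List.ofFn_get F.roots.toList]
      rw [Fin.univ_val_map]
      congr 1
      exact (List.ofFn_congr hl _).symm
    refine ⟨fun i ↦ F.leadingCoeff * w i, ?_, fun r ↦ ?_⟩
    · have h1 : Finset.univ.image (fun i ↦ F.leadingCoeff * w i) =
          (Finset.univ.image w).image (F.leadingCoeff * ·) := by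
        rw [Finset.image_image]; rfl
      rw [h1, Finset.card_image_of_injective _ (mul_right_injective₀ hF0), ← hw]
      rfl
    · have h1 : aeval (fun i ↦ F.leadingCoeff * w i) (sumDiffProd ℝ d r) =
          algebraMap ℝ ℂ (eval (fun i : Fin (d + 1) ↦ f.coeff i) (Q r)) := by
        have e1 : (aeval fun i ↦ F.leadingCoeff * w i) (sumDiffProd ℝ d r) =
            (aeval fun i : Fin d ↦ F.leadingCoeff ^ (i.1 + 1) * F.roots.esymm (i.1 + 1)) (G r) := by
          rw [← hG, ← AlgHom.comp_apply, comp_aeval]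
          congr 2
          ext i
          rw [aeval_esymm_eq_multiset_esymm, ← hw, ← Multiset.esymm_map_const_mul,
            Multiset.map_map]
          rfl
        rw [e1]
        have e2 : algebraMap ℝ ℂ (eval (fun i : Fin (d + 1) ↦ f.coeff i) (Q r)) =
            aeval (fun i : Fin (d + 1) ↦ algebraMap ℝ ℂ (f.coeff i)) (Q r) := by
          rw [← coe_aeval_eq_eval]
          exact (MvPolynomial.aeval_algebraMap_apply _ _ _).symm
        rw [e2, ← AlgHom.comp_apply, comp_aeval]
        congr 2
        ext i
        have hv := Polynomial.coeff_eq_esymm_roots_of_card hcard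
          (k := d - (i.1 + 1)) (by rw [hFd]; omega)
        rw [hFd, show d - (d - (i.1 + 1)) = i.1 + 1 by omega] at hv
        simp only [map_mul, map_pow, map_neg, map_one, aeval_X]
        have hlc : (algebraMap ℝ ℂ) (f.coeff (Fin.last d : Fin (d + 1)).1) = F.leadingCoeff := by
          rw [Polynomial.leadingCoeff, hFd, hF, Polynomial.coeff_map]; rfl
        have hco : (algebraMap ℝ ℂ) (f.coeff (d - (i.1 + 1))) = F.coeff (d - (i.1 + 1)) := by
          rw [hF, Polynomial.coeff_map]
        rw [hlc, hco, hv]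
        have : ((-1 : ℂ) ^ (i.1 + 1)) * (-1) ^ (i.1 + 1) = 1 := by rw [← mul_pow]; simp
        linear_combination (-(F.leadingCoeff ^ (i.1 + 1) * F.roots.esymm (i.1 + 1))) * this
      rw [h1, map_eq_zero]
  refine ⟨(Finset.range (d + 1)).image Q, fun f g hf hg hfd hgd h ↦ ?_⟩
  obtain ⟨z, hz, hzQ⟩ := key f hf hfd
  obtain ⟨w, hw, hwQ⟩ := key g hg hgd
  have hzd : ∀ v : Fin d → ℂ, (Finset.univ.image v).card < d + 1 := fun v ↦
    Nat.lt_succ_of_le (by simpa using Finset.card_image_le (s := Finset.univ) (f := v))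
  rw [← hz, ← hw]
  have agree : ∀ r < d + 1, aeval z (sumDiffProd ℝ d r) = 0 ↔ aeval w (sumDiffProd ℝ d r) = 0 :=
    fun r hr ↦ by
      rw [hzQ, hwQ]
      exact h _ (Finset.mem_image_of_mem _ (Finset.mem_range.2 hr))
  apply le_antisymm
  · by_contra! hlt
    exact aeval_sumDiffProd_card_ne_zero (R := ℝ) z
      ((agree _ (hzd z)).2 (aeval_sumDiffProd_of_lt w hlt))
  · by_contra! hlt
    exact aeval_sumDiffProd_card_ne_zero (R := ℝ) w
      ((agree _ (hzd w)).1 (aeval_sumDiffProd_of_lt z hlt))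

section Shear

variable {K : Type*} [Field K] {n : ℕ}

/-- The substitution `X_i ↦ X_i + X_0 ^ (N ^ i)` for `i ≠ 0`, fixing `X_0`. -/
noncomputable def shear (K : Type*) [Field K] (n N : ℕ) :
    MvPolynomial (Fin (n + 1)) K →ₐ[K] MvPolynomial (Fin (n + 1)) K :=
  aeval fun i ↦ if i = 0 then X 0 else X i + X 0 ^ N ^ i.1

lemma sum_pow_mul_ne {N : ℕ} (hN : 1 < N) {v w : Fin (n + 1) →₀ ℕ} (hv : ∀ i, v i < N)
    (hw : ∀ i, w i < N) (ne : v ≠ w) :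
    ∑ x : Fin (n + 1), N ^ x.1 * v x ≠ ∑ x : Fin (n + 1), N ^ x.1 * w x := by
  intro h
  refine ne <| Finsupp.ext <| congrFun <| List.ofFn_inj.mp ?_
  apply Nat.ofDigits_inj_of_len_eq hN (by simp) (by grind) (by grind)
  simpa only [Nat.ofDigits_eq_sum_mapIdx, List.mapIdx_eq_ofFn, List.get_ofFn, List.length_ofFn,
    Fin.val_cast, mul_comm, List.sum_ofFn] using! h

lemma natDegree_finSuccEquiv_shear_monomial {N : ℕ} (hN : 0 < N) (v : Fin (n + 1) →₀ ℕ) {a : K} (ha : a ≠ 0) :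
    (finSuccEquiv K n (shear K n N (monomial v a))).natDegree =
      ∑ i : Fin (n + 1), N ^ i.1 * v i := by
  rw [monomial_eq, Finsupp.prod_pow v fun a ↦ X a]
  simp only [Fin.prod_univ_succ, Fin.sum_univ_succ, map_mul, map_prod, map_pow, shear,
    MvPolynomial.aeval_C, MvPolynomial.aeval_X, if_pos, Fin.succ_ne_zero,
    ite_false, map_add, finSuccEquiv_X_zero, finSuccEquiv_X_succ, algebraMap_eq]
  have h (i : Fin n) :
      (Polynomial.C (X (R := K) i) + Polynomial.X ^ N ^ (i.succ).1) ^ v i.succ ≠ 0 :=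
    pow_ne_zero (v i.succ) (Polynomial.leadingCoeff_ne_zero.mp <| by
      rw [add_comm, Polynomial.leadingCoeff_X_pow_add_C (Nat.pow_pos hN)]
      exact one_ne_zero)
  rw [Polynomial.natDegree_mul (by simp [ha]) (mul_ne_zero (by simp)
    (Finset.prod_ne_zero_iff.mpr (fun i _ ↦ h i))), Polynomial.natDegree_mul (by simp)
    (Finset.prod_ne_zero_iff.mpr (fun i _ ↦ h i)),
    Polynomial.natDegree_prod _ _ (fun i _ ↦ h i), natDegree_finSuccEquiv, degreeOf_C]
  simpa only [Polynomial.natDegree_pow, zero_add, Polynomial.natDegree_X, mul_one, Fin.val_zero,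
    pow_zero, one_mul, add_right_inj] using Finset.sum_congr rfl (fun i _ ↦ by
    rw [add_comm (Polynomial.C _), Polynomial.natDegree_X_pow_add_C, mul_comm])

lemma leadingCoeff_finSuccEquiv_shear_monomial {N : ℕ} (hN : 0 < N) (v : Fin (n + 1) →₀ ℕ) (a : K) :
    (finSuccEquiv K n (shear K n N (monomial v a))).leadingCoeff = C a := by
  rw [monomial_eq, Finsupp.prod_fintype]
  · simp only [map_mul, map_prod, Polynomial.leadingCoeff_mul, Polynomial.leadingCoeff_prod]
    rw [algHom_C, algebraMap_eq, finSuccEquiv_apply, eval₂Hom_C, RingHom.coe_comp]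
    simp only [Function.comp_apply, Polynomial.leadingCoeff_C, map_pow,
      Polynomial.leadingCoeff_pow]
    have : ∀ j, ((finSuccEquiv K n) (shear K n N (X j))).leadingCoeff = 1 := fun j ↦ by
      by_cases h : j = 0
      · simp [h, shear, finSuccEquiv_apply]
      · simp only [shear, aeval_X, if_neg h, map_add, map_pow]
        obtain ⟨i, rfl⟩ := Fin.exists_succ_eq.mpr h
        rw [finSuccEquiv_X_succ, finSuccEquiv_X_zero, add_comm,
          Polynomial.leadingCoeff_X_pow_add_C (Nat.pow_pos hN)]
    simp only [this, one_pow, Finset.prod_const_one, mul_one]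
  exact fun i ↦ pow_zero _

/-- For a nonzero polynomial and `N` large, the shear makes the leading coefficient with respect to
the first variable a unit. -/
lemma isUnit_leadingCoeff_finSuccEquiv_shear {f : MvPolynomial (Fin (n + 1)) K} (fne : f ≠ 0) :
    IsUnit (finSuccEquiv K n (shear K n (2 + f.totalDegree) f)).leadingCoeff := by
  have hN : 0 < 2 + f.totalDegree := by lia
  set N := 2 + f.totalDegree
  set h := fun w ↦ (monomial w) (coeff w f)
  have hlt : ∀ w ∈ f.support, ∀ i, w i < N := fun w hw i ↦
    lt_of_le_of_lt ((monomial_le_degreeOf i hw).trans (degreeOf_le_totalDegree f i)) (by lia)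
  obtain ⟨v, vin, vs⟩ := Finset.exists_max_image f.support
    (fun v ↦ ((finSuccEquiv K n (shear K n N (h v))).natDegree)) (support_nonempty.mpr fne)
  replace vs : ∀ x ∈ f.support \ {v}, (finSuccEquiv K n (shear K n N (h x))).degree <
      (finSuccEquiv K n (shear K n N (h v))).degree := by
    intro x hx
    obtain ⟨h1, h2⟩ := Finset.mem_sdiff.mp hx
    apply Polynomial.degree_lt_degree <| lt_of_le_of_ne (vs x h1) ?_
    rw [natDegree_finSuccEquiv_shear_monomial hN _ (mem_support_iff.1 h1),
      natDegree_finSuccEquiv_shear_monomial hN _ (mem_support_iff.1 vin)]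
    exact sum_pow_mul_ne (by lia) (hlt x h1) (hlt v vin) (by simpa using h2)
  have coeff : (finSuccEquiv K n (shear K n N (h v + ∑ x ∈ f.support \ {v}, h x))).leadingCoeff =
      (finSuccEquiv K n (shear K n N (h v))).leadingCoeff := by
    simp only [map_add, map_sum]
    rw [add_comm]
    apply Polynomial.leadingCoeff_add_of_degree_lt <|
      (lt_of_le_of_lt <| Polynomial.degree_sum_le _ _) ?_
    have h2 : finSuccEquiv K n (shear K n N (h v)) ≠ 0 := by
      rw [← Polynomial.leadingCoeff_ne_zero, leadingCoeff_finSuccEquiv_shear_monomial hN]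
      simpa using mem_support_iff.mp vin
    exact (Finset.sup_lt_iff <| Ne.bot_lt (fun x ↦ h2 <| Polynomial.degree_eq_bot.mp x)).mpr vs
  have hsum : f = h v + ∑ x ∈ f.support \ {v}, h x := by
    rw [← Finset.sum_eq_add_sum_sdiff_singleton_of_mem vin h]
    exact f.support_sum_monomial_coeff.symm
  rw [hsum, coeff, leadingCoeff_finSuccEquiv_shear_monomial hN]
  exact (mem_support_iff.mp vin).isUnit.map MvPolynomial.C

end Shear

/-- The map of points corresponding to `shear`, and its inverse. -/
def shearHomeomorph (n N : ℕ) : (Fin (n + 1) → ℝ) ≃ₜ (Fin (n + 1) → ℝ) where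
  toFun x i := if i = 0 then x 0 else x i + x 0 ^ N ^ i.1
  invFun x i := if i = 0 then x 0 else x i - x 0 ^ N ^ i.1
  left_inv x := by ext i; by_cases h : i = 0 <;> simp [h]
  right_inv x := by ext i; by_cases h : i = 0 <;> simp [h]
  continuous_toFun := by
    refine continuous_pi fun i ↦ ?_
    by_cases h : i = 0 <;> simp only [h, if_true, if_false] <;> fun_prop
  continuous_invFun := by
    refine continuous_pi fun i ↦ ?_
    by_cases h : i = 0 <;> simp only [h, if_true, if_false] <;> fun_prop

lemma eval_shear (n N : ℕ) (x : Fin (n + 1) → ℝ) (p : MvPolynomial (Fin (n + 1)) ℝ) :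
    eval x (shear ℝ n N p) = eval (shearHomeomorph n N x) p := by
  have : (eval x).comp (shear ℝ n N : _ →+* _) = eval (shearHomeomorph n N x) := by
    ext i
    · simp [shear]
    · by_cases h : i = 0 <;> simp [shear, shearHomeomorph, h]
  exact congrArg (fun g ↦ g p) this

/-- After a polynomial change of coordinates, finitely many nonzero polynomials have constant
leading coefficients with respect to the first variable. -/
lemma exists_homeomorph_leadingCoeff {n : ℕ} (𝓕 : Finset (MvPolynomial (Fin (n + 1)) ℝ)) :
    ∃ (τ : MvPolynomial (Fin (n + 1)) ℝ →ₐ[ℝ] MvPolynomial (Fin (n + 1)) ℝ)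
      (θ : (Fin (n + 1) → ℝ) ≃ₜ (Fin (n + 1) → ℝ)),
      (∀ x p, eval x (τ p) = eval (θ x) p) ∧
      ∀ p ∈ 𝓕, p ≠ 0 → ∃ c : ℝ, c ≠ 0 ∧ (finSuccEquiv ℝ n (τ p)).leadingCoeff = C c := by
  classical
  set F := ∏ p ∈ 𝓕 with p ≠ 0, p with hF
  have hF0 : F ≠ 0 := Finset.prod_ne_zero_iff.2 fun p hp ↦ (Finset.mem_filter.1 hp).2
  refine ⟨shear ℝ n _, shearHomeomorph n _, eval_shear n (2 + F.totalDegree), fun p hp hp0 ↦ ?_⟩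
  have h := isUnit_leadingCoeff_finSuccEquiv_shear hF0
  rw [show shear ℝ n (2 + F.totalDegree) F = ∏ p ∈ 𝓕 with p ≠ 0, shear ℝ n (2 + F.totalDegree) p by
    conv_lhs => rw [hF]
    rw [map_prod], map_prod, Polynomial.leadingCoeff_prod] at h
  have h1 : IsUnit (finSuccEquiv ℝ n (shear ℝ n (2 + F.totalDegree) p)).leadingCoeff :=
    isUnit_of_dvd_unit (Finset.dvd_prod_of_mem
      (fun p ↦ (finSuccEquiv ℝ n (shear ℝ n (2 + F.totalDegree) p)).leadingCoeff)
      (Finset.mem_filter.2 ⟨hp, hp0⟩)) h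
  obtain ⟨c, hc, hc'⟩ := (MvPolynomial.isUnit_iff_eq_C_of_isReduced).1 h1
  exact ⟨c, hc.ne_zero, hc'⟩

/-- Evaluation of a polynomial in a parameter and `k` variables. -/
noncomputable def parEval {k : ℕ} (s : ℝ) (x : Fin k → ℝ) :
    Polynomial (MvPolynomial (Fin k) ℝ) →+* ℝ :=
  Polynomial.eval₂RingHom (eval x) s

lemma parEval_apply {k : ℕ} (s : ℝ) (x : Fin k → ℝ) (P : Polynomial (MvPolynomial (Fin k) ℝ)) :
    parEval s x P = P.eval₂ (eval x) s := rfl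

lemma continuous_parEval {k : ℕ} (P : Polynomial (MvPolynomial (Fin k) ℝ)) :
    Continuous fun q : ℝ × (Fin k → ℝ) ↦ parEval q.1 q.2 P := by
  simp only [parEval_apply, Polynomial.eval₂_eq_sum_range]
  refine continuous_finsetSum _ fun i _ ↦ ?_
  exact ((MvPolynomial.continuous_eval _).comp continuous_snd).mul (continuous_fst.pow i)

lemma coeff_coeff_swap {R : Type*} [CommRing R] (Q : Polynomial (Polynomial R)) (d n : ℕ) :
    ((Polynomial.Bivariate.swap Q).coeff d).coeff n = (Q.coeff n).coeff d := by
  induction Q using Polynomial.induction_on' with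
  | add p q hp hq => simp [hp, hq]
  | monomial m f =>
    rw [Polynomial.Bivariate.swap_monomial, Polynomial.coeff_mul_C, Polynomial.coeff_map,
      Polynomial.coeff_C_mul, Polynomial.coeff_X_pow, Polynomial.coeff_monomial]
    by_cases h : m = n
    · simp [h]
    · simp [h, Ne.symm h]

/-- Regard a polynomial in a parameter and `k + 1` variables as a polynomial in the first variable
over the polynomials in the parameter and the other variables. -/
noncomputable def firstVar {k : ℕ} (P : Polynomial (MvPolynomial (Fin (k + 1)) ℝ)) :
    Polynomial (Polynomial (MvPolynomial (Fin k) ℝ)) :=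
  Polynomial.Bivariate.swap (P.map (finSuccEquiv ℝ k : _ →+* _))

lemma coeff_coeff_firstVar {k : ℕ} (P : Polynomial (MvPolynomial (Fin (k + 1)) ℝ)) (d n : ℕ) :
    ((firstVar P).coeff d).coeff n = (finSuccEquiv ℝ k (P.coeff n)).coeff d := by
  rw [firstVar, coeff_coeff_swap, Polynomial.coeff_map]
  rfl

lemma eval_map_firstVar {k : ℕ} (P : Polynomial (MvPolynomial (Fin (k + 1)) ℝ)) (s T : ℝ)
    (x : Fin k → ℝ) :
    ((firstVar P).map (parEval s x)).eval T = parEval s (Fin.cons T x) P := by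
  induction P using Polynomial.induction_on' with
  | add p q hp hq =>
    rw [map_add, ← hp, ← hq]
    simp [firstVar]
  | monomial m f =>
    rw [firstVar, Polynomial.map_monomial, Polynomial.Bivariate.swap_monomial, parEval_apply,
      Polynomial.eval₂_monomial, eval_eq_eval_mv_eval', Polynomial.map_mul, Polynomial.map_map,
      Polynomial.map_C, Polynomial.eval_mul, Polynomial.eval_C]
    have h1 : (parEval s x).comp Polynomial.C = eval x := by
      ext <;> simp [parEval_apply]
    rw [h1]
    congr 1
    simp [parEval_apply]

/-- Each coefficient with respect to the parameter is zero or has constant leading coefficient. -/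
def RegularFirstVar {k : ℕ} (p : Polynomial (Polynomial (MvPolynomial (Fin k) ℝ))) : Prop :=
  ∀ n, (∀ d, (p.coeff d).coeff n = 0) ∨
    ∃ D, ∃ c : ℝ, c ≠ 0 ∧ (p.coeff D).coeff n = C c ∧ ∀ d > D, (p.coeff d).coeff n = 0

lemma RegularFirstVar.derivative {k : ℕ} {p : Polynomial (Polynomial (MvPolynomial (Fin k) ℝ))}
    (hp : RegularFirstVar p) : RegularFirstVar (Polynomial.derivative p) := by
  have hco : ∀ d n, ((Polynomial.derivative p).coeff d).coeff n =
      (p.coeff (d + 1)).coeff n * C ((d : ℝ) + 1) := fun d n ↦ by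
    have : ((d : Polynomial (MvPolynomial (Fin k) ℝ)) + 1) =
      Polynomial.C (C ((d : ℝ) + 1)) := by simp
    rw [Polynomial.coeff_derivative, this, Polynomial.coeff_mul_C]
  intro n
  simp only [hco]
  rcases hp n with h | ⟨D, c, hc, hD, h⟩
  · exact Or.inl fun d ↦ by simp [h]
  · cases D with
    | zero => exact Or.inl fun d ↦ by rw [h _ (by lia), zero_mul]
    | succ D =>
      refine Or.inr ⟨D, c * (D + 1), mul_ne_zero hc (by positivity), ?_, fun d hd ↦ ?_⟩
      · rw [hD, ← C_mul]
      · rw [h _ (by lia), zero_mul]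

lemma RegularFirstVar.exists_leadingCoeff {k : ℕ}
    {p : Polynomial (Polynomial (MvPolynomial (Fin k) ℝ))}
    (hp : RegularFirstVar p) (hp0 : p ≠ 0) :
    ∃ u : Polynomial ℝ, u ≠ 0 ∧ ∀ s x, parEval s x p.leadingCoeff = u.eval s := by
  have h1 : ∀ n, ∃ c : ℝ, p.leadingCoeff.coeff n = C c := by
    intro n
    rcases hp n with h | ⟨D, c, hc, hD, h⟩
    · exact ⟨0, by rw [Polynomial.leadingCoeff, h, C_0]⟩
    · rcases lt_trichotomy p.natDegree D with hlt | heq | hgt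
      · rw [Polynomial.coeff_eq_zero_of_natDegree_lt hlt] at hD
        exact absurd ((C_eq_zero).1 hD.symm) hc
      · exact ⟨c, by rw [Polynomial.leadingCoeff, heq, hD]⟩
      · exact ⟨0, by rw [Polynomial.leadingCoeff, h _ hgt, C_0]⟩
  have h2 : p.leadingCoeff = (p.leadingCoeff.map constantCoeff).map C := by
    ext1 n
    obtain ⟨c, hc⟩ := h1 n
    simp [Polynomial.coeff_map, hc]
  refine ⟨p.leadingCoeff.map constantCoeff, fun h ↦ ?_, fun s x ↦ ?_⟩
  · rw [h, Polynomial.map_zero, Polynomial.leadingCoeff_eq_zero] at h2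
    exact hp0 h2
  · conv_lhs => rw [h2, parEval_apply, Polynomial.eval₂_map]
    have : (eval x).comp (C : ℝ →+* MvPolynomial (Fin k) ℝ) = RingHom.id ℝ := by ext; simp
    rw [this, Polynomial.eval₂_id]

lemma RegularFirstVar.exists_normalization {k : ℕ}
    {p : Polynomial (Polynomial (MvPolynomial (Fin k) ℝ))}
    (hp : RegularFirstVar p) (hp0 : p ≠ 0) :
    ∃ m q, p = Polynomial.C (Polynomial.X ^ m) * q ∧ ∀ x, q.map (parEval 0 x) ≠ 0 := by
  classical
  have hex : ∃ n d, (p.coeff d).coeff n ≠ 0 := by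
    by_contra! h
    exact hp0 (by ext1 d; ext1 n; simp [h n d])
  set m := Nat.find hex with hm
  have hdvd : Polynomial.C (Polynomial.X ^ m) ∣ p := by
    rw [Polynomial.C_dvd_iff_dvd_coeff]
    intro d
    rw [Polynomial.X_pow_dvd_iff]
    intro n hn
    by_contra h
    exact Nat.find_min hex hn ⟨d, h⟩
  obtain ⟨q, hq⟩ := hdvd
  refine ⟨m, q, hq, fun x h ↦ ?_⟩
  rcases hp m with h0 | ⟨D, c, hc, hD, -⟩
  · obtain ⟨d, hd⟩ := Nat.find_spec hex
    exact hd (h0 d)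
  · have h1 : (p.coeff D).coeff m = (q.coeff D).coeff 0 := by
      rw [hq, Polynomial.coeff_C_mul]
      simpa using Polynomial.coeff_X_pow_mul (q.coeff D) m 0
    have h2 := congrArg (fun r ↦ Polynomial.coeff r D) h
    simp only [Polynomial.coeff_map, Polynomial.coeff_zero] at h2
    have h3 : parEval 0 x (q.coeff D) = eval x ((q.coeff D).coeff 0) := by
      rw [parEval_apply, Polynomial.eval₂_at_zero]
    rw [h3, ← h1, hD, eval_C] at h2
    exact hc h2

lemma regularFirstVar_firstVar {k : ℕ} {P : Polynomial (MvPolynomial (Fin (k + 1)) ℝ)}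
    (h : ∀ n, P.coeff n ≠ 0 → ∃ c : ℝ, c ≠ 0 ∧
      (finSuccEquiv ℝ k (P.coeff n)).leadingCoeff = C c) : RegularFirstVar (firstVar P) := by
  intro n
  simp only [coeff_coeff_firstVar]
  by_cases h0 : P.coeff n = 0
  · exact Or.inl fun d ↦ by simp [h0]
  · obtain ⟨c, hc, hl⟩ := h n h0
    exact Or.inr ⟨_, c, hc, hl, fun d hd ↦ Polynomial.coeff_eq_zero_of_natDegree_lt hd⟩

lemma firstVar_ne_zero {k : ℕ} {P : Polynomial (MvPolynomial (Fin (k + 1)) ℝ)} (h : P ≠ 0) :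
    firstVar P ≠ 0 := by
  contrapose! h
  ext1 n
  have : finSuccEquiv ℝ k (P.coeff n) = 0 := by
    ext1 d
    rw [← coeff_coeff_firstVar, h]; simp
  simpa using this

/-- A finite family of univariate polynomials depending on a parameter and a point, closed under
differentiation up to nonzero factors. -/
structure FibreFamily {E ι : Type*} [TopologicalSpace E] (s₀ : ℝ) (L : Set E)
    (g : ι → ℝ → E → Polynomial ℝ) : Prop where
  cont : ∀ i n, Continuous fun q : ℝ × E ↦ (g i q.1 q.2).coeff n
  bound : ∃ d, ∀ i s x, (g i s x).natDegree ≤ d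
  ne_zero : ∀ i, ∀ s ∈ Icc 0 s₀, ∀ x ∈ L, g i s x ≠ 0
  deg : ∀ i, ∃ d, ∀ s ∈ Ioc 0 s₀, ∀ x ∈ L, (g i s x).natDegree = d
  der : ∀ i, (∀ s ∈ Ioc 0 s₀, ∀ x ∈ L, Polynomial.derivative (g i s x) = 0) ∨
    ∃ j, ∀ s ∈ Ioc 0 s₀, ∀ x ∈ L, ∃ c, c ≠ 0 ∧
      Polynomial.derivative (g i s x) = Polynomial.C c * g j s x

lemma FibreFamily.mono {E ι : Type*} [TopologicalSpace E] {s₀ s₁ : ℝ} {L L' : Set E}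
    {g : ι → ℝ → E → Polynomial ℝ} (h : FibreFamily s₀ L g) (hs : s₁ ≤ s₀) (hL : L' ⊆ L) :
    FibreFamily s₁ L' g where
  cont := h.cont
  bound := h.bound
  ne_zero i s hs' x hx := h.ne_zero i s ⟨hs'.1, hs'.2.trans hs⟩ x (hL hx)
  deg i := by
    obtain ⟨d, hd⟩ := h.deg i
    exact ⟨d, fun s hs' x hx ↦ hd s ⟨hs'.1, hs'.2.trans hs⟩ x (hL hx)⟩
  der i := by
    rcases h.der i with hd | ⟨j, hd⟩
    · exact Or.inl fun s hs' x hx ↦ hd s ⟨hs'.1, hs'.2.trans hs⟩ x (hL hx)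
    · exact Or.inr ⟨j, fun s hs' x hx ↦ hd s ⟨hs'.1, hs'.2.trans hs⟩ x (hL hx)⟩

lemma Polynomial.exists_pos_forall_eval_ne_zero {u : Polynomial ℝ} (hu : u ≠ 0) :
    ∃ s₀ > 0, ∀ s ∈ Ioc 0 s₀, u.eval s ≠ 0 := by
  have hfin : (u.rootSet ℝ ∩ Ioi 0).Finite := (u.rootSet_finite ℝ).inter_of_left _
  have : ∀ᶠ s in nhdsWithin (0 : ℝ) (Ioi 0), s ∉ u.rootSet ℝ ∩ Ioi 0 :=
    mem_nhdsWithin_of_mem_nhds (hfin.isClosed.isOpen_compl.mem_nhds (by simp))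
  obtain ⟨δ, hδ, h⟩ := mem_nhdsGT_iff_exists_Ioc_subset.1 this
  refine ⟨δ, hδ, fun s hs h0 ↦ h hs ⟨?_, hs.1⟩⟩
  rw [Polynomial.mem_rootSet]
  exact ⟨hu, by simpa using h0⟩

/-- A finite family of polynomials in a parameter and `k + 1` variables which is regular with
respect to the first variable gives rise to a fibre family; the number of distinct complex roots of
the product is governed by finitely many polynomials in the parameter and `k` variables. -/
theorem exists_fibreFamily {k : ℕ} (𝓐 : Finset (Polynomial (MvPolynomial (Fin (k + 1)) ℝ)))
    (hreg : ∀ P ∈ 𝓐, ∀ n, P.coeff n ≠ 0 → ∃ c : ℝ, c ≠ 0 ∧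
      (finSuccEquiv ℝ k (P.coeff n)).leadingCoeff = C c) (h0 : ∀ P ∈ 𝓐, P ≠ 0) :
    ∃ (ι : Type) (_ : Fintype ι) (g : ι → ℝ → (Fin k → ℝ) → Polynomial ℝ) (s₀ : ℝ),
      0 < s₀ ∧ FibreFamily s₀ univ g ∧
      (∀ P ∈ 𝓐, ∃ i n, ∀ s x T, parEval s (Fin.cons T x) P = s ^ n * (g i s x).eval T) ∧
      ∃ 𝓑 : Finset (Polynomial (MvPolynomial (Fin k) ℝ)), ∀ s ∈ Ioc 0 s₀, ∀ s' ∈ Ioc 0 s₀,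
        ∀ x x', (∀ b ∈ 𝓑, parEval s x b = 0 ↔ parEval s' x' b = 0) →
        ((∏ i, g i s x).map (algebraMap ℝ ℂ)).roots.toFinset.card =
          ((∏ i, g i s' x').map (algebraMap ℝ ℂ)).roots.toFinset.card := by
  classical
  let 𝓓 : Finset (Polynomial (Polynomial (MvPolynomial (Fin k) ℝ))) :=
    (𝓐.biUnion fun P ↦ (Finset.range ((firstVar P).natDegree + 1)).image
      fun j ↦ Polynomial.derivative^[j] (firstVar P)).filter (· ≠ 0)
  have hD : ∀ p : 𝓓, RegularFirstVar p.1 ∧ p.1 ≠ 0 := by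
    rintro ⟨p, hp⟩
    obtain ⟨hp, hp0⟩ := Finset.mem_filter.1 hp
    obtain ⟨P, hP, hp⟩ := Finset.mem_biUnion.1 hp
    obtain ⟨j, -, rfl⟩ := Finset.mem_image.1 hp
    refine ⟨?_, hp0⟩
    have : ∀ j, RegularFirstVar (Polynomial.derivative^[j] (firstVar P)) := fun j ↦ by
      induction j with
      | zero => exact regularFirstVar_firstVar (hreg P hP)
      | succ j ih => rw [Function.iterate_succ_apply']; exact ih.derivative
    exact this j
  have hDer : ∀ p : 𝓓, Polynomial.derivative p.1 ≠ 0 → Polynomial.derivative p.1 ∈ 𝓓 := by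
    rintro ⟨p, hp⟩ hd
    obtain ⟨hp, hp0⟩ := Finset.mem_filter.1 hp
    obtain ⟨P, hP, hp⟩ := Finset.mem_biUnion.1 hp
    obtain ⟨j, hj, rfl⟩ := Finset.mem_image.1 hp
    refine Finset.mem_filter.2 ⟨Finset.mem_biUnion.2 ⟨P, hP, Finset.mem_image.2 ⟨j + 1, ?_, ?_⟩⟩, hd⟩
    · by_contra hj'
      refine hd ?_
      simp only [Finset.mem_range, not_lt] at hj'
      simp only
      rw [← Function.iterate_succ_apply' (f := Polynomial.derivative)]
      exact Polynomial.iterate_derivative_eq_zero hj'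
    · rw [Function.iterate_succ_apply']
  choose u hu0 hu using fun p : 𝓓 ↦ (hD p).1.exists_leadingCoeff (hD p).2
  choose m q hq hq0 using fun p : 𝓓 ↦ (hD p).1.exists_normalization (hD p).2
  obtain ⟨s₀, hs₀, hs⟩ := Polynomial.exists_pos_forall_eval_ne_zero
    (Finset.prod_ne_zero_iff.2 fun p (_ : p ∈ (Finset.univ : Finset 𝓓)) ↦ hu0 p)
  have hmap : ∀ (p : 𝓓) s x, p.1.map (parEval s x) =
      Polynomial.C (s ^ m p) * (q p).map (parEval s x) := fun p s x ↦ by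
    conv_lhs => rw [hq p]
    simp [Polynomial.map_mul, parEval_apply]
  have hlc : ∀ p : 𝓓, ∀ s ∈ Ioc 0 s₀, ∀ x, parEval s x p.1.leadingCoeff ≠ 0 := fun p s h x ↦ by
    rw [hu]
    have := hs s h
    rw [Polynomial.eval_prod] at this
    exact Finset.prod_ne_zero_iff.1 this p (Finset.mem_univ _)
  have hqlc : ∀ p : 𝓓, ∀ s ∈ Ioc 0 s₀, ∀ x, parEval s x (q p).leadingCoeff ≠ 0 := fun p s h x h' ↦ by
    refine hlc p s h x ?_
    rw [hq p, Polynomial.leadingCoeff_mul, map_mul, h', mul_zero]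
  let g : 𝓓 → ℝ → (Fin k → ℝ) → Polynomial ℝ := fun p s x ↦ (q p).map (parEval s x)
  have hgdeg : ∀ p : 𝓓, ∀ s ∈ Ioc 0 s₀, ∀ x, (g p s x).natDegree = (q p).natDegree :=
    fun p s h x ↦ Polynomial.natDegree_map_of_leadingCoeff_ne_zero _ (hqlc p s h x)
  have hgne : ∀ p : 𝓓, ∀ s ∈ Ioc 0 s₀, ∀ x, g p s x ≠ 0 := fun p s h x h' ↦ by
    refine hqlc p s h x ?_
    have := congrArg (fun r ↦ Polynomial.coeff r (q p).natDegree) h'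
    simpa [g, Polynomial.coeff_map] using this
  refine ⟨𝓓, inferInstance, g, s₀, hs₀, ⟨?_, ?_, ?_, ?_, ?_⟩, ?_, ?_⟩
  · intro p n
    simp only [g, Polynomial.coeff_map]
    exact continuous_parEval _
  · refine ⟨Finset.univ.sup fun p ↦ (q p).natDegree, fun p s x ↦ ?_⟩
    exact Polynomial.natDegree_map_le.trans
      (Finset.le_sup (f := fun p ↦ (q p).natDegree) (Finset.mem_univ p))
  · intro p s h x _
    rcases h.1.eq_or_lt with rfl | h1
    · exact hq0 p x
    · exact hgne p s ⟨h1, h.2⟩ x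
  · exact fun p ↦ ⟨_, fun s h x _ ↦ hgdeg p s h x⟩
  · intro p
    by_cases hd : Polynomial.derivative p.1 = 0
    · refine Or.inl fun s h x _ ↦ ?_
      have h1 := congrArg (Polynomial.map (parEval s x)) hd
      rw [← Polynomial.derivative_map, hmap, Polynomial.derivative_C_mul, Polynomial.map_zero] at h1
      exact (mul_eq_zero.1 h1).resolve_left (by simpa using pow_ne_zero _ h.1.ne')
    · refine Or.inr ⟨⟨_, hDer p hd⟩, fun s h x _ ↦ ?_⟩
      have h1 := hmap ⟨_, hDer p hd⟩ s x
      rw [← Polynomial.derivative_map, hmap, Polynomial.derivative_C_mul] at h1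
      have h2 : Polynomial.C (s ^ m p) ≠ 0 := by simpa using pow_ne_zero _ h.1.ne'
      refine ⟨(s ^ m p)⁻¹ * s ^ m ⟨_, hDer p hd⟩, ?_, ?_⟩
      · exact mul_ne_zero (inv_ne_zero (pow_ne_zero _ h.1.ne')) (pow_ne_zero _ h.1.ne')
      · apply mul_left_cancel₀ h2
        rw [h1, ← mul_assoc, ← Polynomial.C_mul, mul_inv_cancel_left₀ (pow_ne_zero _ h.1.ne')]
  · intro P hP
    have hmem : firstVar P ∈ 𝓓 := Finset.mem_filter.2 ⟨Finset.mem_biUnion.2 ⟨P, hP,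
      Finset.mem_image.2 ⟨0, by simp, rfl⟩⟩, firstVar_ne_zero (h0 P hP)⟩
    refine ⟨⟨_, hmem⟩, m ⟨_, hmem⟩, fun s x T ↦ ?_⟩
    rw [← eval_map_firstVar, hmap ⟨_, hmem⟩, Polynomial.eval_mul, Polynomial.eval_C]
  · obtain ⟨𝒢, h𝒢⟩ := exists_card_roots_invariants (∑ p, (q p).natDegree)
    set F := ∏ p, q p with hF
    refine ⟨𝒢.image fun G ↦ aeval (fun i : Fin (_ + 1) ↦ F.coeff i) G,
      fun s hs s' hs' x x' hb ↦ ?_⟩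
    have hgF : ∀ s x, ∏ i, g i s x = F.map (parEval s x) := fun s x ↦ by
      rw [hF, Polynomial.map_prod]
    have hev : ∀ s x (G : MvPolynomial (Fin (∑ p, (q p).natDegree + 1)) ℝ),
        eval (fun i : Fin (_ + 1) ↦ (F.map (parEval s x)).coeff i) G =
        parEval s x (aeval (fun i : Fin (_ + 1) ↦ F.coeff i) G) := fun s x G ↦ by
      have : (parEval s x).comp (aeval (fun i : Fin (∑ p, (q p).natDegree + 1) ↦ F.coeff i) :
          MvPolynomial _ ℝ →ₐ[ℝ] _).toRingHom =
          eval (fun i : Fin (_ + 1) ↦ (F.map (parEval s x)).coeff i) := by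
        ext i
        · simp [parEval_apply]
        · change parEval s x (aeval _ (X i)) = _
          rw [aeval_X, eval_X, Polynomial.coeff_map]
      rw [← this]; rfl
    have hdegF : ∀ s ∈ Ioc 0 s₀, ∀ x, (F.map (parEval s x)).natDegree = ∑ p, (q p).natDegree :=
      fun s h x ↦ by
        rw [← hgF, Polynomial.natDegree_prod _ _ fun p _ ↦ hgne p s h x]
        exact Finset.sum_congr rfl fun p _ ↦ hgdeg p s h x
    rw [hgF, hgF]
    refine h𝒢 _ _ ?_ ?_ (hdegF s hs x) (hdegF s' hs' x') fun G hG ↦ ?_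
    · rw [← hgF]; exact Finset.prod_ne_zero_iff.2 fun p _ ↦ hgne p s hs x
    · rw [← hgF]; exact Finset.prod_ne_zero_iff.2 fun p _ ↦ hgne p s' hs' x'
    · rw [hev, hev]
      exact hb _ (Finset.mem_image_of_mem _ hG)

section

open Filter Topology

/-- Roots of polynomials of constant degree persist under small perturbations of the
coefficients. -/
lemma Polynomial.eventually_exists_root {α : Type*} {l : Filter α} {F : α → Polynomial ℝ}
    {F₀ : Polynomial ℝ} (h0 : F₀ ≠ 0) (hdeg : ∀ᶠ a in l, (F a).natDegree = F₀.natDegree)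
    (hcoeff : ∀ n, Tendsto (fun a ↦ (F a).coeff n) l (𝓝 (F₀.coeff n))) {w : ℂ}
    (hw : Polynomial.aeval w F₀ = 0) {ε : ℝ} (hε : 0 < ε) :
    ∀ᶠ a in l, ∃ z : ℂ, Polynomial.aeval z (F a) = 0 ∧ dist z w < ε := by
  set d := F₀.natDegree with hd
  have hlc : F₀.coeff d ≠ 0 := by rw [hd]; simpa using h0
  have hval : Tendsto (fun a ↦ ∑ i ∈ Finset.range (d + 1), ((F a).coeff i : ℂ) * w ^ i) l
      (𝓝 (∑ i ∈ Finset.range (d + 1), (F₀.coeff i : ℂ) * w ^ i)) :=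
    tendsto_finsetSum _ fun i _ ↦
      ((Complex.continuous_ofReal.tendsto _).comp (hcoeff i)).mul tendsto_const_nhds
  have hval0 : ∑ i ∈ Finset.range (d + 1), (F₀.coeff i : ℂ) * w ^ i = 0 := by
    rw [← hw, Polynomial.aeval_eq_sum_range]
    simp [Algebra.smul_def]
    rfl
  rw [hval0] at hval
  have h1 : ∀ᶠ a in l, ‖∑ i ∈ Finset.range (d + 1), ((F a).coeff i : ℂ) * w ^ i‖ <
      |F₀.coeff d| / 2 * ε ^ d := by
    have := hval.norm
    rw [norm_zero] at this
    exact this.eventually (gt_mem_nhds (by positivity))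
  have h2 : ∀ᶠ a in l, |F₀.coeff d| / 2 < |(F a).coeff d| :=
    (hcoeff d).abs.eventually (lt_mem_nhds (by have := abs_pos.2 hlc; linarith))
  filter_upwards [hdeg, h1, h2] with a had ha1 ha2
  by_contra! hcon
  have hsplit : (F a).map (algebraMap ℝ ℂ) |>.Splits := IsAlgClosed.splits _
  have hne : F a ≠ 0 := by
    rintro h
    rw [h, Polynomial.coeff_zero, abs_zero] at ha2
    have := abs_pos.2 hlc
    linarith
  have hmne : (F a).map (algebraMap ℝ ℂ) ≠ 0 :=
    (Polynomial.map_ne_zero_iff (algebraMap ℝ ℂ).injective).2 hne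
  have e1 : Polynomial.aeval w (F a) = ∑ i ∈ Finset.range (d + 1), ((F a).coeff i : ℂ) * w ^ i := by
    rw [Polynomial.aeval_eq_sum_range, had]
    simp [Algebra.smul_def]
  have e2 : Polynomial.aeval w (F a) = ((F a).coeff d : ℂ) *
      (((F a).map (algebraMap ℝ ℂ)).roots.map fun z ↦ w - z).prod := by
    rw [← Polynomial.eval_map_algebraMap, hsplit.eval_eq_prod_roots, Polynomial.leadingCoeff_map,
      Polynomial.leadingCoeff, had]
    rfl
  have hcard : ((F a).map (algebraMap ℝ ℂ)).roots.card = d := by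
    rw [Polynomial.splits_iff_card_roots.1 hsplit, Polynomial.natDegree_map, had]
  have e3 : ε ^ d ≤ ‖(((F a).map (algebraMap ℝ ℂ)).roots.map fun z ↦ w - z).prod‖ := by
    have hall : ∀ z ∈ ((F a).map (algebraMap ℝ ℂ)).roots, ε ≤ ‖w - z‖ := by
      intro z hz
      rw [← dist_eq_norm, dist_comm]
      apply hcon
      rw [← Polynomial.eval_map_algebraMap]
      exact (Polynomial.mem_roots hmne).1 hz
    rw [← hcard]
    generalize ((F a).map (algebraMap ℝ ℂ)).roots = s at hall
    induction s using Multiset.induction_on with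
    | empty => simp
    | cons z s ih =>
      rw [Multiset.card_cons, Multiset.map_cons, Multiset.prod_cons, norm_mul, pow_succ']
      exact mul_le_mul (hall z (by simp)) (ih fun y hy ↦ hall y (by simp [hy])) (by positivity)
        (norm_nonneg _)
  rw [← e1, e2, norm_mul, Complex.norm_real, Real.norm_eq_abs] at ha1
  have : |F₀.coeff d| / 2 * ε ^ d ≤ |(F a).coeff d| *
      ‖(((F a).map (algebraMap ℝ ℂ)).roots.map fun z ↦ w - z).prod‖ :=
    mul_le_mul ha2.le e3 (by positivity) (abs_nonneg _)
  linarith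

/-- The real zeros of a finite family of polynomials. -/
noncomputable def realZeros {ι : Type*} [Fintype ι] (G : ι → Polynomial ℝ) : Finset ℝ :=
  (∏ i, G i).roots.toFinset

lemma mem_realZeros {ι : Type*} [Fintype ι] {G : ι → Polynomial ℝ} (h : ∀ i, G i ≠ 0) {T : ℝ} :
    T ∈ realZeros G ↔ ∃ i, (G i).eval T = 0 := by
  rw [realZeros, Multiset.mem_toFinset, Polynomial.mem_roots (Finset.prod_ne_zero_iff.2 fun i _ ↦ h i),
    Polynomial.IsRoot.def, Polynomial.eval_prod, Finset.prod_eq_zero_iff]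
  simp

lemma mem_complexZeros {ι : Type*} [Fintype ι] {G : ι → Polynomial ℝ} (h : ∀ i, G i ≠ 0) {z : ℂ} :
    z ∈ ((∏ i, G i).map (algebraMap ℝ ℂ)).roots.toFinset ↔
      ∃ i, Polynomial.aeval z (G i) = 0 := by
  rw [Multiset.mem_toFinset, Polynomial.mem_roots ((Polynomial.map_ne_zero_iff
    (algebraMap ℝ ℂ).injective).2 (Finset.prod_ne_zero_iff.2 fun i _ ↦ h i)),
    Polynomial.IsRoot.def, Polynomial.eval_map_algebraMap, map_prod, Finset.prod_eq_zero_iff]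
  simp

lemma aeval_ofReal_eq_zero_iff (p : Polynomial ℝ) (T : ℝ) :
    Polynomial.aeval (T : ℂ) p = 0 ↔ p.eval T = 0 := by
  have : Polynomial.aeval (T : ℂ) p = ((p.eval T : ℝ) : ℂ) := by
    have := Polynomial.aeval_algebraMap_apply ℂ T p
    rw [← Polynomial.coe_aeval_eq_eval]
    exact this
  rw [this, Complex.ofReal_eq_zero]

/-- If the number of distinct complex zeros of a family of polynomials does not change, then its
real zeros move continuously, keeping track of which members of the family vanish there. -/
theorem eventually_exists_bijOn_realZeros {α ι : Type*} [Fintype ι] {l : Filter α}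
    {G : ι → α → Polynomial ℝ} {G₀ : ι → Polynomial ℝ} (h0 : ∀ i, G₀ i ≠ 0)
    (hne : ∀ᶠ a in l, ∀ i, G i a ≠ 0)
    (hdeg : ∀ i, ∀ᶠ a in l, (G i a).natDegree = (G₀ i).natDegree)
    (hcoeff : ∀ i n, Tendsto (fun a ↦ (G i a).coeff n) l (𝓝 ((G₀ i).coeff n)))
    (hcard : ∀ᶠ a in l, ((∏ i, G i a).map (algebraMap ℝ ℂ)).roots.toFinset.card =
      ((∏ i, G₀ i).map (algebraMap ℝ ℂ)).roots.toFinset.card) {ε : ℝ} (hε : 0 < ε) :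
    ∀ᶠ a in l, ∃ φ : ℝ → ℝ, BijOn φ (realZeros G₀) (realZeros fun i ↦ G i a) ∧
      ∀ w ∈ realZeros G₀, |φ w - w| < ε ∧ ∀ i, (G₀ i).eval w = 0 → (G i a).eval (φ w) = 0 := by
  classical
  set C₀ := ((∏ i, G₀ i).map (algebraMap ℝ ℂ)).roots.toFinset with hC₀
  obtain ⟨δ, hδ0, hδε, hsep, him⟩ : ∃ δ, 0 < δ ∧ δ < ε ∧
      (∀ w ∈ C₀, ∀ w' ∈ C₀, w ≠ w' → 2 * δ < dist w w') ∧
      (∀ w ∈ C₀, w.im ≠ 0 → δ < |w.im|) := by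
    have e1 : ∀ᶠ δ in 𝓝[>] (0 : ℝ), 0 < δ := self_mem_nhdsWithin
    have e2 : ∀ c : ℝ, 0 < c → ∀ᶠ δ in 𝓝[>] (0 : ℝ), δ < c := fun c hc ↦
      mem_nhdsWithin_of_mem_nhds (gt_mem_nhds hc)
    have e3 : ∀ᶠ δ in 𝓝[>] (0 : ℝ), ∀ w ∈ C₀, ∀ w' ∈ C₀, w ≠ w' → 2 * δ < dist w w' := by
      rw [Filter.eventually_all_finset]
      intro w _
      rw [Filter.eventually_all_finset]
      intro w' _
      by_cases h : w = w'
      · exact Eventually.of_forall fun _ h' ↦ absurd h h'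
      · filter_upwards [e2 (dist w w' / 2) (half_pos (dist_pos.2 h))] with δ hδ _
        linarith
    have e4 : ∀ᶠ δ in 𝓝[>] (0 : ℝ), ∀ w ∈ C₀, w.im ≠ 0 → δ < |w.im| := by
      rw [Filter.eventually_all_finset]
      intro w _
      by_cases h : w.im = 0
      · exact Eventually.of_forall fun _ h' ↦ absurd h h'
      · filter_upwards [e2 _ (abs_pos.2 h)] with δ hδ _ using hδ
    exact (e1.and ((e2 ε hε).and (e3.and e4))).exists
  have hroot : ∀ᶠ a in l, ∀ w ∈ C₀, ∀ i, Polynomial.aeval w (G₀ i) = 0 →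
      ∃ z : ℂ, Polynomial.aeval z (G i a) = 0 ∧ dist z w < δ := by
    rw [Filter.eventually_all_finset]
    intro w _
    rw [Filter.eventually_all]
    intro i
    by_cases h : Polynomial.aeval w (G₀ i) = 0
    · filter_upwards [Polynomial.eventually_exists_root (h0 i) (hdeg i) (hcoeff i) h hδ0]
        with a ha _ using ha
    · exact Eventually.of_forall fun _ h' ↦ absurd h' h
  filter_upwards [hne, hcard, hroot] with a hnea hcarda hroota
  set Ca := ((∏ i, G i a).map (algebraMap ℝ ℂ)).roots.toFinset with hCa
  have hex : ∀ w : C₀, ∃ z ∈ Ca, dist z w < δ := by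
    rintro ⟨w, hw⟩
    obtain ⟨i, hi⟩ := (mem_complexZeros h0).1 hw
    obtain ⟨z, hz, hzw⟩ := hroota w hw i hi
    exact ⟨z, (mem_complexZeros hnea).2 ⟨i, hz⟩, hzw⟩
  choose f hfC hfd using hex
  have hfinj : Function.Injective f := by
    intro w w' h
    by_contra hww
    have h1 := hsep w w.2 w' w'.2 (fun h ↦ hww (Subtype.ext h))
    have h2 := hfd w
    have h3 := hfd w'
    have h4 := dist_triangle_left (w : ℂ) w' (f w)
    rw [← h] at h3
    linarith
  have hfsurj : ∀ z ∈ Ca, ∃ w, f w = z := by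
    have himg : Finset.univ.image f = Ca := by
      refine Finset.eq_of_subset_of_card_le ?_ ?_
      · intro z hz
        obtain ⟨w, -, rfl⟩ := Finset.mem_image.1 hz
        exact hfC w
      · rw [Finset.card_image_of_injective _ hfinj, hcarda]; simp
    intro z hz
    rw [← himg] at hz
    obtain ⟨w, -, h⟩ := Finset.mem_image.1 hz
    exact ⟨w, h⟩
  have huniq : ∀ w : C₀, ∀ z ∈ Ca, dist z w < δ → z = f w := by
    intro w z hz hd
    obtain ⟨w', rfl⟩ := hfsurj z hz
    by_contra hne
    have h1 := hsep w w.2 w' w'.2 (fun h ↦ hne (by rw [Subtype.ext h]))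
    have h3 := hfd w'
    have h4 := dist_triangle_left (w : ℂ) w' (f w')
    linarith
  have hreal : ∀ w : C₀, w.1.im = 0 → (f w).im = 0 := by
    intro w hw
    have hc : starRingEnd ℂ w.1 = w.1 := Complex.conj_eq_iff_im.2 hw
    have h1 : starRingEnd ℂ (f w) ∈ Ca := by
      obtain ⟨i, hi⟩ := (mem_complexZeros hnea).1 (hfC w)
      exact (mem_complexZeros hnea).2 ⟨i, by rw [Polynomial.aeval_conj, hi, map_zero]⟩
    have h2 : dist (starRingEnd ℂ (f w)) w < δ := by
      rw [← hc, Complex.dist_conj_conj]; exact hfd w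
    exact Complex.conj_eq_iff_im.1 (huniq w _ h1 h2)
  have hC₀mem : ∀ T : ℝ, T ∈ realZeros G₀ ↔ (T : ℂ) ∈ C₀ := fun T ↦ by
    rw [mem_realZeros h0, mem_complexZeros h0]; simp [aeval_ofReal_eq_zero_iff]
  have hCamem : ∀ T : ℝ, T ∈ realZeros (fun i ↦ G i a) ↔ (T : ℂ) ∈ Ca := fun T ↦ by
    rw [mem_realZeros hnea, mem_complexZeros hnea]; simp [aeval_ofReal_eq_zero_iff]
  let φ : ℝ → ℝ := fun T ↦ if h : (T : ℂ) ∈ C₀ then (f ⟨T, h⟩).re else 0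
  have hφ : ∀ T : ℝ, ∀ h : (T : ℂ) ∈ C₀, ((φ T : ℝ) : ℂ) = f ⟨T, h⟩ := by
    intro T h
    have := hreal ⟨T, h⟩ (by simp)
    simp only [φ, dif_pos h]
    exact Complex.ext (by simp) (by simp [this])
  refine ⟨φ, ⟨?_, ?_, ?_⟩, ?_⟩
  · intro T hT
    have h := (hC₀mem T).1 hT
    refine (hCamem _).2 ?_
    rw [hφ T h]
    exact hfC _
  · intro T hT T' hT' e
    have h := (hC₀mem T).1 hT
    have h' := (hC₀mem T').1 hT'
    have e' : ((φ T : ℝ) : ℂ) = φ T' := by rw [show φ T = φ T' from e]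
    rw [hφ T h, hφ T' h'] at e'
    exact Complex.ofReal_injective (congrArg Subtype.val (hfinj e'))
  · intro T hT
    obtain ⟨w, hw⟩ := hfsurj _ ((hCamem T).1 hT)
    have hwim : w.1.im = 0 := by
      by_contra h
      have h1 := him w w.2 h
      have h2 := hfd w
      rw [hw, dist_comm, Complex.dist_eq] at h2
      have h3 := Complex.abs_im_le_norm (w.1 - T)
      simp at h3
      linarith
    have hwr : ((w.1.re : ℝ) : ℂ) = w.1 := Complex.ext (by simp) (by simp [hwim])
    have hmem : ((w.1.re : ℝ) : ℂ) ∈ C₀ := by rw [hwr]; exact w.2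
    refine ⟨w.1.re, (hC₀mem _).2 hmem, ?_⟩
    have h1 := hφ _ hmem
    rw [show (⟨((w.1.re : ℝ) : ℂ), hmem⟩ : C₀) = w from Subtype.ext hwr, hw] at h1
    exact_mod_cast h1
  · intro w hw
    have h := (hC₀mem w).1 hw
    refine ⟨?_, fun i hi ↦ ?_⟩
    · have := hfd ⟨w, h⟩
      rw [← hφ w h, Complex.dist_eq, ← Complex.ofReal_sub, Complex.norm_real] at this
      exact this.trans hδε
    · obtain ⟨z, hz, hzw⟩ := hroota w h i ((aeval_ofReal_eq_zero_iff _ _).2 hi)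
      have := huniq ⟨w, h⟩ z ((mem_complexZeros hnea).2 ⟨i, hz⟩) hzw
      rw [this, ← hφ w h] at hz
      exact (aeval_ofReal_eq_zero_iff _ _).1 hz

/-- The increasing bijection between two finite sets of reals of the same cardinality. -/
noncomputable def orderMatch (A B : Finset ℝ) (a : ℝ) : ℝ :=
  if h : A.card = B.card ∧ a ∈ A then
    ((A.orderIsoOfFin h.1).symm.trans (B.orderIsoOfFin rfl) ⟨a, h.2⟩ : B) else a

lemma orderMatch_eq {A B : Finset ℝ} {f : ℝ → ℝ} (hf : StrictMonoOn f A) (hb : BijOn f A B) {a : ℝ}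
    (ha : a ∈ A) : orderMatch A B a = f a := by
  have hcard : A.card = B.card := by
    rw [← Finset.card_image_of_injOn hb.injOn]
    congr 1
    ext b
    rw [← Finset.mem_coe, Finset.coe_image, hb.image_eq]
    rfl
  rw [orderMatch, dif_pos ⟨hcard, ha⟩]
  let e : A ≃o B := StrictMono.orderIsoOfSurjective
    (fun a : A ↦ (⟨f a, hb.mapsTo a.2⟩ : B)) (fun a b h ↦ hf a.2 b.2 h) (fun b ↦ by
      obtain ⟨a, ha, h⟩ := hb.surjOn b.2
      exact ⟨⟨a, ha⟩, Subtype.ext h⟩)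
  have : (A.orderIsoOfFin hcard).symm.trans (B.orderIsoOfFin rfl) = e := Subsingleton.elim _ _
  rw [this]
  rfl

lemma orderMatch_spec {A B : Finset ℝ} (h : A.card = B.card) :
    StrictMonoOn (orderMatch A B) A ∧ BijOn (orderMatch A B) A B := by
  have key : ∀ a (ha : a ∈ A), orderMatch A B a =
      ((A.orderIsoOfFin h).symm.trans (B.orderIsoOfFin rfl) ⟨a, ha⟩ : B) := fun a ha ↦ by
    rw [orderMatch, dif_pos ⟨h, ha⟩]
  have hmono : StrictMonoOn (orderMatch A B) A := by
    intro a ha b hb hab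
    rw [key a ha, key b hb]
    exact ((A.orderIsoOfFin h).symm.trans (B.orderIsoOfFin rfl)).strictMono
      (a := ⟨a, ha⟩) (b := ⟨b, hb⟩) hab
  refine ⟨hmono, fun a ha ↦ ?_, hmono.injOn, fun b hb ↦ ?_⟩
  · rw [key a ha]; exact Subtype.prop _
  · obtain ⟨⟨a, ha⟩, hab⟩ := ((A.orderIsoOfFin h).symm.trans (B.orderIsoOfFin rfl)).surjective
      ⟨b, hb⟩
    exact ⟨a, ha, by rw [key a ha, hab]⟩

lemma orderMatch_self {A : Finset ℝ} {a : ℝ} (ha : a ∈ A) : orderMatch A A a = a :=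
  orderMatch_eq (f := id) strictMonoOn_id (bijOn_id _) ha

lemma orderMatch_orderMatch {A B C : Finset ℝ} (h : A.card = B.card) (h' : B.card = C.card) {a : ℝ}
    (ha : a ∈ A) : orderMatch B C (orderMatch A B a) = orderMatch A C a := by
  obtain ⟨m1, b1⟩ := orderMatch_spec h
  obtain ⟨m2, b2⟩ := orderMatch_spec h'
  exact (orderMatch_eq (f := orderMatch B C ∘ orderMatch A B) (m2.comp m1 b1.mapsTo)
    (b2.comp b1) ha).symm

lemma Finset.exists_pos_separation (A : Finset ℝ) :
    ∃ δ > 0, ∀ a ∈ A, ∀ b ∈ A, a ≠ b → 2 * δ < |a - b| := by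
  have h : ∀ᶠ δ in 𝓝[>] (0 : ℝ), ∀ a ∈ A, ∀ b ∈ A, a ≠ b → 2 * δ < |a - b| := by
    rw [Filter.eventually_all_finset]
    intro a _
    rw [Filter.eventually_all_finset]
    intro b _
    by_cases h : a = b
    · exact Eventually.of_forall fun _ h' ↦ absurd h h'
    · filter_upwards [mem_nhdsWithin_of_mem_nhds
        (gt_mem_nhds (half_pos (abs_pos.2 (sub_ne_zero.2 h))))] with δ hδ _
      linarith
  have h0 : ∀ᶠ δ in 𝓝[>] (0 : ℝ), 0 < δ := eventually_mem_nhdsWithin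
  obtain ⟨δ, hδ, h⟩ := (h0.and h).exists
  exact ⟨δ, hδ, h⟩

/-- A curve of families of polynomials, parametrised by `Ioc 0 s₀`, whose real zeros move
continuously and keep track of which members of the family vanish. -/
structure TrackedZeros {ι : Type*} [Fintype ι] (s₀ : ℝ) (H : ℝ → ι → Polynomial ℝ) : Prop where
  ne_zero : ∀ τ ∈ Ioc 0 s₀, ∀ i, H τ i ≠ 0
  cont : ∀ i, ContinuousOn (fun q : ℝ × ℝ ↦ (H q.1 i).eval q.2) (Ioc 0 s₀ ×ˢ univ)
  track : ∀ τ₁ ∈ Ioc 0 s₀, ∀ ε > 0, ∀ᶠ τ in 𝓝[Ioc 0 s₀] τ₁, ∃ φ : ℝ → ℝ,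
    BijOn φ (realZeros (H τ₁)) (realZeros (H τ)) ∧
    ∀ w ∈ realZeros (H τ₁), |φ w - w| < ε ∧ ∀ i, (H τ₁ i).eval w = 0 → (H τ i).eval (φ w) = 0

namespace TrackedZeros

variable {ι : Type*} [Fintype ι] {s₀ : ℝ} {H : ℝ → ι → Polynomial ℝ}

lemma card_eq (h : TrackedZeros s₀ H) {τ τ' : ℝ} (hτ : τ ∈ Ioc 0 s₀) (hτ' : τ' ∈ Ioc 0 s₀) :
    (realZeros (H τ)).card = (realZeros (H τ')).card := by
  refine isPreconnected_Ioc.constant (f := fun τ ↦ (realZeros (H τ)).card) ?_ hτ hτ'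
  intro τ₁ hτ₁
  rw [ContinuousWithinAt, nhds_discrete ℕ, tendsto_pure]
  filter_upwards [h.track τ₁ hτ₁ 1 one_pos] with τ hτ
  obtain ⟨φ, hφ, -⟩ := hτ
  rw [← Finset.card_image_of_injOn hφ.injOn]
  congr 1
  ext b
  rw [← Finset.mem_coe (s := Finset.image _ _), Finset.coe_image, hφ.image_eq]
  rfl

lemma eventually_orderMatch (h : TrackedZeros s₀ H) {τ₁ : ℝ} (hτ₁ : τ₁ ∈ Ioc 0 s₀) {ε : ℝ}
    (hε : 0 < ε) : ∀ᶠ τ in 𝓝[Ioc 0 s₀] τ₁, ∀ w ∈ realZeros (H τ₁),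
      |orderMatch (realZeros (H τ₁)) (realZeros (H τ)) w - w| < ε ∧
      ∀ i, (H τ₁ i).eval w = 0 →
        (H τ i).eval (orderMatch (realZeros (H τ₁)) (realZeros (H τ)) w) = 0 := by
  obtain ⟨δ, hδ, hsep⟩ := (realZeros (H τ₁)).exists_pos_separation
  filter_upwards [h.track τ₁ hτ₁ _ (lt_min hδ hε)] with τ hτ w hw
  obtain ⟨φ, hφ, hφ'⟩ := hτ
  rw [orderMatch_eq (f := φ) ?_ hφ hw]
  · exact ⟨(hφ' w hw).1.trans_le (min_le_right _ _), (hφ' w hw).2⟩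
  · intro a ha b hb hab
    have h1 := abs_lt.1 ((hφ' a ha).1.trans_le (min_le_left _ _))
    have h2 := abs_lt.1 ((hφ' b hb).1.trans_le (min_le_left _ _))
    have h3 := hsep a ha b hb hab.ne
    rw [abs_of_neg (by linarith)] at h3
    linarith

lemma orderMatch_trans (h : TrackedZeros s₀ H) {τ₁ τ₂ τ₃ : ℝ} (h1 : τ₁ ∈ Ioc 0 s₀)
    (h2 : τ₂ ∈ Ioc 0 s₀) (h3 : τ₃ ∈ Ioc 0 s₀) {a : ℝ} (ha : a ∈ realZeros (H τ₁)) :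
    orderMatch (realZeros (H τ₂)) (realZeros (H τ₃))
      (orderMatch (realZeros (H τ₁)) (realZeros (H τ₂)) a) =
      orderMatch (realZeros (H τ₁)) (realZeros (H τ₃)) a :=
  orderMatch_orderMatch (h.card_eq h1 h2) (h.card_eq h2 h3) ha

lemma orderMatch_mem (h : TrackedZeros s₀ H) {τ₁ τ₂ : ℝ} (h1 : τ₁ ∈ Ioc 0 s₀)
    (h2 : τ₂ ∈ Ioc 0 s₀) {a : ℝ} (ha : a ∈ realZeros (H τ₁)) :
    orderMatch (realZeros (H τ₁)) (realZeros (H τ₂)) a ∈ realZeros (H τ₂) :=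
  (orderMatch_spec (h.card_eq h1 h2)).2.mapsTo ha

lemma continuousOn_orderMatch (h : TrackedZeros s₀ H) {s : ℝ} (hs : s ∈ Ioc 0 s₀) {a : ℝ}
    (ha : a ∈ realZeros (H s)) :
    ContinuousOn (fun τ ↦ orderMatch (realZeros (H s)) (realZeros (H τ)) a) (Ioc 0 s₀) := by
  intro τ₁ hτ₁
  rw [ContinuousWithinAt, Metric.tendsto_nhds]
  intro ε hε
  filter_upwards [h.eventually_orderMatch hτ₁ hε, self_mem_nhdsWithin] with τ hτ hτI
  have := (hτ _ (h.orderMatch_mem hs hτ₁ ha)).1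
  rwa [h.orderMatch_trans hs hτ₁ hτI ha] at this

lemma eval_orderMatch_eq_zero_iff (h : TrackedZeros s₀ H) {s τ : ℝ} (hs : s ∈ Ioc 0 s₀)
    (hτ : τ ∈ Ioc 0 s₀) {a : ℝ} (ha : a ∈ realZeros (H s)) (i : ι) :
    (H τ i).eval (orderMatch (realZeros (H s)) (realZeros (H τ)) a) = 0 ↔ (H s i).eval a = 0 := by
  have key : (fun τ ↦ (H τ i).eval (orderMatch (realZeros (H s)) (realZeros (H τ)) a) = 0) τ =
      (fun τ ↦ (H τ i).eval (orderMatch (realZeros (H s)) (realZeros (H τ)) a) = 0) s := by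
    let _ : TopologicalSpace Prop := ⊥
    have _ : DiscreteTopology Prop := ⟨rfl⟩
    refine isPreconnected_Ioc.constant (Y := Prop)
      (f := fun τ ↦ (H τ i).eval (orderMatch (realZeros (H s)) (realZeros (H τ)) a) = 0) ?_ hτ hs
    intro τ₁ hτ₁
    rw [ContinuousWithinAt, nhds_discrete Prop, tendsto_pure]
    by_cases h0 : (H τ₁ i).eval (orderMatch (realZeros (H s)) (realZeros (H τ₁)) a) = 0
    · filter_upwards [h.eventually_orderMatch hτ₁ one_pos, self_mem_nhdsWithin] with τ hτ hτI
      have := (hτ _ (h.orderMatch_mem hs hτ₁ ha)).2 i h0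
      rw [h.orderMatch_trans hs hτ₁ hτI ha] at this
      simp [this, h0]
    · have hc : ContinuousOn (fun τ ↦ (H τ i).eval
          (orderMatch (realZeros (H s)) (realZeros (H τ)) a)) (Ioc 0 s₀) :=
        (h.cont i).comp (continuousOn_id.prodMk (h.continuousOn_orderMatch hs ha))
          fun τ hτ ↦ ⟨hτ, mem_univ _⟩
      filter_upwards [(hc τ₁ hτ₁).eventually_ne h0] with τ hτ
      simp [hτ, h0]
  simpa [orderMatch_self ha] using key

lemma exists_isolation (h : TrackedZeros s₀ H) {τ₁ : ℝ} (hτ₁ : τ₁ ∈ Ioc 0 s₀) {w : ℝ}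
    (hw : w ∈ realZeros (H τ₁)) : ∃ ε > 0, ∀ᶠ τ in 𝓝[Ioc 0 s₀] τ₁, ∀ b ∈ realZeros (H τ),
      |b - w| < ε → b = orderMatch (realZeros (H τ₁)) (realZeros (H τ)) w := by
  obtain ⟨δ, hδ, hsep⟩ := (realZeros (H τ₁)).exists_pos_separation
  refine ⟨δ, hδ, ?_⟩
  filter_upwards [h.eventually_orderMatch hτ₁ hδ, self_mem_nhdsWithin] with τ hτ hτI b hb hbw
  obtain ⟨w', hw', rfl⟩ := (orderMatch_spec (h.card_eq hτ₁ hτI)).2.surjOn hb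
  by_contra hne
  have h1 := hsep w hw w' hw' (fun e ↦ hne (by rw [e]))
  have h2 := (hτ w' hw').1
  have h3 := abs_sub_le w (orderMatch (realZeros (H τ₁)) (realZeros (H τ)) w') w'
  rw [abs_sub_comm w (orderMatch (realZeros (H τ₁)) (realZeros (H τ)) w')] at h3
  linarith

end TrackedZeros

/-- Linear interpolation between the values `v` at `a` and `v'` at `a'`. -/
noncomputable def linInterp (a a' v v' T : ℝ) : ℝ := v + (T - a) / (a' - a) * (v' - v)

lemma linInterp_self (a v v' T : ℝ) : linInterp a a v v' T = v := by simp [linInterp]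

lemma linInterp_left (a a' v v' : ℝ) : linInterp a a' v v' a = v := by simp [linInterp]

lemma linInterp_right {a a' : ℝ} (v v' : ℝ) (h : a ≠ a') : linInterp a a' v v' a' = v' := by
  rw [linInterp, div_self (sub_ne_zero.2 h.symm)]; ring

lemma linInterp_id {a a' T : ℝ} (h : a ≤ T) (h' : T ≤ a') : linInterp a a' a a' T = T := by
  rcases (h.trans h').eq_or_lt with rfl | hlt
  · rw [linInterp_self]; exact le_antisymm h h'
  · rw [linInterp, div_mul_cancel₀ _ (sub_ne_zero.2 hlt.ne')]; ring

lemma linInterp_mem {a a' v v' T : ℝ} (h : a ≤ T) (h' : T ≤ a') {s : Set ℝ} (hs : Convex ℝ s)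
    (hv : v ∈ s) (hv' : v' ∈ s) : linInterp a a' v v' T ∈ s := by
  have h1 : 0 ≤ (T - a) / (a' - a) := div_nonneg (by linarith) (by linarith)
  have h2 : (T - a) / (a' - a) ≤ 1 := div_le_one_of_le₀ (by linarith) (by linarith)
  have := hs hv hv' (sub_nonneg.2 h2) h1 (by ring)
  convert this using 1
  simp only [linInterp, smul_eq_mul]; ring

lemma linInterp_linInterp {a a' b b' v v' T : ℝ} (h : b ≠ b') :
    linInterp b b' v v' (linInterp a a' b b' T) = linInterp a a' v v' T := by
  have : b' - b ≠ 0 := sub_ne_zero.2 h.symm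
  simp only [linInterp, add_sub_cancel_left, mul_div_assoc, div_self this, mul_one]

/-- The piecewise linear extension of a function `c` defined on a finite set `A`. -/
noncomputable def pwLinear (A : Finset ℝ) (c : ℝ → ℝ) (T : ℝ) : ℝ :=
  linInterp (sSup (A.filter (· ≤ T) : Finset ℝ)) (sInf (A.filter (T ≤ ·) : Finset ℝ))
    (c (sSup (A.filter (· ≤ T) : Finset ℝ))) (c (sInf (A.filter (T ≤ ·) : Finset ℝ))) T

lemma exists_bracket {A : Finset ℝ} {R T : ℝ} (hR : R ∈ A) (hR' : -R ∈ A) (hT : T ∈ Icc (-R) R)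
    (c : ℝ → ℝ) : ∃ a ∈ A, ∃ a' ∈ A, a ≤ T ∧ T ≤ a' ∧ (∀ b ∈ A, b ≤ a ∨ a' ≤ b) ∧
      pwLinear A c T = linInterp a a' (c a) (c a') T := by
  have h1 : (A.filter (· ≤ T)).Nonempty := ⟨-R, by simp [hR', hT.1]⟩
  have h2 : (A.filter (T ≤ ·)).Nonempty := ⟨R, by simp [hR, hT.2]⟩
  have m1 := Finset.mem_filter.1 h1.csSup_mem
  have m2 := Finset.mem_filter.1 h2.csInf_mem
  refine ⟨_, m1.1, _, m2.1, m1.2, m2.2, fun b hb ↦ ?_, rfl⟩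
  rcases le_total b T with h | h
  · exact Or.inl (le_csSup (Finset.bddAbove _) (by simp [hb, h]))
  · exact Or.inr (csInf_le (Finset.bddBelow _) (by simp [hb, h]))

lemma pwLinear_eq {A : Finset ℝ} {c : ℝ → ℝ} {a a' T : ℝ} (ha : a ∈ A) (ha' : a' ∈ A) (h : a ≤ T)
    (h' : T ≤ a') (hgap : ∀ b ∈ A, b ≤ a ∨ a' ≤ b) :
    pwLinear A c T = linInterp a a' (c a) (c a') T := by
  have h1 : (A.filter (· ≤ T)).Nonempty := ⟨a, by simp [ha, h]⟩
  have h2 : (A.filter (T ≤ ·)).Nonempty := ⟨a', by simp [ha', h']⟩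
  have m1 := Finset.mem_filter.1 h1.csSup_mem
  have m2 := Finset.mem_filter.1 h2.csInf_mem
  have l1 : a ≤ sSup (A.filter (· ≤ T) : Finset ℝ) :=
    le_csSup (Finset.bddAbove _) (by simp [ha, h])
  have l2 : sInf (A.filter (T ≤ ·) : Finset ℝ) ≤ a' :=
    csInf_le (Finset.bddBelow _) (by simp [ha', h'])
  rw [pwLinear]
  set u := sSup ((A.filter (· ≤ T) : Finset ℝ) : Set ℝ)
  set u' := sInf ((A.filter (T ≤ ·) : Finset ℝ) : Set ℝ)
  rcases eq_or_lt_of_le h with rfl | hlt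
  · have e1 : u = a := le_antisymm m1.2 l1
    have e2 : u' = a := by
      refine le_antisymm ?_ m2.2
      exact csInf_le (Finset.bddBelow _) (by simp [ha])
    rw [e1, e2, linInterp_self, linInterp_left]
  rcases eq_or_lt_of_le h' with rfl | hlt'
  · have e1 : u = T := by
      refine le_antisymm m1.2 ?_
      exact le_csSup (Finset.bddAbove _) (by simp [ha'])
    have e2 : u' = T := le_antisymm l2 m2.2
    rw [e1, e2, linInterp_self, linInterp_right _ _ hlt.ne]
  have e1 : u = a := by
    rcases hgap u m1.1 with h3 | h3
    · exact le_antisymm h3 l1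
    · linarith [m1.2]
  have e2 : u' = a' := by
    rcases hgap u' m2.1 with h3 | h3
    · linarith [m2.2]
    · exact le_antisymm l2 h3
  rw [e1, e2]

lemma pwLinear_apply {A : Finset ℝ} {c : ℝ → ℝ} {a : ℝ} (ha : a ∈ A) : pwLinear A c a = c a := by
  rw [pwLinear_eq ha ha le_rfl le_rfl fun b _ ↦ le_total b a, linInterp_self]

section

variable {A B : Finset ℝ} {R T : ℝ} (hR : R ∈ A) (hR' : -R ∈ A) (hT : T ∈ Icc (-R) R)
include hR hR' hT

lemma pwLinear_congr {c c' : ℝ → ℝ} (h : ∀ a ∈ A, c a = c' a) :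
    pwLinear A c T = pwLinear A c' T := by
  obtain ⟨a, ha, a', ha', h1, h2, h3, h4⟩ := exists_bracket hR hR' hT c
  rw [h4, pwLinear_eq ha ha' h1 h2 h3, h a ha, h a' ha']

lemma pwLinear_id {c : ℝ → ℝ} (h : ∀ a ∈ A, c a = a) : pwLinear A c T = T := by
  obtain ⟨a, ha, a', ha', h1, h2, h3, h4⟩ := exists_bracket hR hR' hT c
  rw [h4, h a ha, h a' ha', linInterp_id h1 h2]

lemma pwLinear_mem {c : ℝ → ℝ} {s : Set ℝ} (hs : Convex ℝ s) (h : ∀ a ∈ A, c a ∈ s) :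
    pwLinear A c T ∈ s := by
  obtain ⟨a, ha, a', ha', h1, h2, h3, h4⟩ := exists_bracket hR hR' hT c
  rw [h4]
  exact linInterp_mem h1 h2 hs (h a ha) (h a' ha')

lemma pwLinear_pwLinear {c c' : ℝ → ℝ} (hc : StrictMonoOn c A) (hb : BijOn c A B) :
    pwLinear B c' (pwLinear A c T) = pwLinear A (c' ∘ c) T := by
  obtain ⟨a, ha, a', ha', h1, h2, h3, h4⟩ := exists_bracket hR hR' hT c
  have h5 := pwLinear_eq (c := c' ∘ c) ha ha' h1 h2 h3
  have hle : c a ≤ c a' := hc.monotoneOn ha ha' (h1.trans h2)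
  have hm : linInterp a a' (c a) (c a') T ∈ Icc (c a) (c a') :=
    linInterp_mem h1 h2 (convex_Icc _ _) ⟨le_rfl, hle⟩ ⟨hle, le_rfl⟩
  rw [h4, h5, pwLinear_eq (hb.mapsTo ha) (hb.mapsTo ha') hm.1 hm.2]
  · rcases hle.eq_or_lt with h | h
    · have : a = a' := hb.injOn ha ha' h
      subst this
      rw [linInterp_self, linInterp_self]; rfl
    · exact linInterp_linInterp h.ne
  · intro b hbB
    obtain ⟨w, hw, rfl⟩ := hb.surjOn hbB
    rcases h3 w hw with h | h
    · exact Or.inl (hc.monotoneOn hw ha h)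
    · exact Or.inr (hc.monotoneOn ha' hw h)

end

/-- Continuity of the piecewise linear extension of a continuous function defined on a closed
family of finite sets with lower semicontinuous fibres. -/
lemma continuousOn_pwLinear {Y : Type*} [TopologicalSpace Y] {D : Set Y} {R : ℝ}
    {A : Y → Finset ℝ} {c : Y → ℝ → ℝ} (hR : ∀ y ∈ D, R ∈ A y) (hR' : ∀ y ∈ D, -R ∈ A y)
    (hA : ∀ y ∈ D, ∀ a ∈ A y, a ∈ Icc (-R) R)
    (hclosed : ∀ y ∈ D, ∀ a ∉ A y, ∀ᶠ q : Y × ℝ in 𝓝[D] y ×ˢ 𝓝 a, q.2 ∉ A q.1)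
    (hlsc : ∀ y ∈ D, ∀ a ∈ A y, ∀ ε > 0, ∀ᶠ y' in 𝓝[D] y, ∃ a' ∈ A y', |a' - a| < ε)
    (hc : ContinuousOn (fun q : Y × ℝ ↦ c q.1 q.2) {q | q.1 ∈ D ∧ q.2 ∈ A q.1}) :
    ContinuousOn (fun q : Y × ℝ ↦ pwLinear (A q.1) (c q.1) q.2) (D ×ˢ Icc (-R) R) := by
  rintro ⟨y₁, T₁⟩ ⟨hy₁, hT₁⟩
  rw [ContinuousWithinAt, tendsto_iff_ultrafilter]
  intro 𝒰 h𝒰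
  have hmem : ∀ᶠ q : Y × ℝ in 𝒰, q ∈ D ×ˢ Icc (-R) R := h𝒰 eventually_mem_nhdsWithin
  have hy : Tendsto (fun q : Y × ℝ ↦ q.1) 𝒰 (𝓝[D] y₁) := by
    rw [tendsto_nhdsWithin_iff]
    refine ⟨(continuous_fst.tendsto (y₁, T₁)).mono_left (h𝒰.trans nhdsWithin_le_nhds), ?_⟩
    filter_upwards [hmem] with q hq using hq.1
  have hT : Tendsto (fun q : Y × ℝ ↦ q.2) 𝒰 (𝓝 T₁) :=
    (continuous_snd.tendsto (y₁, T₁)).mono_left (h𝒰.trans nhdsWithin_le_nhds)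
  have hbr : ∀ q : Y × ℝ, ∃ a a' : ℝ, q ∈ D ×ˢ Icc (-R) R → a ∈ A q.1 ∧ a' ∈ A q.1 ∧ a ≤ q.2 ∧
      q.2 ≤ a' ∧ (∀ b ∈ A q.1, b ≤ a ∨ a' ≤ b) ∧
      pwLinear (A q.1) (c q.1) q.2 = linInterp a a' (c q.1 a) (c q.1 a') q.2 := by
    intro q
    by_cases hq : q ∈ D ×ˢ Icc (-R) R
    · obtain ⟨a, ha, a', ha', h⟩ := exists_bracket (hR q.1 hq.1) (hR' q.1 hq.1) hq.2 (c q.1)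
      exact ⟨a, a', fun _ ↦ ⟨ha, ha', h⟩⟩
    · exact ⟨0, 0, fun h ↦ absurd h hq⟩
  choose a a' hbr using hbr
  have hbr' : ∀ᶠ q : Y × ℝ in 𝒰, _ := hmem.mono hbr
  have hlim : ∀ f : Y × ℝ → ℝ, (∀ᶠ q in 𝒰, f q ∈ A q.1) →
      ∃ α ∈ A y₁, Tendsto f 𝒰 (𝓝 α) ∧ Tendsto (fun q ↦ c q.1 (f q)) 𝒰 (𝓝 (c y₁ α)) := by
    intro f hf
    have hf' : ∀ᶠ q in 𝒰, f q ∈ Icc (-R) R := by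
      filter_upwards [hf, hmem] with q hq hq' using hA _ hq'.1 _ hq
    obtain ⟨α, -, hα⟩ := isCompact_Icc.ultrafilter_le_nhds (𝒰.map f) (le_principal_iff.2 hf')
    have hα : Tendsto f 𝒰 (𝓝 α) := hα
    have hαA : α ∈ A y₁ := by
      by_contra hn
      have := (hy.prodMk hα).eventually (hclosed y₁ hy₁ α hn)
      obtain ⟨q, h1, h2⟩ := (this.and hf).exists
      exact h1 h2
    refine ⟨α, hαA, hα, ?_⟩
    have := hc (y₁, α) ⟨hy₁, hαA⟩
    refine Tendsto.comp (f := fun q : Y × ℝ ↦ (q.1, f q)) this ?_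
    rw [tendsto_nhdsWithin_iff]
    refine ⟨?_, ?_⟩
    · rw [nhds_prod_eq]
      exact (tendsto_nhds_of_tendsto_nhdsWithin hy).prodMk hα
    · filter_upwards [hf, hmem] with q hq hq' using ⟨hq'.1, hq⟩
  obtain ⟨α, hα, ta, tc⟩ := hlim a (hbr'.mono fun q h ↦ h.1)
  obtain ⟨α', hα', ta', tc'⟩ := hlim a' (hbr'.mono fun q h ↦ h.2.1)
  have hαT : α ≤ T₁ := le_of_tendsto_of_tendsto ta hT (hbr'.mono fun q h ↦ h.2.2.1)
  have hαT' : T₁ ≤ α' := le_of_tendsto_of_tendsto hT ta' (hbr'.mono fun q h ↦ h.2.2.2.1)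
  have hgap : ∀ b ∈ A y₁, b ≤ α ∨ α' ≤ b := by
    intro b hb
    by_contra! hcon
    have hε : 0 < min (b - α) (α' - b) / 2 := by
      have := lt_min (sub_pos.2 hcon.1) (sub_pos.2 hcon.2); linarith
    have e1 := hy.eventually (hlsc y₁ hy₁ b hb _ hε)
    have e2 := (Metric.tendsto_nhds.1 ta) _ hε
    have e3 := (Metric.tendsto_nhds.1 ta') _ hε
    obtain ⟨q, ⟨w, hw, hwb⟩, h2, h3, h4⟩ := (e1.and (e2.and (e3.and hbr'))).exists
    rw [Real.dist_eq] at h2 h3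
    have m1 := min_le_left (b - α) (α' - b)
    have m2 := min_le_right (b - α) (α' - b)
    rw [abs_lt] at hwb h2 h3
    rcases h4.2.2.2.2.1 w hw with h | h <;> linarith
  change Tendsto _ _ (𝓝 (pwLinear (A y₁) (c y₁) T₁))
  rw [pwLinear_eq hα hα' hαT hαT' hgap]
  refine Tendsto.congr' (f₁ := fun q ↦ linInterp (a q) (a' q) (c q.1 (a q)) (c q.1 (a' q)) q.2)
    (hbr'.mono fun q h ↦ h.2.2.2.2.2.symm) ?_
  rcases (hαT.trans hαT').eq_or_lt with heq | hlt
  · rw [← heq] at tc' ⊢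
    rw [linInterp_self]
    rw [Metric.tendsto_nhds] at tc tc' ⊢
    intro ε hε
    filter_upwards [tc ε hε, tc' ε hε, hbr'] with q h1 h2 h3
    exact linInterp_mem h3.2.2.1 h3.2.2.2.1 (convex_ball (c y₁ α) ε) h1 h2
  · simp only [linInterp]
    exact tc.add (((hT.sub ta).div (ta'.sub ta) (sub_ne_zero.2 hlt.ne')).mul (tc'.sub tc))

/-- A family of homeomorphisms `Ψ s s'` of a compact set `L`, for `s, s'` in `(0, s₀]`, with the
cocycle property, together with its continuous extension to `s' = 0`. -/
structure FlowOn {E : Type*} [TopologicalSpace E] (s₀ : ℝ) (L : Set E) (Ψ : ℝ → ℝ → E → E) :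
    Prop where
  pos : 0 < s₀
  compact : IsCompact L
  mapsTo : ∀ s ∈ Ioc 0 s₀, ∀ s' ∈ Icc 0 s₀, ∀ x ∈ L, Ψ s s' x ∈ L
  cont : ContinuousOn (fun q : ℝ × ℝ × E ↦ Ψ q.1 q.2.1 q.2.2) (Ioc 0 s₀ ×ˢ Icc 0 s₀ ×ˢ L)
  refl : ∀ s ∈ Ioc 0 s₀, ∀ x ∈ L, Ψ s s x = x
  trans : ∀ s ∈ Ioc 0 s₀, ∀ s' ∈ Ioc 0 s₀, ∀ s'' ∈ Icc 0 s₀, ∀ x ∈ L,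
    Ψ s' s'' (Ψ s s' x) = Ψ s s'' x

lemma FlowOn.restrict {E : Type*} [TopologicalSpace E] {s₀ s₁ : ℝ} {L : Set E} {Ψ : ℝ → ℝ → E → E}
    (h : FlowOn s₀ L Ψ) (h1 : 0 < s₁) (h2 : s₁ ≤ s₀) : FlowOn s₁ L Ψ where
  pos := h1
  compact := h.compact
  mapsTo s hs s' hs' := h.mapsTo s (Ioc_subset_Ioc_right h2 hs) s' (Icc_subset_Icc_right h2 hs')
  cont := h.cont.mono (prod_mono (Ioc_subset_Ioc_right h2)
    (prod_mono (Icc_subset_Icc_right h2) subset_rfl))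
  refl s hs := h.refl s (Ioc_subset_Ioc_right h2 hs)
  trans s hs s' hs' s'' hs'' := h.trans s (Ioc_subset_Ioc_right h2 hs) s'
    (Ioc_subset_Ioc_right h2 hs') s'' (Icc_subset_Icc_right h2 hs'')

lemma exists_grid {G : Polynomial ℝ} (hG : G ≠ 0) (R : ℝ) {ε : ℝ} (hε : 0 < ε) :
    ∃ N : Finset ℝ, (∀ T ∈ N, G.eval T ≠ 0) ∧
      ∀ u ∈ Icc (-R) R, ∀ v, u + ε < v → ∃ T ∈ N, T ∈ Ioo u v := by
  have h1 : ∀ j : ℤ, ∃ T ∈ Ioo (j * (ε / 2)) ((j + 1) * (ε / 2)), G.eval T ≠ 0 := by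
    intro j
    have hinf : (Ioo (j * (ε / 2)) ((j + 1) * (ε / 2))).Infinite := Ioo_infinite (by linarith)
    obtain ⟨T, hT, hT'⟩ := (hinf.sdiff G.roots.toFinset.finite_toSet).nonempty
    refine ⟨T, hT, fun h ↦ hT' ?_⟩
    simpa [hG] using h
  choose f hf hf' using h1
  classical
  refine ⟨(Finset.Icc ⌈-R / (ε / 2)⌉ ⌈R / (ε / 2)⌉).image f, ?_, ?_⟩
  · intro T hT
    obtain ⟨j, -, rfl⟩ := Finset.mem_image.1 hT
    exact hf' j
  · intro u hu v huv
    have hε2 : 0 < ε / 2 := by linarith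
    refine ⟨f ⌈u / (ε / 2)⌉, Finset.mem_image_of_mem _ (Finset.mem_Icc.2 ⟨?_, ?_⟩), ?_⟩
    · exact Int.ceil_le_ceil (div_le_div_of_nonneg_right hu.1 hε2.le)
    · exact Int.ceil_le_ceil (div_le_div_of_nonneg_right hu.2 hε2.le)
    · have h2 := hf ⌈u / (ε / 2)⌉
      have h3 : u ≤ ⌈u / (ε / 2)⌉ * (ε / 2) := (div_le_iff₀ hε2).1 (Int.le_ceil _)
      have h4 : (⌈u / (ε / 2)⌉ : ℝ) * (ε / 2) < u + ε / 2 := by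
        have := mul_lt_mul_of_pos_right (Int.ceil_lt_add_one (u / (ε / 2))) hε2
        rwa [add_mul, div_mul_cancel₀ _ hε2.ne', one_mul] at this
      exact ⟨h3.trans_lt h2.1, by linarith [h2.2]⟩

/-- An equicontinuity principle: curves converging at one parameter converge at all parameters
provided that the possible limits at nearby parameters are isolated. -/
lemma tendsto_of_equicontinuous {P : Type*} {l : Filter P} {s₀ R s₁ : ℝ} {r : P → ℝ → ℝ}
    {r₁ : ℝ → ℝ} (hs₁ : s₁ ∈ Ioc 0 s₀)
    (hosc : ∀ τ₂ ∈ Icc 0 s₀, ∀ ε > 0, ∃ δ > 0,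
      (∀ᶠ p in l, ∀ τ ∈ Icc 0 s₀, ∀ τ' ∈ Icc 0 s₀, |τ - τ₂| < δ → |τ' - τ₂| < δ →
        |r p τ - r p τ'| ≤ ε) ∧
      ∀ τ ∈ Icc 0 s₀, ∀ τ' ∈ Icc 0 s₀, |τ - τ₂| < δ → |τ' - τ₂| < δ → |r₁ τ - r₁ τ'| ≤ ε)
    (hmem : ∀ᶠ p in l, ∀ τ ∈ Icc 0 s₀, r p τ ∈ Icc (-R) R)
    (hstart : Tendsto (fun p ↦ r p s₁) l (𝓝 (r₁ s₁)))
    (hiso : ∀ τ₁ ∈ Ioc 0 s₀, ∃ η > 0, ∀ᶠ τ in 𝓝[Ioc 0 s₀] τ₁, ∀ 𝒰 : Ultrafilter P, ↑𝒰 ≤ l →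
      ∀ b, Tendsto (fun p ↦ r p τ) 𝒰 (𝓝 b) → |b - r₁ τ₁| < η → b = r₁ τ)
    {τ : ℝ} (hτ : τ ∈ Icc 0 s₀) : Tendsto (fun p ↦ r p τ) l (𝓝 (r₁ τ)) := by
  have hIoc : Ioc 0 s₀ ⊆ Icc 0 s₀ := Ioc_subset_Icc_self
  have hcl : ∀ τ₁ ∈ Icc 0 s₀, (∃ᶠ τ in 𝓝[Ioc 0 s₀] τ₁, Tendsto (fun p ↦ r p τ) l (𝓝 (r₁ τ))) →
      Tendsto (fun p ↦ r p τ₁) l (𝓝 (r₁ τ₁)) := by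
    intro τ₁ hτ₁ hfr
    rw [Metric.tendsto_nhds]
    intro ε hε
    obtain ⟨δ, hδ, h1, h2⟩ := hosc τ₁ hτ₁ (ε / 4) (by linarith)
    obtain ⟨τ, ht, hτI, hτδ⟩ := (hfr.and_eventually (eventually_mem_nhdsWithin.and
      (mem_nhdsWithin_of_mem_nhds (Metric.ball_mem_nhds τ₁ hδ)))).exists
    filter_upwards [h1, Metric.tendsto_nhds.1 ht (ε / 4) (by linarith)] with p h3 h4
    have h5 := h3 τ₁ hτ₁ τ (hIoc hτI) (by simpa using hδ) hτδ
    have h6 := h2 τ (hIoc hτI) τ₁ hτ₁ hτδ (by simpa using hδ)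
    rw [Real.dist_eq] at h4 ⊢
    rw [abs_lt] at *
    rw [abs_le] at h5 h6
    constructor <;> linarith
  have key : ∀ τ ∈ Ioc 0 s₀, Tendsto (fun p ↦ r p τ) l (𝓝 (r₁ τ)) := by
    intro τ hτ
    let _ : TopologicalSpace Prop := ⊥
    have _ : DiscreteTopology Prop := ⟨rfl⟩
    have := isPreconnected_Ioc.constant (Y := Prop)
      (f := fun τ ↦ Tendsto (fun p ↦ r p τ) l (𝓝 (r₁ τ))) ?_ hτ hs₁
    · simpa [hstart] using this
    intro τ₁ hτ₁
    rw [ContinuousWithinAt, nhds_discrete Prop, tendsto_pure]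
    by_cases h0 : Tendsto (fun p ↦ r p τ₁) l (𝓝 (r₁ τ₁))
    · obtain ⟨η, hη, hη'⟩ := hiso τ₁ hτ₁
      obtain ⟨δ, hδ, h1, -⟩ := hosc τ₁ (hIoc hτ₁) (η / 3) (by linarith)
      filter_upwards [hη', eventually_mem_nhdsWithin,
        mem_nhdsWithin_of_mem_nhds (Metric.ball_mem_nhds τ₁ hδ)] with τ h2 hτI hτδ
      simp only [h0, eq_iff_iff, iff_true]
      rw [tendsto_iff_ultrafilter]
      intro 𝒰 h𝒰
      have hm : ∀ᶠ p in 𝒰, r p τ ∈ Icc (-R) R := h𝒰 (hmem.mono fun p hp ↦ hp τ (hIoc hτI))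
      obtain ⟨b, -, hb⟩ := isCompact_Icc.ultrafilter_le_nhds (𝒰.map (r · τ)) (le_principal_iff.2 hm)
      have hb : Tendsto (fun p ↦ r p τ) 𝒰 (𝓝 b) := hb
      rw [← h2 𝒰 h𝒰 b hb ?_]
      · exact hb
      · have h3 : Tendsto (fun p ↦ |r p τ - r p τ₁|) 𝒰 (𝓝 |b - r₁ τ₁|) :=
          (hb.sub (h0.mono_left h𝒰)).abs
        refine (le_of_tendsto h3 (h𝒰 (h1.mono fun p hp ↦
          hp τ (hIoc hτI) τ₁ (hIoc hτ₁) hτδ (by simpa using hδ)))).trans_lt (by linarith)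
    · have : ∀ᶠ τ in 𝓝[Ioc 0 s₀] τ₁, ¬ Tendsto (fun p ↦ r p τ) l (𝓝 (r₁ τ)) := by
        by_contra hcon
        exact h0 (hcl τ₁ (hIoc hτ₁) hcon)
      filter_upwards [this] with τ hτ
      simp [h0, hτ]
  refine hcl τ hτ ?_
  have : (𝓝[Ioc 0 s₀] τ).NeBot := by
    rw [← mem_closure_iff_nhdsWithin_neBot, closure_Ioc (hs₁.1.trans_le hs₁.2).ne]
    exact hτ
  refine Eventually.frequently ?_
  filter_upwards [eventually_mem_nhdsWithin] with τ hτ using key τ hτ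

lemma FibreFamily.continuous_eval {E ι : Type*} [TopologicalSpace E] {s₀ : ℝ} {L : Set E}
    {g : ι → ℝ → E → Polynomial ℝ} (h : FibreFamily s₀ L g) (i : ι) :
    Continuous fun q : ℝ × E × ℝ ↦ (g i q.1 q.2.1).eval q.2.2 := by
  obtain ⟨d, hd⟩ := h.bound
  have : (fun q : ℝ × E × ℝ ↦ (g i q.1 q.2.1).eval q.2.2) = fun q ↦
      ∑ n ∈ Finset.range (d + 1), (g i q.1 q.2.1).coeff n * q.2.2 ^ n := by
    ext q
    exact Polynomial.eval_eq_sum_range' (Nat.lt_succ_of_le (hd i _ _)) _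
  rw [this]
  refine continuous_finsetSum _ fun n _ ↦ ?_
  have h1 := (h.cont i n).comp (continuous_fst.prodMk
    (continuous_fst.comp continuous_snd) : Continuous fun q : ℝ × E × ℝ ↦ (q.1, q.2.1))
  exact h1.mul ((continuous_snd.comp continuous_snd).pow n)

/-- Real zeros in `[-R, R]` of a family of polynomials. -/
noncomputable def boundedZeros {E ι : Type*} [Fintype ι] (g : ι → ℝ → E → Polynomial ℝ) (R s : ℝ)
    (x : E) : Finset ℝ :=
  (realZeros fun i ↦ g i s x).filter (· ∈ Icc (-R) R)

/-- Transport of the real zeros of a family of polynomials along a flow. -/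
noncomputable def zeroTransport {E ι : Type*} [Fintype ι] (g : ι → ℝ → E → Polynomial ℝ)
    (Ψ : ℝ → ℝ → E → E) (s s' : ℝ) (x : E) (a : ℝ) : ℝ :=
  if s' = 0 then limUnder (𝓝[>] 0) fun τ ↦
    orderMatch (realZeros fun i ↦ g i s x) (realZeros fun i ↦ g i τ (Ψ s τ x)) a
  else orderMatch (realZeros fun i ↦ g i s x) (realZeros fun i ↦ g i s' (Ψ s s' x)) a

structure LiftSetup {E ι : Type*} [TopologicalSpace E] [Fintype ι] (s₀ R : ℝ) (L : Set E)
    (Ψ : ℝ → ℝ → E → E) (g : ι → ℝ → E → Polynomial ℝ) : Prop where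
  flow : FlowOn s₀ L Ψ
  fam : FibreFamily s₀ L g
  card : ∀ s ∈ Ioc 0 s₀, ∀ s' ∈ Ioc 0 s₀, ∀ x ∈ L,
    ((∏ i, g i s x).map (algebraMap ℝ ℂ)).roots.toFinset.card =
    ((∏ i, g i s' (Ψ s s' x)).map (algebraMap ℝ ℂ)).roots.toFinset.card
  pos : 0 < R
  top : ∃ i, ∀ s ∈ Ioc 0 s₀, ∀ x ∈ L, ∀ T, (g i s x).eval T = 0 ↔ T = R
  bot : ∃ i, ∀ s ∈ Ioc 0 s₀, ∀ x ∈ L, ∀ T, (g i s x).eval T = 0 ↔ T = -R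

namespace LiftSetup

variable {E ι : Type*} [TopologicalSpace E] [Fintype ι] {s₀ R : ℝ} {L : Set E}
  {Ψ : ℝ → ℝ → E → E} {g : ι → ℝ → E → Polynomial ℝ}

lemma mem_zeros (h : LiftSetup s₀ R L Ψ g) {s : ℝ} (hs : s ∈ Icc 0 s₀) {x : E} (hx : x ∈ L)
    {T : ℝ} : T ∈ realZeros (fun i ↦ g i s x) ↔ ∃ i, (g i s x).eval T = 0 :=
  mem_realZeros fun i ↦ h.fam.ne_zero i s hs x hx

lemma mem_boundedZeros (h : LiftSetup s₀ R L Ψ g) {s : ℝ} (hs : s ∈ Icc 0 s₀) {x : E} (hx : x ∈ L)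
    {T : ℝ} : T ∈ boundedZeros g R s x ↔ (∃ i, (g i s x).eval T = 0) ∧ T ∈ Icc (-R) R := by
  rw [boundedZeros, Finset.mem_filter, h.mem_zeros hs hx]

lemma top_mem (h : LiftSetup s₀ R L Ψ g) {s : ℝ} (hs : s ∈ Ioc 0 s₀) {x : E} (hx : x ∈ L) :
    R ∈ boundedZeros g R s x := by
  obtain ⟨i, hi⟩ := h.top
  have := h.pos
  exact (h.mem_boundedZeros (Ioc_subset_Icc_self hs) hx).2
    ⟨⟨i, (hi s hs x hx R).2 rfl⟩, ⟨by linarith, le_rfl⟩⟩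

lemma bot_mem (h : LiftSetup s₀ R L Ψ g) {s : ℝ} (hs : s ∈ Ioc 0 s₀) {x : E} (hx : x ∈ L) :
    -R ∈ boundedZeros g R s x := by
  obtain ⟨i, hi⟩ := h.bot
  have := h.pos
  exact (h.mem_boundedZeros (Ioc_subset_Icc_self hs) hx).2
    ⟨⟨i, (hi s hs x hx _).2 rfl⟩, ⟨le_rfl, by linarith⟩⟩

lemma continuousOn_flow (h : LiftSetup s₀ R L Ψ g) {s : ℝ} (hs : s ∈ Ioc 0 s₀) {x : E}
    (hx : x ∈ L) : ContinuousOn (fun τ ↦ Ψ s τ x) (Icc 0 s₀) :=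
  h.flow.cont.comp (f := fun τ ↦ (s, τ, x)) (by fun_prop) fun _ hτ ↦ ⟨hs, hτ, hx⟩

lemma trackedZeros (h : LiftSetup s₀ R L Ψ g) {s : ℝ} (hs : s ∈ Ioc 0 s₀) {x : E} (hx : x ∈ L) :
    TrackedZeros s₀ (fun τ i ↦ g i τ (Ψ s τ x)) where
  ne_zero τ hτ i := h.fam.ne_zero i τ (Ioc_subset_Icc_self hτ) _
    (h.flow.mapsTo s hs τ (Ioc_subset_Icc_self hτ) x hx)
  cont i := by
    refine (h.fam.continuous_eval i).comp_continuousOn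
      (f := fun q : ℝ × ℝ ↦ (q.1, Ψ s q.1 x, q.2)) ?_
    refine continuousOn_fst.prodMk (ContinuousOn.prodMk ?_ continuousOn_snd)
    exact (h.continuousOn_flow hs hx).comp continuousOn_fst fun q hq ↦ Ioc_subset_Icc_self hq.1
  track τ₁ hτ₁ ε hε := by
    have hm : ∀ τ ∈ Ioc 0 s₀, Ψ s τ x ∈ L := fun τ hτ ↦
      h.flow.mapsTo s hs τ (Ioc_subset_Icc_self hτ) x hx
    refine eventually_exists_bijOn_realZeros (l := 𝓝[Ioc 0 s₀] τ₁)
      (G := fun i τ ↦ g i τ (Ψ s τ x)) ?_ ?_ ?_ ?_ ?_ hε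
    · exact fun i ↦ h.fam.ne_zero i τ₁ (Ioc_subset_Icc_self hτ₁) _ (hm τ₁ hτ₁)
    · filter_upwards [eventually_mem_nhdsWithin] with τ hτ i using
        h.fam.ne_zero i τ (Ioc_subset_Icc_self hτ) _ (hm τ hτ)
    · intro i
      obtain ⟨d, hd⟩ := h.fam.deg i
      filter_upwards [eventually_mem_nhdsWithin] with τ hτ
      rw [hd τ hτ _ (hm τ hτ), hd τ₁ hτ₁ _ (hm τ₁ hτ₁)]
    · intro i n
      have h1 : ContinuousOn (fun τ ↦ (τ, Ψ s τ x)) (Icc 0 s₀) :=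
        continuousOn_id.prodMk (h.continuousOn_flow hs hx)
      have h2 := (h.fam.cont i n).comp_continuousOn h1
      exact (h2 τ₁ (Ioc_subset_Icc_self hτ₁)).mono Ioc_subset_Icc_self
    · filter_upwards [eventually_mem_nhdsWithin] with τ hτ
      have := h.card s hs τ hτ x hx
      have h2 := h.card s hs τ₁ hτ₁ x hx
      exact this.symm.trans h2

end LiftSetup

namespace LiftSetup

variable {E ι : Type*} [TopologicalSpace E] [Fintype ι] {s₀ R : ℝ} {L : Set E}
  {Ψ : ℝ → ℝ → E → E} {g : ι → ℝ → E → Polynomial ℝ}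

lemma zeroTransport_of_pos (h : LiftSetup s₀ R L Ψ g) {s : ℝ} (hs : s ∈ Ioc 0 s₀) {x : E}
    (hx : x ∈ L) {s' : ℝ} (hs' : s' ∈ Ioc 0 s₀) : zeroTransport g Ψ s s' x =
      orderMatch (realZeros fun i ↦ g i s (Ψ s s x)) (realZeros fun i ↦ g i s' (Ψ s s' x)) := by
  ext a
  rw [zeroTransport, if_neg hs'.1.ne', h.flow.refl s hs x hx]

lemma eval_zeroTransport (h : LiftSetup s₀ R L Ψ g) {s : ℝ} (hs : s ∈ Ioc 0 s₀) {x : E}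
    (hx : x ∈ L) {s' : ℝ} (hs' : s' ∈ Ioc 0 s₀) {a : ℝ} (ha : a ∈ realZeros fun i ↦ g i s x)
    (i : ι) : (g i s' (Ψ s s' x)).eval (zeroTransport g Ψ s s' x a) = 0 ↔
      (g i s x).eval a = 0 := by
  have := (h.trackedZeros hs hx).eval_orderMatch_eq_zero_iff hs hs' (a := a)
    (by rwa [h.flow.refl s hs x hx]) i
  rwa [← h.zeroTransport_of_pos hs hx hs', h.flow.refl s hs x hx] at this

lemma zeroTransport_top (h : LiftSetup s₀ R L Ψ g) {s : ℝ} (hs : s ∈ Ioc 0 s₀) {x : E}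
    (hx : x ∈ L) {s' : ℝ} (hs' : s' ∈ Ioc 0 s₀) : zeroTransport g Ψ s s' x R = R := by
  obtain ⟨i, hi⟩ := h.top
  have hR : R ∈ realZeros fun i ↦ g i s x := (Finset.mem_filter.1 (h.top_mem hs hx)).1
  rw [← hi s' hs' _ (h.flow.mapsTo s hs s' (Ioc_subset_Icc_self hs') x hx),
    h.eval_zeroTransport hs hx hs' hR, hi s hs x hx]

lemma zeroTransport_bot (h : LiftSetup s₀ R L Ψ g) {s : ℝ} (hs : s ∈ Ioc 0 s₀) {x : E}
    (hx : x ∈ L) {s' : ℝ} (hs' : s' ∈ Ioc 0 s₀) : zeroTransport g Ψ s s' x (-R) = -R := by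
  obtain ⟨i, hi⟩ := h.bot
  have hR : -R ∈ realZeros fun i ↦ g i s x := (Finset.mem_filter.1 (h.bot_mem hs hx)).1
  rw [← hi s' hs' _ (h.flow.mapsTo s hs s' (Ioc_subset_Icc_self hs') x hx),
    h.eval_zeroTransport hs hx hs' hR, hi s hs x hx]

lemma zeroTransport_spec (h : LiftSetup s₀ R L Ψ g) {s : ℝ} (hs : s ∈ Ioc 0 s₀) {x : E}
    (hx : x ∈ L) {s' : ℝ} (hs' : s' ∈ Ioc 0 s₀) :
    StrictMonoOn (zeroTransport g Ψ s s' x) (boundedZeros g R s x) ∧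
    BijOn (zeroTransport g Ψ s s' x) (boundedZeros g R s x) (boundedZeros g R s' (Ψ s s' x)) := by
  obtain ⟨hm, hb⟩ := orderMatch_spec ((h.trackedZeros hs hx).card_eq hs hs')
  rw [← h.zeroTransport_of_pos hs hx hs', h.flow.refl s hs x hx] at hm hb
  have hsub : ∀ s x, (boundedZeros g R s x : Set ℝ) ⊆ realZeros fun i ↦ g i s x := fun s x a ha ↦
    (Finset.mem_filter.1 ha).1
  have hR := hsub _ _ (h.top_mem hs hx)
  have hR' := hsub _ _ (h.bot_mem hs hx)
  have hkey : ∀ a ∈ realZeros (fun i ↦ g i s x),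
      zeroTransport g Ψ s s' x a ∈ Icc (-R) R ↔ a ∈ Icc (-R) R := by
    intro a ha
    have h1 := hm.le_iff_le hR' ha
    have h2 := hm.le_iff_le ha hR
    rw [h.zeroTransport_top hs hx hs'] at h2
    rw [h.zeroTransport_bot hs hx hs'] at h1
    exact and_congr h1 h2
  refine ⟨hm.mono (hsub _ _), fun a ha ↦ ?_, hb.injOn.mono (hsub _ _), fun b hbB ↦ ?_⟩
  · exact Finset.mem_filter.2 ⟨hb.mapsTo (hsub _ _ ha),
      (hkey a (hsub _ _ ha)).2 (Finset.mem_filter.1 ha).2⟩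
  · obtain ⟨a, ha, rfl⟩ := hb.surjOn (hsub _ _ hbB)
    exact ⟨a, Finset.mem_filter.2 ⟨ha, (hkey a ha).1 (Finset.mem_filter.1 hbB).2⟩, rfl⟩

lemma zeroTransport_self (h : LiftSetup s₀ R L Ψ g) {s : ℝ} (hs : s ∈ Ioc 0 s₀) {x : E}
    (hx : x ∈ L) {a : ℝ} (ha : a ∈ boundedZeros g R s x) : zeroTransport g Ψ s s x a = a := by
  rw [zeroTransport, if_neg hs.1.ne', h.flow.refl s hs x hx,
    orderMatch_self (Finset.mem_filter.1 ha).1]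

lemma continuousOn_zeroTransport_pos (h : LiftSetup s₀ R L Ψ g) {s : ℝ} (hs : s ∈ Ioc 0 s₀) {x : E}
    (hx : x ∈ L) {a : ℝ} (ha : a ∈ boundedZeros g R s x) :
    ContinuousOn (fun τ ↦ zeroTransport g Ψ s τ x a) (Ioc 0 s₀) := by
  have := (h.trackedZeros hs hx).continuousOn_orderMatch hs (a := a)
    (by rw [h.flow.refl s hs x hx]; exact (Finset.mem_filter.1 ha).1)
  refine this.congr fun τ hτ ↦ ?_
  rw [h.zeroTransport_of_pos hs hx hτ]

lemma exists_oscillation_pos (h : LiftSetup s₀ R L Ψ g) {s₁ τ₂ : ℝ} (hs₁ : s₁ ∈ Ioc 0 s₀)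
    (hτ₂ : τ₂ ∈ Icc 0 s₀) {x₁ : E} (hx₁ : x₁ ∈ L) {ε : ℝ} (hε : 0 < ε) : ∃ δ > 0,
      ∀ᶠ p in 𝓝[Ioc 0 s₀ ×ˢ L] (s₁, x₁), ∀ a ∈ boundedZeros g R p.1 p.2,
        ∀ τ ∈ Ioc 0 s₀, ∀ τ' ∈ Ioc 0 s₀, |τ - τ₂| < δ → |τ' - τ₂| < δ →
        |zeroTransport g Ψ p.1 τ p.2 a - zeroTransport g Ψ p.1 τ' p.2 a| ≤ ε := by
  have hy := h.flow.mapsTo s₁ hs₁ τ₂ hτ₂ x₁ hx₁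
  have hne : ∏ i, g i τ₂ (Ψ s₁ τ₂ x₁) ≠ 0 :=
    Finset.prod_ne_zero_iff.2 fun i _ ↦ h.fam.ne_zero i τ₂ hτ₂ _ hy
  obtain ⟨N, hN, hN'⟩ := exists_grid hne R hε
  have hev : ∀ᶠ q : ℝ × ℝ × E in 𝓝[Icc 0 s₀ ×ˢ (Ioc 0 s₀ ×ˢ L)] (τ₂, (s₁, x₁)),
      ∀ T ∈ N, ∀ i, (g i q.1 (Ψ q.2.1 q.1 q.2.2)).eval T ≠ 0 := by
    rw [Filter.eventually_all_finset]
    intro T hT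
    rw [Filter.eventually_all]
    intro i
    have hc : ContinuousOn (fun q : ℝ × ℝ × E ↦ (g i q.1 (Ψ q.2.1 q.1 q.2.2)).eval T)
        (Icc 0 s₀ ×ˢ (Ioc 0 s₀ ×ˢ L)) := by
      refine (h.fam.continuous_eval i).comp_continuousOn
        (f := fun q : ℝ × ℝ × E ↦ (q.1, Ψ q.2.1 q.1 q.2.2, T)) ?_
      refine continuousOn_fst.prodMk (ContinuousOn.prodMk ?_ continuousOn_const)
      exact h.flow.cont.comp (f := fun q : ℝ × ℝ × E ↦ (q.2.1, q.1, q.2.2)) (by fun_prop)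
        fun q hq ↦ ⟨hq.2.1, hq.1, hq.2.2⟩
    refine (hc _ ⟨hτ₂, hs₁, hx₁⟩).eventually_ne ?_
    have := hN T hT
    rw [Polynomial.eval_prod, Finset.prod_ne_zero_iff] at this
    exact this i (Finset.mem_univ i)
  rw [nhdsWithin_prod_eq, eventually_prod_iff] at hev
  obtain ⟨pa, hpa, pb, hpb, hab⟩ := hev
  obtain ⟨δ, hδ, hpa⟩ := Metric.mem_nhdsWithin_iff.1 hpa
  refine ⟨δ, hδ, ?_⟩
  have aux : ∀ p : ℝ × E, p ∈ Ioc 0 s₀ ×ˢ L → pb p → ∀ a ∈ boundedZeros g R p.1 p.2,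
        ∀ τ ∈ Ioc 0 s₀, ∀ τ' ∈ Ioc 0 s₀, |τ - τ₂| < δ → |τ' - τ₂| < δ →
        zeroTransport g Ψ p.1 τ' p.2 a - zeroTransport g Ψ p.1 τ p.2 a ≤ ε := by
    intro p hp hpb a ha τ hτ τ' hτ' hτδ hτδ'
    by_contra! hcon
    have hmem := (h.zeroTransport_spec hp.1 hp.2 hτ).2.mapsTo ha
    obtain ⟨T, hTN, hT⟩ := hN' _ (Finset.mem_filter.1 hmem).2 (zeroTransport g Ψ p.1 τ' p.2 a)
      (by linarith)
    have hsub : uIcc τ τ' ⊆ Ioc 0 s₀ := ordConnected_Ioc.uIcc_subset hτ hτ'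
    have hball : uIcc τ τ' ⊆ Metric.ball τ₂ δ := by
      rw [Real.ball_eq_Ioo]
      rw [abs_lt] at hτδ hτδ'
      exact ordConnected_Ioo.uIcc_subset ⟨by linarith, by linarith⟩ ⟨by linarith, by linarith⟩
    have hivt := intermediate_value_uIcc
      ((h.continuousOn_zeroTransport_pos hp.1 hp.2 ha).mono hsub)
    obtain ⟨τ'', hτ'', hT'⟩ := hivt (Icc_subset_uIcc (Ioo_subset_Icc_self hT))
    have hm := (h.zeroTransport_spec hp.1 hp.2 (hsub hτ'')).2.mapsTo ha
    simp only at hT'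
    rw [hT', Finset.mem_coe, h.mem_boundedZeros (Ioc_subset_Icc_self (hsub hτ''))
      (h.flow.mapsTo _ hp.1 _ (Ioc_subset_Icc_self (hsub hτ'')) _ hp.2)] at hm
    obtain ⟨⟨i, hi⟩, -⟩ := hm
    exact hab (hpa ⟨hball hτ'', Ioc_subset_Icc_self (hsub hτ'')⟩) hpb T hTN i hi
  filter_upwards [hpb, eventually_mem_nhdsWithin] with p hpb hp a ha τ hτ τ' hτ' hτδ hτδ'
  rw [abs_le]
  constructor
  · linarith [aux p hp hpb a ha τ hτ τ' hτ' hτδ hτδ']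
  · exact aux p hp hpb a ha τ' hτ' τ hτ hτδ' hτδ

lemma tendsto_zeroTransport (h : LiftSetup s₀ R L Ψ g) {s : ℝ} (hs : s ∈ Ioc 0 s₀) {x : E}
    (hx : x ∈ L) {a : ℝ} (ha : a ∈ boundedZeros g R s x) {τ : ℝ} (hτ : τ ∈ Icc 0 s₀) :
    Tendsto (fun τ ↦ zeroTransport g Ψ s τ x a) (𝓝[Ioc 0 s₀] τ)
      (𝓝 (zeroTransport g Ψ s τ x a)) := by
  rcases hτ.1.eq_or_lt with rfl | hpos
  swap
  · exact h.continuousOn_zeroTransport_pos hs hx ha τ ⟨hpos, hτ.2⟩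
  have hev : (fun τ ↦ orderMatch (realZeros fun i ↦ g i s x)
      (realZeros fun i ↦ g i τ (Ψ s τ x)) a) =ᶠ[𝓝[>] 0] fun τ ↦ zeroTransport g Ψ s τ x a := by
    filter_upwards [eventually_mem_nhdsWithin] with τ hτ
    rw [zeroTransport, if_neg (ne_of_gt hτ)]
  have hlim : ∃ b, Tendsto (fun τ ↦ zeroTransport g Ψ s τ x a) (𝓝[>] 0) (𝓝 b) := by
    rw [← cauchy_map_iff_exists_tendsto, Metric.cauchy_iff]
    refine ⟨inferInstance, fun ε hε ↦ ?_⟩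
    obtain ⟨δ, hδ, hev⟩ := h.exists_oscillation_pos hs hτ hx (half_pos hε)
    have hp := hev.self_of_nhdsWithin ⟨hs, hx⟩ a ha
    refine ⟨(fun τ ↦ zeroTransport g Ψ s τ x a) '' (Ioo 0 (min δ s₀)), image_mem_map
      (Ioo_mem_nhdsGT (lt_min hδ h.flow.pos)), ?_⟩
    rintro _ ⟨τ, hτ, rfl⟩ _ ⟨τ', hτ', rfl⟩
    have e1 := lt_min_iff.1 hτ.2
    have e2 := lt_min_iff.1 hτ'.2
    refine (hp τ ⟨hτ.1, e1.2.le⟩ τ' ⟨hτ'.1, e2.2.le⟩ ?_ ?_).trans_lt (half_lt_self hε)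
    · rw [sub_zero, abs_of_pos hτ.1]; exact e1.1
    · rw [sub_zero, abs_of_pos hτ'.1]; exact e2.1
  obtain ⟨b, hb⟩ := hlim
  have : zeroTransport g Ψ s 0 x a = b := by
    rw [zeroTransport, if_pos rfl]
    exact (hb.congr' hev.symm).limUnder_eq
  rw [this]
  exact hb.mono_left (nhdsWithin_mono _ Ioc_subset_Ioi_self)

lemma neBot_nhdsWithin (h : LiftSetup s₀ R L Ψ g) {τ : ℝ} (hτ : τ ∈ Icc 0 s₀) :
    (𝓝[Ioc 0 s₀] τ).NeBot := by
  rw [← mem_closure_iff_nhdsWithin_neBot, closure_Ioc h.flow.pos.ne]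
  exact hτ

lemma zeroTransport_mem_Icc (h : LiftSetup s₀ R L Ψ g) {s : ℝ} (hs : s ∈ Ioc 0 s₀) {x : E}
    (hx : x ∈ L) {a : ℝ} (ha : a ∈ boundedZeros g R s x) {τ : ℝ} (hτ : τ ∈ Icc 0 s₀) :
    zeroTransport g Ψ s τ x a ∈ Icc (-R) R := by
  have := h.neBot_nhdsWithin hτ
  refine isClosed_Icc.mem_of_tendsto (h.tendsto_zeroTransport hs hx ha hτ) ?_
  filter_upwards [eventually_mem_nhdsWithin] with τ hτ
  exact (Finset.mem_filter.1 ((h.zeroTransport_spec hs hx hτ).2.mapsTo ha)).2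

lemma exists_oscillation (h : LiftSetup s₀ R L Ψ g) {s₁ τ₂ : ℝ} (hs₁ : s₁ ∈ Ioc 0 s₀)
    (hτ₂ : τ₂ ∈ Icc 0 s₀) {x₁ : E} (hx₁ : x₁ ∈ L) {ε : ℝ} (hε : 0 < ε) : ∃ δ > 0,
      ∀ᶠ p in 𝓝[Ioc 0 s₀ ×ˢ L] (s₁, x₁), ∀ a ∈ boundedZeros g R p.1 p.2,
        ∀ τ ∈ Icc 0 s₀, ∀ τ' ∈ Icc 0 s₀, |τ - τ₂| < δ → |τ' - τ₂| < δ →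
        |zeroTransport g Ψ p.1 τ p.2 a - zeroTransport g Ψ p.1 τ' p.2 a| ≤ ε := by
  obtain ⟨δ, hδ, hev⟩ := h.exists_oscillation_pos hs₁ hτ₂ hx₁ hε
  refine ⟨δ, hδ, ?_⟩
  filter_upwards [hev, eventually_mem_nhdsWithin] with p hev hp a ha τ hτ τ' hτ' hτδ hτδ'
  have n1 := h.neBot_nhdsWithin hτ
  have n2 := h.neBot_nhdsWithin hτ'
  have t1 := h.tendsto_zeroTransport hp.1 hp.2 ha hτ
  have t2 := h.tendsto_zeroTransport hp.1 hp.2 ha hτ'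
  have hb : ∀ τ, |τ - τ₂| < δ → ∀ᶠ τ'' in 𝓝[Ioc 0 s₀] τ, |τ'' - τ₂| < δ := fun τ hτ ↦
    mem_nhdsWithin_of_mem_nhds (Metric.isOpen_ball.mem_nhds hτ)
  refine le_of_tendsto (t1.sub_const _).abs ?_
  filter_upwards [hb τ hτδ, eventually_mem_nhdsWithin] with u hu huI
  refine le_of_tendsto (t2.const_sub _).abs ?_
  filter_upwards [hb τ' hτδ', eventually_mem_nhdsWithin] with u' hu' hu'I
  exact hev a ha u huI u' hu'I hu hu'

end LiftSetup

namespace LiftSetup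

variable {E ι : Type*} [TopologicalSpace E] [Fintype ι] {s₀ R : ℝ} {L : Set E}
  {Ψ : ℝ → ℝ → E → E} {g : ι → ℝ → E → Polynomial ℝ}

lemma continuousOn_zeroTransport (h : LiftSetup s₀ R L Ψ g) :
    ContinuousOn (fun q : (ℝ × ℝ × E) × ℝ ↦ zeroTransport g Ψ q.1.1 q.1.2.1 q.1.2.2 q.2)
      {q | q.1 ∈ Ioc 0 s₀ ×ˢ Icc 0 s₀ ×ˢ L ∧ q.2 ∈ boundedZeros g R q.1.1 q.1.2.2} := by
  rintro ⟨⟨s₁, τ₁, x₁⟩, a₁⟩ ⟨⟨hs₁, hτ₁, hx₁⟩, ha₁⟩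
  simp only at hs₁ hτ₁ hx₁ ha₁
  set D : Set ((ℝ × ℝ × E) × ℝ) :=
    {q | q.1 ∈ Ioc 0 s₀ ×ˢ Icc 0 s₀ ×ˢ L ∧ q.2 ∈ boundedZeros g R q.1.1 q.1.2.2} with hD
  have hb : Tendsto (fun q : (ℝ × ℝ × E) × ℝ ↦ (q.1.1, q.1.2.2)) (𝓝[D] ((s₁, τ₁, x₁), a₁))
      (𝓝[Ioc 0 s₀ ×ˢ L] (s₁, x₁)) := by
    rw [tendsto_nhdsWithin_iff]
    refine ⟨?_, ?_⟩
    · have : Continuous fun q : (ℝ × ℝ × E) × ℝ ↦ (q.1.1, q.1.2.2) := by fun_prop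
      exact (this.tendsto ((s₁, τ₁, x₁), a₁)).mono_left nhdsWithin_le_nhds
    · filter_upwards [eventually_mem_nhdsWithin] with q hq using ⟨hq.1.1, hq.1.2.2⟩
  have ht {f : (ℝ × ℝ × E) × ℝ → ℝ} (hf : Continuous f) :
      Tendsto f (𝓝[D] ((s₁, τ₁, x₁), a₁)) (𝓝 (f ((s₁, τ₁, x₁), a₁))) :=
    (hf.tendsto _).mono_left nhdsWithin_le_nhds
  have hmemD : ∀ᶠ q in 𝓝[D] ((s₁, τ₁, x₁), a₁), q ∈ D := eventually_mem_nhdsWithin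
  have hIoc : Ioc 0 s₀ ⊆ Icc 0 s₀ := Ioc_subset_Icc_self
  have hosc : ∀ τ₂ ∈ Icc 0 s₀, ∀ ε > 0, ∃ δ > 0, (∀ᶠ q in 𝓝[D] ((s₁, τ₁, x₁), a₁),
      ∀ τ ∈ Icc 0 s₀, ∀ τ' ∈ Icc 0 s₀, |τ - τ₂| < δ → |τ' - τ₂| < δ →
        |zeroTransport g Ψ q.1.1 τ q.1.2.2 q.2 - zeroTransport g Ψ q.1.1 τ' q.1.2.2 q.2| ≤ ε) ∧
      ∀ τ ∈ Icc 0 s₀, ∀ τ' ∈ Icc 0 s₀, |τ - τ₂| < δ → |τ' - τ₂| < δ →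
        |zeroTransport g Ψ s₁ τ x₁ a₁ - zeroTransport g Ψ s₁ τ' x₁ a₁| ≤ ε := by
    intro τ₂ hτ₂ ε hε
    obtain ⟨δ, hδ, hev⟩ := h.exists_oscillation hs₁ hτ₂ hx₁ hε
    refine ⟨δ, hδ, ?_, hev.self_of_nhdsWithin ⟨hs₁, hx₁⟩ a₁ ha₁⟩
    filter_upwards [hb.eventually hev, hmemD] with q hq hqD using hq q.2 hqD.2
  have key := tendsto_of_equicontinuous (l := 𝓝[D] ((s₁, τ₁, x₁), a₁)) (R := R)
    (r := fun q τ ↦ zeroTransport g Ψ q.1.1 τ q.1.2.2 q.2)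
    (r₁ := fun τ ↦ zeroTransport g Ψ s₁ τ x₁ a₁) hs₁ hosc ?_ ?_ ?_ hτ₁
  · change Tendsto _ _ (𝓝 (zeroTransport g Ψ s₁ τ₁ x₁ a₁))
    rw [Metric.tendsto_nhds] at key ⊢
    intro ε hε
    obtain ⟨δ, hδ, hev, -⟩ := hosc τ₁ hτ₁ (ε / 2) (half_pos hε)
    have hτ : ∀ᶠ q in 𝓝[D] ((s₁, τ₁, x₁), a₁), |q.1.2.1 - τ₁| < δ :=
      (ht (f := fun q ↦ q.1.2.1) (by fun_prop)) (Metric.ball_mem_nhds τ₁ hδ)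
    filter_upwards [hev, key (ε / 2) (half_pos hε), hτ, hmemD] with q h1 h2 h3 h4
    have h5 := h1 q.1.2.1 h4.1.2.1 τ₁ hτ₁ h3 (by simpa using hδ)
    rw [Real.dist_eq] at h2 ⊢
    have := abs_sub_le (zeroTransport g Ψ q.1.1 q.1.2.1 q.1.2.2 q.2)
      (zeroTransport g Ψ q.1.1 τ₁ q.1.2.2 q.2) (zeroTransport g Ψ s₁ τ₁ x₁ a₁)
    linarith
  · filter_upwards [hmemD] with q hq τ hτ using h.zeroTransport_mem_Icc hq.1.1 hq.1.2.2 hq.2 hτ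
  · simp only [h.zeroTransport_self hs₁ hx₁ ha₁]
    rw [Metric.tendsto_nhds]
    intro ε hε
    obtain ⟨δ, hδ, hev, -⟩ := hosc s₁ (hIoc hs₁) (ε / 2) (half_pos hε)
    have hs : ∀ᶠ q in 𝓝[D] ((s₁, τ₁, x₁), a₁), |q.1.1 - s₁| < δ :=
      (ht (f := fun q ↦ q.1.1) (by fun_prop)) (Metric.ball_mem_nhds s₁ hδ)
    have ha : ∀ᶠ q in 𝓝[D] ((s₁, τ₁, x₁), a₁), |q.2 - a₁| < ε / 2 :=
      (ht (f := fun q ↦ q.2) (by fun_prop)) (Metric.ball_mem_nhds a₁ (half_pos hε))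
    filter_upwards [hev, hs, ha, hmemD] with q h1 h2 h3 h4
    have h5 := h1 s₁ (hIoc hs₁) q.1.1 (hIoc h4.1.1) (by simpa using hδ) h2
    rw [h.zeroTransport_self h4.1.1 h4.1.2.2 h4.2] at h5
    rw [Real.dist_eq]
    have := abs_sub_le (zeroTransport g Ψ q.1.1 s₁ q.1.2.2 q.2) q.2 a₁
    linarith
  · intro τ₂ hτ₂
    have hT := h.trackedZeros hs₁ hx₁
    have ha₁' : a₁ ∈ realZeros fun i ↦ g i s₁ (Ψ s₁ s₁ x₁) := by
      rw [h.flow.refl s₁ hs₁ x₁ hx₁]; exact (Finset.mem_filter.1 ha₁).1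
    obtain ⟨η, hη, hev⟩ := hT.exists_isolation hτ₂ (hT.orderMatch_mem hs₁ hτ₂ ha₁')
    refine ⟨η, hη, ?_⟩
    filter_upwards [hev, eventually_mem_nhdsWithin] with τ hτ hτI 𝒰 h𝒰 b hb' hbη
    rw [h.zeroTransport_of_pos hs₁ hx₁ hτ₂] at hbη
    have hlim : b ∈ realZeros fun i ↦ g i τ (Ψ s₁ τ x₁) := by
      rw [h.mem_zeros (hIoc hτI) (h.flow.mapsTo s₁ hs₁ τ (hIoc hτI) x₁ hx₁)]
      by_contra! hcon
      have h1 : ∀ᶠ q : (ℝ × ℝ × E) × ℝ in 𝒰, ∀ i, (g i τ (Ψ q.1.1 τ q.1.2.2)).eval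
          (zeroTransport g Ψ q.1.1 τ q.1.2.2 q.2) ≠ 0 := by
        rw [Filter.eventually_all]
        intro i
        have hΨ : ContinuousOn (fun p : ℝ × E ↦ Ψ p.1 τ p.2) (Ioc 0 s₀ ×ˢ L) :=
          h.flow.cont.comp (f := fun p : ℝ × E ↦ (p.1, τ, p.2)) (by fun_prop)
            fun p hp ↦ ⟨hp.1, hIoc hτI, hp.2⟩
        have h2 : Tendsto (fun q : (ℝ × ℝ × E) × ℝ ↦ Ψ q.1.1 τ q.1.2.2) 𝒰 (𝓝 (Ψ s₁ τ x₁)) :=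
          (hΨ (s₁, x₁) ⟨hs₁, hx₁⟩).tendsto.comp (hb.mono_left h𝒰)
        have h3 := ((h.fam.continuous_eval i).tendsto (τ, Ψ s₁ τ x₁, b)).comp
          (tendsto_const_nhds.prodMk_nhds (h2.prodMk_nhds hb'))
        exact h3.eventually_ne (hcon i)
      obtain ⟨q, h2, h3⟩ := (h1.and (h𝒰 hmemD)).exists
      have h4 := (h.zeroTransport_spec h3.1.1 h3.1.2.2 hτI).2.mapsTo h3.2
      rw [Finset.mem_coe, h.mem_boundedZeros (hIoc hτI)
        (h.flow.mapsTo _ h3.1.1 _ (hIoc hτI) _ h3.1.2.2)] at h4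
      obtain ⟨⟨i, hi⟩, -⟩ := h4
      exact h2 i hi
    rw [hτ b hlim hbη, hT.orderMatch_trans hs₁ hτ₂ hτI ha₁', h.zeroTransport_of_pos hs₁ hx₁ hτI]

lemma eventually_exists_zero_near (h : LiftSetup s₀ R L Ψ g) {s₁ : ℝ} (hs₁ : s₁ ∈ Ioc 0 s₀) {x₁ : E}
    (hx₁ : x₁ ∈ L) {a : ℝ} {ε : ℝ} (hε : 0 < ε) :
    ∀ d i, (g i s₁ x₁).natDegree = d → (g i s₁ x₁).eval a = 0 →
    ∀ᶠ p in 𝓝[Ioc 0 s₀ ×ˢ L] (s₁, x₁), ∃ a', (∃ i, (g i p.1 p.2).eval a' = 0) ∧ |a' - a| < ε := by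
  intro d
  induction d using Nat.strong_induction_on with
  | _ d IH =>
  intro i hd hroot
  have hne := h.fam.ne_zero i s₁ (Ioc_subset_Icc_self hs₁) x₁ hx₁
  have hdeg : (g i s₁ x₁).natDegree ≠ 0 := by
    intro h0
    rw [Polynomial.eq_C_of_natDegree_eq_zero h0] at hroot hne
    rw [Polynomial.eval_C] at hroot
    exact hne (by rw [hroot, Polynomial.C_0])
  have hder : Polynomial.derivative (g i s₁ x₁) ≠ 0 := fun h0 ↦
    hdeg (Polynomial.derivative_eq_zero.1 h0)
  rcases h.fam.der i with h0 | ⟨j, hj⟩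
  · exact absurd (h0 s₁ hs₁ x₁ hx₁) hder
  obtain ⟨c, hc, hcj⟩ := hj s₁ hs₁ x₁ hx₁
  by_cases hjroot : (g j s₁ x₁).eval a = 0
  · refine IH _ ?_ j rfl hjroot
    rw [← Polynomial.natDegree_C_mul hc, ← hcj, ← hd]
    exact Polynomial.natDegree_derivative_lt hdeg
  · have hda : (Polynomial.derivative (g i s₁ x₁)).eval a ≠ 0 := by
      rw [hcj]; simp [hc, hjroot]
    obtain ⟨Q, hQ⟩ := Polynomial.dvd_iff_isRoot.2 hroot
    have hQa : Q.eval a ≠ 0 := by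
      rw [hQ] at hda
      simpa using hda
    have hQc : ∀ᶠ η in 𝓝[>] (0 : ℝ), 0 < Q.eval (a - η) * Q.eval (a + η) := by
      have : Continuous fun η ↦ Q.eval (a - η) * Q.eval (a + η) := by fun_prop
      refine (this.tendsto 0).mono_left nhdsWithin_le_nhds |>.eventually (lt_mem_nhds ?_)
      simp only [sub_zero, add_zero]
      exact mul_self_pos.2 hQa
    obtain ⟨η, hη, hηε⟩ := (hQc.and (Ioo_mem_nhdsGT hε)).exists
    have hsign : (g i s₁ x₁).eval (a - η) * (g i s₁ x₁).eval (a + η) < 0 := by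
      have : (g i s₁ x₁).eval (a - η) * (g i s₁ x₁).eval (a + η) =
          -(η ^ 2 * (Q.eval (a - η) * Q.eval (a + η))) := by
        rw [hQ]; simp; ring
      rw [this]
      exact neg_neg_of_pos (mul_pos (pow_pos hηε.1 2) hη)
    have hc' : Continuous fun p : ℝ × E ↦
        (g i p.1 p.2).eval (a - η) * (g i p.1 p.2).eval (a + η) := by
      have h1 : ∀ T, Continuous fun p : ℝ × E ↦ (g i p.1 p.2).eval T := fun T ↦
        (h.fam.continuous_eval i).comp (f := fun p : ℝ × E ↦ (p.1, p.2, T)) (by fun_prop)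
      exact (h1 _).mul (h1 _)
    filter_upwards [((hc'.tendsto (s₁, x₁)).mono_left nhdsWithin_le_nhds).eventually
      (gt_mem_nhds hsign)] with p hp
    have hle : a - η ≤ a + η := by linarith [hηε.1]
    have h0 : (0 : ℝ) ∈ uIcc ((g i p.1 p.2).eval (a - η)) ((g i p.1 p.2).eval (a + η)) := by
      rw [mem_uIcc]
      rcases mul_neg_iff.1 hp with h | h
      · exact Or.inr ⟨h.2.le, h.1.le⟩
      · exact Or.inl ⟨h.1.le, h.2.le⟩
    obtain ⟨T, hT, hT0⟩ := intermediate_value_uIcc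
      ((g i p.1 p.2).continuous.continuousOn (s := uIcc (a - η) (a + η))) h0
    rw [uIcc_of_le hle] at hT
    refine ⟨T, ⟨i, hT0⟩, ?_⟩
    rw [abs_lt]
    constructor <;> linarith [hT.1, hT.2, hηε.2]

lemma eventually_exists_boundedZeros_near (h : LiftSetup s₀ R L Ψ g) {s₁ : ℝ}
    (hs₁ : s₁ ∈ Ioc 0 s₀) {x₁ : E} (hx₁ : x₁ ∈ L) {a : ℝ} (ha : a ∈ boundedZeros g R s₁ x₁) {ε : ℝ}
    (hε : 0 < ε) : ∀ᶠ p in 𝓝[Ioc 0 s₀ ×ˢ L] (s₁, x₁), ∃ a' ∈ boundedZeros g R p.1 p.2,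
      |a' - a| < ε := by
  obtain ⟨⟨i, hi⟩, hle, hle'⟩ := (h.mem_boundedZeros (Ioc_subset_Icc_self hs₁) hx₁).1 ha
  rcases hle.eq_or_lt with rfl | hlt
  · filter_upwards [eventually_mem_nhdsWithin] with p hp
    exact ⟨_, h.bot_mem hp.1 hp.2, by simpa using hε⟩
  rcases hle'.eq_or_lt with rfl | hlt'
  · filter_upwards [eventually_mem_nhdsWithin] with p hp
    exact ⟨_, h.top_mem hp.1 hp.2, by simpa using hε⟩
  have hε' : 0 < min ε (min (a + R) (R - a)) :=
    lt_min hε (lt_min (by linarith) (by linarith))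
  filter_upwards [h.eventually_exists_zero_near hs₁ hx₁ hε' _ i rfl hi,
    eventually_mem_nhdsWithin] with p hp hpI
  obtain ⟨a', ha', hlt⟩ := hp
  obtain ⟨h1, h2⟩ := lt_min_iff.1 hlt
  obtain ⟨h2, h3⟩ := lt_min_iff.1 h2
  refine ⟨a', (h.mem_boundedZeros (Ioc_subset_Icc_self hpI.1) hpI.2).2 ⟨ha', ?_⟩, h1⟩
  rw [abs_lt] at h2 h3
  constructor <;> linarith

end LiftSetup

lemma continuous_finCons_prod (k : ℕ) :
    Continuous fun p : ℝ × (Fin k → ℝ) ↦ (Fin.cons p.1 p.2 : Fin (k + 1) → ℝ) :=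
  Continuous.finCons (A := fun _ : Fin (k + 1) ↦ ℝ) continuous_fst continuous_snd

/-- The lift of a flow to a cylinder, interpolating linearly between the transported zeros. -/
noncomputable def liftFlow {k : ℕ} {ι : Type*} [Fintype ι]
    (g : ι → ℝ → (Fin k → ℝ) → Polynomial ℝ) (R : ℝ)
    (Ψ : ℝ → ℝ → (Fin k → ℝ) → Fin k → ℝ) (s s' : ℝ) (v : Fin (k + 1) → ℝ) : Fin (k + 1) → ℝ :=
  Fin.cons (pwLinear (boundedZeros g R s (Fin.tail v)) (zeroTransport g Ψ s s' (Fin.tail v)) (v 0))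
    (Ψ s s' (Fin.tail v))

namespace LiftSetup

variable {k : ℕ} {ι : Type*} [Fintype ι] {s₀ R : ℝ} {L : Set (Fin k → ℝ)}
  {Ψ : ℝ → ℝ → (Fin k → ℝ) → Fin k → ℝ} {g : ι → ℝ → (Fin k → ℝ) → Polynomial ℝ}

lemma zeroTransport_zeroTransport (h : LiftSetup s₀ R L Ψ g) {s s' s'' : ℝ} (hs : s ∈ Ioc 0 s₀)
    (hs' : s' ∈ Ioc 0 s₀) (hs'' : s'' ∈ Icc 0 s₀) {x : Fin k → ℝ} (hx : x ∈ L) {a : ℝ}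
    (ha : a ∈ boundedZeros g R s x) :
    zeroTransport g Ψ s' s'' (Ψ s s' x) (zeroTransport g Ψ s s' x a) =
      zeroTransport g Ψ s s'' x a := by
  have hx' := h.flow.mapsTo s hs s' (Ioc_subset_Icc_self hs') x hx
  have ha' := (h.zeroTransport_spec hs hx hs').2.mapsTo ha
  have h1 := h.tendsto_zeroTransport hs hx ha hs''
  have h2 := h.tendsto_zeroTransport hs' hx' ha' hs''
  have := h.neBot_nhdsWithin hs''
  refine tendsto_nhds_unique_of_eventuallyEq h2 h1 ?_
  filter_upwards [eventually_mem_nhdsWithin] with τ hτ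
  have hT := h.trackedZeros hs hx
  have ha0 : a ∈ realZeros fun i ↦ g i s (Ψ s s x) := by
    rw [h.flow.refl s hs x hx]; exact (Finset.mem_filter.1 ha).1
  rw [zeroTransport, if_neg hτ.1.ne', h.flow.trans s hs s' hs' τ (Ioc_subset_Icc_self hτ) x hx,
    h.zeroTransport_of_pos hs hx hs', h.zeroTransport_of_pos hs hx hτ]
  exact hT.orderMatch_trans hs hs' hτ ha0

lemma continuousOn_pwLinear_zeroTransport (h : LiftSetup s₀ R L Ψ g) :
    ContinuousOn (fun q : (ℝ × ℝ × (Fin k → ℝ)) × ℝ ↦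
      pwLinear (boundedZeros g R q.1.1 q.1.2.2) (zeroTransport g Ψ q.1.1 q.1.2.1 q.1.2.2) q.2)
      ((Ioc 0 s₀ ×ˢ Icc 0 s₀ ×ˢ L) ×ˢ Icc (-R) R) := by
  have hproj : ∀ y ∈ Ioc 0 s₀ ×ˢ Icc 0 s₀ ×ˢ L,
      Tendsto (fun q : ℝ × ℝ × (Fin k → ℝ) ↦ (q.1, q.2.2)) (𝓝[Ioc 0 s₀ ×ˢ Icc 0 s₀ ×ˢ L] y)
      (𝓝[Ioc 0 s₀ ×ˢ L] (y.1, y.2.2)) := by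
    intro y hy
    rw [tendsto_nhdsWithin_iff]
    refine ⟨?_, ?_⟩
    · have : Continuous fun q : ℝ × ℝ × (Fin k → ℝ) ↦ (q.1, q.2.2) := by fun_prop
      exact (this.tendsto y).mono_left nhdsWithin_le_nhds
    · filter_upwards [eventually_mem_nhdsWithin] with q hq using ⟨hq.1, hq.2.2⟩
  refine continuousOn_pwLinear (A := fun q : ℝ × ℝ × (Fin k → ℝ) ↦ boundedZeros g R q.1 q.2.2)
    (c := fun q : ℝ × ℝ × (Fin k → ℝ) ↦ zeroTransport g Ψ q.1 q.2.1 q.2.2) ?_ ?_ ?_ ?_ ?_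
    h.continuousOn_zeroTransport
  · exact fun y hy ↦ h.top_mem hy.1 hy.2.2
  · exact fun y hy ↦ h.bot_mem hy.1 hy.2.2
  · exact fun y hy a ha ↦ (Finset.mem_filter.1 ha).2
  · intro y hy a ha
    rw [h.mem_boundedZeros (Ioc_subset_Icc_self hy.1) hy.2.2] at ha
    have hD : ∀ᶠ q : (ℝ × ℝ × (Fin k → ℝ)) × ℝ in 𝓝[Ioc 0 s₀ ×ˢ Icc 0 s₀ ×ˢ L] y ×ˢ 𝓝 a,
      q.1 ∈ Ioc 0 s₀ ×ˢ Icc 0 s₀ ×ˢ L := tendsto_fst.eventually eventually_mem_nhdsWithin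
    by_cases haR : a ∈ Icc (-R) R
    · have hne : ∀ i, (g i y.1 y.2.2).eval a ≠ 0 := fun i hi ↦ ha ⟨⟨i, hi⟩, haR⟩
      have hev : ∀ᶠ q : (ℝ × ℝ × (Fin k → ℝ)) × ℝ in 𝓝[Ioc 0 s₀ ×ˢ Icc 0 s₀ ×ˢ L] y ×ˢ 𝓝 a,
          ∀ i, (g i q.1.1 q.1.2.2).eval q.2 ≠ 0 := by
        rw [Filter.eventually_all]
        intro i
        have hc : Continuous fun q : (ℝ × ℝ × (Fin k → ℝ)) × ℝ ↦ (g i q.1.1 q.1.2.2).eval q.2 :=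
          (h.fam.continuous_eval i).comp
            (f := fun q : (ℝ × ℝ × (Fin k → ℝ)) × ℝ ↦ (q.1.1, q.1.2.2, q.2)) (by fun_prop)
        refine ((hc.tendsto (y, a)).mono_left ?_).eventually_ne (hne i)
        rw [nhds_prod_eq]
        exact prod_mono_left _ nhdsWithin_le_nhds
      filter_upwards [hev, hD] with q hq hqD hmem
      obtain ⟨⟨i, hi⟩, -⟩ :=
        (h.mem_boundedZeros (Ioc_subset_Icc_self hqD.1) hqD.2.2).1 hmem
      exact hq i hi
    · filter_upwards [tendsto_snd.eventually (isClosed_Icc.isOpen_compl.mem_nhds haR)] with q hq hmem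
      exact hq (Finset.mem_filter.1 hmem).2
  · intro y hy a ha ε hε
    exact (hproj y hy).eventually (h.eventually_exists_boundedZeros_near hy.1 hy.2.2 ha hε)

/-- The cylinder of height `R` over `L`. -/
def cylinder (R : ℝ) (L : Set (Fin k → ℝ)) : Set (Fin (k + 1) → ℝ) :=
  {v | v 0 ∈ Icc (-R) R ∧ Fin.tail v ∈ L}

lemma isCompact_cylinder (hL : IsCompact L) : IsCompact (cylinder R L) := by
  have : cylinder R L = (fun p : ℝ × (Fin k → ℝ) ↦ (Fin.cons p.1 p.2 : Fin (k + 1) → ℝ)) ''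
      (Icc (-R) R ×ˢ L) := by
    ext v
    constructor
    · intro hv
      exact ⟨(v 0, Fin.tail v), ⟨hv.1, hv.2⟩, Fin.cons_self_tail v⟩
    · rintro ⟨p, hp, rfl⟩
      exact ⟨hp.1, hp.2⟩
  rw [this]
  exact (isCompact_Icc.prod hL).image (continuous_finCons_prod k)

lemma flowOn_liftFlow (h : LiftSetup s₀ R L Ψ g) : FlowOn s₀ (cylinder R L) (liftFlow g R Ψ) where
  pos := h.flow.pos
  compact := isCompact_cylinder h.flow.compact
  mapsTo s hs s' hs' v hv := by
    refine ⟨?_, ?_⟩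
    · simp only [liftFlow, Fin.cons_zero]
      exact pwLinear_mem (h.top_mem hs hv.2) (h.bot_mem hs hv.2) hv.1 (convex_Icc _ _)
        fun a ha ↦ h.zeroTransport_mem_Icc hs hv.2 ha hs'
    · simp only [liftFlow, Fin.tail_cons]
      exact h.flow.mapsTo s hs s' hs' _ hv.2
  cont := by
    have h1 := h.continuousOn_pwLinear_zeroTransport.comp
      (f := fun q : ℝ × ℝ × (Fin (k + 1) → ℝ) ↦ ((q.1, q.2.1, Fin.tail q.2.2), q.2.2 0))
      (s := Ioc 0 s₀ ×ˢ Icc 0 s₀ ×ˢ cylinder R L)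
      (by
        have : Continuous fun q : ℝ × ℝ × (Fin (k + 1) → ℝ) ↦ Fin.tail q.2.2 :=
          (continuous_snd.comp continuous_snd).finTail
        fun_prop)
      fun q hq ↦ ⟨⟨hq.1, hq.2.1, hq.2.2.2⟩, hq.2.2.1⟩
    have h2 := h.flow.cont.comp
      (f := fun q : ℝ × ℝ × (Fin (k + 1) → ℝ) ↦ (q.1, q.2.1, Fin.tail q.2.2))
      (s := Ioc 0 s₀ ×ˢ Icc 0 s₀ ×ˢ cylinder R L)
      (by
        have : Continuous fun q : ℝ × ℝ × (Fin (k + 1) → ℝ) ↦ Fin.tail q.2.2 :=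
          (continuous_snd.comp continuous_snd).finTail
        fun_prop)
      fun q hq ↦ ⟨hq.1, hq.2.1, hq.2.2.2⟩
    exact (continuous_finCons_prod k).comp_continuousOn (h1.prodMk h2)
  refl s hs v hv := by
    rw [liftFlow, pwLinear_id (h.top_mem hs hv.2) (h.bot_mem hs hv.2) hv.1
      (fun a ha ↦ h.zeroTransport_self hs hv.2 ha), h.flow.refl s hs _ hv.2, Fin.cons_self_tail]
  trans s hs s' hs' s'' hs'' v hv := by
    obtain ⟨hm, hb⟩ := h.zeroTransport_spec hs hv.2 hs'
    have hcomp := pwLinear_congr (h.top_mem hs hv.2) (h.bot_mem hs hv.2) hv.1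
      (c := zeroTransport g Ψ s' s'' (Ψ s s' (Fin.tail v)) ∘ zeroTransport g Ψ s s' (Fin.tail v))
      (c' := zeroTransport g Ψ s s'' (Fin.tail v))
      fun a ha ↦ h.zeroTransport_zeroTransport hs hs' hs'' hv.2 ha
    simp only [liftFlow, Fin.tail_cons, Fin.cons_zero]
    rw [h.flow.trans s hs s' hs' s'' hs'' _ hv.2,
      pwLinear_pwLinear (h.top_mem hs hv.2) (h.bot_mem hs hv.2) hv.1 hm hb, hcomp]

lemma eval_liftFlow_eq_zero (h : LiftSetup s₀ R L Ψ g) {s s' : ℝ} (hs : s ∈ Ioc 0 s₀)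
    (hs' : s' ∈ Ioc 0 s₀) {v : Fin (k + 1) → ℝ} (hv : v ∈ cylinder R L) {i : ι}
    (h0 : (g i s (Fin.tail v)).eval (v 0) = 0) :
    (g i s' (Fin.tail (liftFlow g R Ψ s s' v))).eval (liftFlow g R Ψ s s' v 0) = 0 := by
  have hmem : v 0 ∈ boundedZeros g R s (Fin.tail v) :=
    (h.mem_boundedZeros (Ioc_subset_Icc_self hs) hv.2).2 ⟨⟨i, h0⟩, hv.1⟩
  simp only [liftFlow, Fin.tail_cons, Fin.cons_zero]
  rw [pwLinear_apply hmem, h.eval_zeroTransport hs hv.2 hs' (Finset.mem_filter.1 hmem).1]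
  exact h0

end LiftSetup

/-- A function that is continuous along a flow and whose vanishing is preserved by the flow has
constant sign along the flow. -/
lemma FlowOn.sign_eq {E : Type*} [TopologicalSpace E] {s₀ : ℝ} {L : Set E} {Ψ : ℝ → ℝ → E → E}
    (h : FlowOn s₀ L Ψ) {f : ℝ × E → ℝ} (hf : Continuous f)
    (h0 : ∀ s ∈ Ioc 0 s₀, ∀ s' ∈ Ioc 0 s₀, ∀ x ∈ L, f (s, x) = 0 → f (s', Ψ s s' x) = 0)
    {s s' : ℝ} (hs : s ∈ Ioc 0 s₀) (hs' : s' ∈ Ioc 0 s₀) {x : E} (hx : x ∈ L) :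
    SignType.sign (f (s', Ψ s s' x)) = SignType.sign (f (s, x)) := by
  by_cases hfx : f (s, x) = 0
  · rw [hfx, h0 s hs s' hs' x hx hfx]
  have hIoc : Ioc 0 s₀ ⊆ Icc 0 s₀ := Ioc_subset_Icc_self
  have hne : ∀ τ ∈ Ioc 0 s₀, f (τ, Ψ s τ x) ≠ 0 := by
    intro τ hτ hcon
    have := h0 τ hτ s hs _ (h.mapsTo s hs τ (hIoc hτ) x hx) hcon
    rw [h.trans s hs τ hτ s (hIoc hs) x hx, h.refl s hs x hx] at this
    exact hfx this
  have hc : ContinuousOn (fun τ ↦ f (τ, Ψ s τ x)) (Ioc 0 s₀) := by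
    have h1 : ContinuousOn (fun τ ↦ Ψ s τ x) (Ioc 0 s₀) :=
      h.cont.comp (f := fun τ ↦ (s, τ, x)) (by fun_prop) fun τ hτ ↦ ⟨hs, hIoc hτ, hx⟩
    exact hf.comp_continuousOn (continuousOn_id.prodMk h1)
  have key := isPreconnected_Ioc.constant (f := fun τ ↦ SignType.sign (f (τ, Ψ s τ x))) ?_ hs' hs
  · simp only [h.refl s hs x hx] at key
    exact key
  · intro τ hτ
    exact (continuousAt_sign_of_ne_zero (hne τ hτ)).tendsto.comp (hc τ hτ)

lemma FlowOn.conj {E : Type*} [TopologicalSpace E] {s₀ : ℝ} {L : Set E} {Ψ : ℝ → ℝ → E → E}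
    (h : FlowOn s₀ L Ψ) (θ : E ≃ₜ E) :
    FlowOn s₀ (θ '' L) fun s s' x ↦ θ (Ψ s s' (θ.symm x)) where
  pos := h.pos
  compact := h.compact.image θ.continuous
  mapsTo s hs s' hs' := by
    rintro _ ⟨x, hx, rfl⟩
    exact mem_image_of_mem _ (by simpa using h.mapsTo s hs s' hs' x hx)
  cont := by
    refine θ.continuous.comp_continuousOn (h.cont.comp
      (f := fun q : ℝ × ℝ × E ↦ (q.1, q.2.1, θ.symm q.2.2)) (by fun_prop) ?_)
    rintro ⟨s, s', x⟩ ⟨hs, hs', x, hx, rfl⟩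
    exact ⟨hs, hs', by simpa using hx⟩
  refl s hs := by
    rintro _ ⟨x, hx, rfl⟩
    simp [h.refl s hs x hx]
  trans s hs s' hs' s'' hs'' := by
    rintro _ ⟨x, hx, rfl⟩
    simp [h.trans s hs s' hs' s'' hs'' x hx]

lemma parEval_map {k : ℕ} {τ : MvPolynomial (Fin k) ℝ →ₐ[ℝ] MvPolynomial (Fin k) ℝ}
    {θ : (Fin k → ℝ) → Fin k → ℝ} (h : ∀ x p, eval x (τ p) = eval (θ x) p)
    (P : Polynomial (MvPolynomial (Fin k) ℝ)) (s : ℝ) (x : Fin k → ℝ) :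
    parEval s x (P.map (τ : MvPolynomial (Fin k) ℝ →+* MvPolynomial (Fin k) ℝ)) =
      parEval s (θ x) P := by
  rw [parEval_apply, parEval_apply, Polynomial.eval₂_map]
  congr 1
  exact RingHom.ext (h x)

/-- A step of the construction of flows along which finitely many polynomials keep their signs. -/
lemma exists_flow_succ {k : ℕ}
    (ih : ∀ (𝓐 : Finset (Polynomial (MvPolynomial (Fin k) ℝ))) (K : Set (Fin k → ℝ)),
      Bornology.IsBounded K → ∃ s₀ L Ψ, K ⊆ L ∧ FlowOn s₀ L Ψ ∧
        ∀ P ∈ 𝓐, ∀ s ∈ Ioc 0 s₀, ∀ s' ∈ Ioc 0 s₀, ∀ x ∈ L,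
          SignType.sign (parEval s' (Ψ s s' x) P) = SignType.sign (parEval s x P))
    (𝓐 : Finset (Polynomial (MvPolynomial (Fin (k + 1)) ℝ))) (K : Set (Fin (k + 1) → ℝ))
    (hK : Bornology.IsBounded K) :
    ∃ s₀ L Ψ, K ⊆ L ∧ FlowOn s₀ L Ψ ∧
      ∀ P ∈ 𝓐, ∀ s ∈ Ioc 0 s₀, ∀ s' ∈ Ioc 0 s₀, ∀ x ∈ L,
        SignType.sign (parEval s' (Ψ s s' x) P) = SignType.sign (parEval s x P) := by
  classical
  obtain ⟨τ, θ, hτθ, hlead⟩ := exists_homeomorph_leadingCoeff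
    ((𝓐.erase 0).biUnion fun P ↦ P.support.image P.coeff)
  have hτ : Function.Injective (τ : MvPolynomial (Fin (k + 1)) ℝ →+* MvPolynomial (Fin (k + 1)) ℝ) := by
    refine (injective_iff_map_eq_zero _).2 fun p hp ↦ MvPolynomial.funext fun x ↦ ?_
    obtain ⟨y, rfl⟩ := θ.surjective x
    rw [← hτθ, show τ p = 0 from hp]; simp
  have hK' : Bornology.IsBounded (θ.symm '' K) :=
    (hK.isCompact_closure.image θ.symm.continuous).isBounded.subset
      (image_mono subset_closure)
  obtain ⟨R, hR, hKR⟩ := hK'.exists_pos_norm_le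
  let Ptop : Polynomial (MvPolynomial (Fin (k + 1)) ℝ) := Polynomial.C (X 0 - C R)
  let Pbot : Polynomial (MvPolynomial (Fin (k + 1)) ℝ) := Polynomial.C (X 0 - C (-R))
  have hX : ∀ r : ℝ, (finSuccEquiv ℝ k (X 0 - C r)).leadingCoeff = C 1 := by
    intro r
    have : finSuccEquiv ℝ k (X 0 - C r) = Polynomial.X - Polynomial.C (C r) := by
      simp [finSuccEquiv_apply]
    rw [this, Polynomial.leadingCoeff_X_sub_C, C_1]
  have hX0 : ∀ r : ℝ, (X 0 - C r : MvPolynomial (Fin (k + 1)) ℝ) ≠ 0 := by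
    intro r h
    have := hX r
    simp [h] at this
  have hXreg : ∀ r : ℝ, ∀ n, (Polynomial.C (X 0 - C r : MvPolynomial (Fin (k + 1)) ℝ)).coeff n ≠ 0 →
      ∃ c : ℝ, c ≠ 0 ∧ (finSuccEquiv ℝ k ((Polynomial.C (X 0 - C r)).coeff n)).leadingCoeff = C c := by
    intro r n hn
    rw [Polynomial.coeff_C] at hn ⊢
    split_ifs at hn ⊢
    · exact ⟨1, one_ne_zero, hX r⟩
    · exact absurd rfl hn
  obtain ⟨ι, _, g, s₀, hs₀, hfam, hg, 𝓑, h𝓑⟩ := exists_fibreFamily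
    (insert Ptop (insert Pbot ((𝓐.erase 0).image (Polynomial.map
      (τ : MvPolynomial (Fin (k + 1)) ℝ →+* MvPolynomial (Fin (k + 1)) ℝ)))))
    (by
      intro P hP
      rcases Finset.mem_insert.1 hP with rfl | hP
      · exact hXreg R
      rcases Finset.mem_insert.1 hP with rfl | hP
      · exact hXreg (-R)
      obtain ⟨Q, hQ, rfl⟩ := Finset.mem_image.1 hP
      intro n hn
      rw [Polynomial.coeff_map] at hn ⊢
      have hn' : Q.coeff n ≠ 0 := fun h ↦ hn (by rw [h, map_zero])
      exact hlead _ (Finset.mem_biUnion.2 ⟨Q, hQ, Finset.mem_image_of_mem _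
        (Polynomial.mem_support_iff.2 hn')⟩) hn')
    (by
      intro P hP
      rcases Finset.mem_insert.1 hP with rfl | hP
      · exact Polynomial.C_ne_zero.2 (hX0 R)
      rcases Finset.mem_insert.1 hP with rfl | hP
      · exact Polynomial.C_ne_zero.2 (hX0 (-R))
      obtain ⟨Q, hQ, rfl⟩ := Finset.mem_image.1 hP
      exact (Polynomial.map_ne_zero_iff hτ).2 (Finset.ne_of_mem_erase hQ))
  have hT : Bornology.IsBounded (Fin.tail '' (θ.symm '' K) : Set (Fin k → ℝ)) := by
    refine ((hK'.isCompact_closure).image (f := fun v : Fin (k + 1) → ℝ ↦ (Fin.tail v : Fin k → ℝ))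
      ?_).isBounded.subset (image_mono subset_closure)
    exact continuous_pi fun i ↦ continuous_apply _
  obtain ⟨s₁, L, Ψ, hKL, hΨ, hsign⟩ := ih 𝓑 _ hT
  have hm0 : 0 < min s₀ s₁ := lt_min hs₀ hΨ.pos
  have hroot : ∀ r : ℝ, Polynomial.C (X 0 - C r) ∈ insert Ptop (insert Pbot ((𝓐.erase 0).image
      (Polynomial.map (τ : MvPolynomial (Fin (k + 1)) ℝ →+* MvPolynomial (Fin (k + 1)) ℝ)))) →
      ∃ i, ∀ s ∈ Ioc 0 (min s₀ s₁), ∀ x ∈ L, ∀ T, (g i s x).eval T = 0 ↔ T = r := by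
    intro r hr
    obtain ⟨i, n, hi⟩ := hg _ hr
    refine ⟨i, fun s hs x _ T ↦ ?_⟩
    have h1 := hi s x T
    have h2 : parEval s (Fin.cons T x) (Polynomial.C (X 0 - C r)) = T - r := by
      simp [parEval_apply]
    rw [h2] at h1
    rw [← sub_eq_zero (a := T), h1, mul_eq_zero, or_iff_right (pow_ne_zero _ hs.1.ne')]
  have hsetup : LiftSetup (min s₀ s₁) R L Ψ g :=
    { flow := hΨ.restrict hm0 (min_le_right _ _)
      fam := hfam.mono (min_le_left _ _) (subset_univ _)
      card := by
        intro s hs s' hs' x hx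
        refine h𝓑 s ⟨hs.1, hs.2.trans (min_le_left _ _)⟩ s' ⟨hs'.1, hs'.2.trans (min_le_left _ _)⟩
          _ _ fun b hb ↦ ?_
        have := hsign b hb s ⟨hs.1, hs.2.trans (min_le_right _ _)⟩ s'
          ⟨hs'.1, hs'.2.trans (min_le_right _ _)⟩ x hx
        rw [← sign_eq_zero_iff, ← this, sign_eq_zero_iff]
      pos := hR
      top := hroot R (Finset.mem_insert_self _ _)
      bot := hroot (-R) (Finset.mem_insert_of_mem (Finset.mem_insert_self _ _)) }
  have hflow := hsetup.flowOn_liftFlow.conj θ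
  refine ⟨min s₀ s₁, _, _, ?_, hflow, ?_⟩
  · intro x hx
    refine ⟨θ.symm x, ⟨?_, hKL (mem_image_of_mem _ (mem_image_of_mem _ hx))⟩, by simp⟩
    have := (norm_le_pi_norm (θ.symm x) 0).trans (hKR _ (mem_image_of_mem _ hx))
    exact abs_le.1 this
  · intro P hP s hs s' hs' x hx
    by_cases hP0 : P = 0
    · simp [hP0]
    refine hflow.sign_eq (continuous_parEval P) ?_ hs hs' hx
    rintro s hs s' hs' _ ⟨v, hv, rfl⟩ h0
    obtain ⟨i, n, hi⟩ := hg _ (Finset.mem_insert_of_mem (Finset.mem_insert_of_mem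
      (Finset.mem_image_of_mem _ (Finset.mem_erase.2 ⟨hP0, hP⟩))))
    have hi' : ∀ s v, parEval s (θ v) P = s ^ n * (g i s (Fin.tail v)).eval (v 0) := by
      intro s v
      rw [← hi, Fin.cons_self_tail, parEval_map hτθ]
    simp only [Homeomorph.symm_apply_apply] at h0 ⊢
    rw [hi', mul_eq_zero, or_iff_right (pow_ne_zero _ hs.1.ne')] at h0
    rw [hi', hsetup.eval_liftFlow_eq_zero hs hs' hv h0, mul_zero]

/-- Over a bounded set, there is a flow along which finitely many polynomials in a parameter and
`k` variables keep their signs. -/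
theorem exists_flow (k : ℕ) : ∀ (𝓐 : Finset (Polynomial (MvPolynomial (Fin k) ℝ)))
    (K : Set (Fin k → ℝ)), Bornology.IsBounded K → ∃ s₀ L Ψ, K ⊆ L ∧ FlowOn s₀ L Ψ ∧
      ∀ P ∈ 𝓐, ∀ s ∈ Ioc 0 s₀, ∀ s' ∈ Ioc 0 s₀, ∀ x ∈ L,
        SignType.sign (parEval s' (Ψ s s' x) P) = SignType.sign (parEval s x P) := by
  induction k with
  | zero =>
    intro 𝓐 K _
    have hP : ∀ P ∈ 𝓐, ∀ᶠ s₀ in 𝓝[>] (0 : ℝ), ∀ s ∈ Ioc 0 s₀, ∀ s' ∈ Ioc 0 s₀, ∀ x : Fin 0 → ℝ,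
        parEval s x P = 0 → parEval s' x P = 0 := by
      intro P _
      have hu : ∀ s (x : Fin 0 → ℝ), parEval s x P = (P.map (eval default)).eval s := by
        intro s x
        rw [Subsingleton.elim x default, parEval_apply, Polynomial.eval_map]
      by_cases h : P.map (eval (default : Fin 0 → ℝ)) = 0
      · exact Eventually.of_forall fun s₀ s _ s' _ x _ ↦ by rw [hu, h, Polynomial.eval_zero]
      · obtain ⟨s₁, hs₁, h1⟩ := Polynomial.exists_pos_forall_eval_ne_zero h
        filter_upwards [Ioc_mem_nhdsGT hs₁] with s₀ hs₀ s hs s' _ x h0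
        exact absurd (by rwa [hu] at h0) (h1 s ⟨hs.1, hs.2.trans hs₀.2⟩)
    obtain ⟨s₀, h, hs₀⟩ := (((Filter.eventually_all_finset 𝓐).2 hP).and
      eventually_mem_nhdsWithin).exists
    have hflow : FlowOn s₀ (univ : Set (Fin 0 → ℝ)) fun _ _ x ↦ x :=
      { pos := hs₀
        compact := isCompact_univ
        mapsTo := fun _ _ _ _ x _ ↦ mem_univ x
        cont := by fun_prop
        refl := fun _ _ _ _ ↦ rfl
        trans := fun _ _ _ _ _ _ _ _ ↦ rfl }
    refine ⟨s₀, univ, _, subset_univ _, hflow, fun P hP s hs s' hs' x hx ↦ ?_⟩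
    exact hflow.sign_eq (continuous_parEval P)
      (fun s hs s' hs' x _ ↦ h P hP s hs s' hs' x) hs hs' hx
  | succ k ih => exact exists_flow_succ ih

lemma ContinuousMap.Homotopic.of_continuousOn {E F : Type*} [TopologicalSpace E]
    [TopologicalSpace F] {P : Set E} {Q : Set F} {f g : C(P, Q)}
    (H : ℝ → E → F) (hc : ContinuousOn (fun q : ℝ × E ↦ H q.1 q.2) (Icc 0 1 ×ˢ P))
    (hm : ∀ l ∈ Icc (0 : ℝ) 1, ∀ x ∈ P, H l x ∈ Q) (h0 : ∀ x : P, H 0 x = f x)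
    (h1 : ∀ x : P, H 1 x = g x) : f.Homotopic g := by
  refine ⟨⟨⟨fun q ↦ ⟨H q.1 q.2, hm q.1 q.1.2 q.2 q.2.2⟩, ?_⟩, fun x ↦ Subtype.ext (h0 x),
    fun x ↦ Subtype.ext (h1 x)⟩⟩
  refine Continuous.subtype_mk ?_ _
  exact hc.comp_continuous (f := fun q : unitInterval × P ↦ ((q.1 : ℝ), (q.2 : E)))
    (by fun_prop) fun q ↦ ⟨q.1.2, q.2.2⟩

lemma IsClosed.exists_continuous_eq_zero_iff {Y : Type*} [PseudoMetricSpace Y] {T : Set Y}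
    (hT : IsClosed T) : ∃ d : Y → ℝ, Continuous d ∧ ∀ y, 0 ≤ d y ∧ (d y = 0 ↔ y ∈ T) := by
  rcases T.eq_empty_or_nonempty with rfl | hne
  · exact ⟨fun _ ↦ 1, continuous_const, by simp⟩
  · exact ⟨fun y ↦ Metric.infDist y T, Metric.continuous_infDist_pt T, fun y ↦
      ⟨Metric.infDist_nonneg, (hT.mem_iff_infDist_zero hne).symm⟩⟩

/-- A family of sets which decreases along a flow to a subset of its limit is homotopy equivalent
to this limit, provided that the part of the family which is not already in the limit is carried by
a closed invariant tube shrinking into the limit. -/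
theorem FlowOn.homotopyEquiv_of_tube {E : Type*} [MetricSpace E] {s₀ : ℝ} {L : Set E}
    {Ψ : ℝ → ℝ → E → E} (h : FlowOn s₀ L Ψ) {D : ℝ → Set E} (hDL : ∀ s ∈ Icc 0 s₀, D s ⊆ L)
    (hmono : ∀ s ∈ Icc 0 s₀, ∀ s' ∈ Icc 0 s₀, s ≤ s' → D s ⊆ D s')
    (hinv : ∀ s ∈ Ioc 0 s₀, ∀ s' ∈ Ioc 0 s₀, ∀ x ∈ D s, Ψ s s' x ∈ D s')
    {T : Set (ℝ × E)} (hT : IsClosed T)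
    (hTinv : ∀ s ∈ Ioc 0 s₀, ∀ s' ∈ Ioc 0 s₀, ∀ x ∈ L, (s, x) ∈ T → (s', Ψ s s' x) ∈ T)
    (hoff : ∀ s ∈ Ioc 0 s₀, ∀ x ∈ D s, (s, x) ∉ T → x ∈ D 0)
    (hT0 : ∀ x, (0, x) ∈ T → x ∈ D 0) :
    Nonempty (ContinuousMap.HomotopyEquiv (D s₀) (D 0)) := by
  obtain ⟨d, hd, hd0⟩ := hT.exists_continuous_eq_zero_iff
  set ρ : ℝ × E → ℝ := fun q ↦ min q.1 (d q) with hρ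
  have hρc : Continuous ρ := continuous_fst.min hd
  have hs₀ : s₀ ∈ Ioc 0 s₀ := ⟨h.pos, le_rfl⟩
  have h0mem : (0 : ℝ) ∈ Icc 0 s₀ := ⟨le_rfl, h.pos.le⟩
  have hIoc : Ioc 0 s₀ ⊆ Icc 0 s₀ := Ioc_subset_Icc_self
  have hD0 : ∀ s ∈ Icc 0 s₀, D 0 ⊆ D s := fun s hs ↦ hmono 0 h0mem s hs hs.1
  have hρmem : ∀ s ∈ Icc 0 s₀, ∀ x, ρ (s, x) ∈ Icc 0 s₀ := fun s hs x ↦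
    ⟨le_min hs.1 (hd0 _).1, (min_le_left _ _).trans hs.2⟩
  have hG : ∀ s ∈ Ioc 0 s₀, ∀ x ∈ D s, Ψ s (ρ (s, x)) x ∈ D 0 := by
    intro s hs x hx
    have hxL := hDL s (hIoc hs) hx
    rcases (hρmem s (hIoc hs) x).1.eq_or_lt with h0 | h0
    · rw [← h0]
      have hxT : (s, x) ∈ T := by
        rw [← (hd0 _).2]
        rcases min_choice s (d (s, x)) with h1 | h1
        · exact absurd (h0.trans h1) hs.1.ne
        · exact (h0.trans h1).symm
      have : (𝓝[Ioc 0 s₀] (0 : ℝ)).NeBot := by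
        rw [← mem_closure_iff_nhdsWithin_neBot, closure_Ioc h.pos.ne]
        exact h0mem
      refine hT0 _ (hT.mem_of_tendsto (f := fun τ ↦ (τ, Ψ s τ x)) (b := 𝓝[Ioc 0 s₀] 0) ?_ ?_)
      · have hc : ContinuousOn (fun τ ↦ (τ, Ψ s τ x)) (Icc 0 s₀) :=
          continuousOn_id.prodMk (h.cont.comp (f := fun τ ↦ (s, τ, x)) (by fun_prop)
            fun τ hτ ↦ ⟨hs, hτ, hxL⟩)
        exact (hc 0 h0mem).mono hIoc
      · filter_upwards [eventually_mem_nhdsWithin] with τ hτ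
        exact hTinv s hs τ hτ x hxL hxT
    · have hρ' : ρ (s, x) ∈ Ioc 0 s₀ := ⟨h0, (hρmem s (hIoc hs) x).2⟩
      refine hoff _ hρ' _ (hinv s hs _ hρ' x hx) fun hcon ↦ ?_
      have := hTinv _ hρ' s hs _ (h.mapsTo s hs _ (hIoc hρ') x hxL) hcon
      rw [h.trans s hs _ hρ' s (hIoc hs) x hxL, h.refl s hs x hxL] at this
      exact (h0.trans_le (min_le_right _ _)).ne' ((hd0 _).2.2 this)
  have hGc : ContinuousOn (fun q : ℝ × E ↦ Ψ q.1 (ρ q) q.2) (Ioc 0 s₀ ×ˢ L) :=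
    h.cont.comp (f := fun q : ℝ × E ↦ (q.1, ρ q, q.2)) (by fun_prop)
      fun q hq ↦ ⟨hq.1, hρmem q.1 (hIoc hq.1) q.2, hq.2⟩
  have hG0 : ∀ x ∈ L, Tendsto (fun q : ℝ × E ↦ Ψ q.1 (ρ q) q.2) (𝓝[Ioc 0 s₀ ×ˢ L] (0, x)) (𝓝 x) := by
    intro x hx
    rw [tendsto_iff_dist_tendsto_zero]
    have hdist : Tendsto (fun q : ℝ × E ↦ dist (Ψ q.1 (ρ q) q.2) q.2) (𝓝[Ioc 0 s₀ ×ˢ L] (0, x))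
        (𝓝 0) := by
      have hK : IsCompact (Icc 0 s₀ ×ˢ L) := isCompact_Icc.prod h.compact
      have huc := hK.uniformContinuousOn_of_continuous (f := fun q : ℝ × E ↦ Ψ s₀ q.1 q.2)
        (h.cont.comp (f := fun q : ℝ × E ↦ (s₀, q.1, q.2)) (by fun_prop) fun q hq ↦
          ⟨hs₀, hq.1, hq.2⟩)
      rw [Metric.uniformContinuousOn_iff] at huc
      rw [Metric.tendsto_nhds]
      intro ε hε
      obtain ⟨δ, hδ, huc⟩ := huc ε hε
      have hfst : ∀ᶠ q : ℝ × E in 𝓝[Ioc 0 s₀ ×ˢ L] (0, x), q.1 < δ :=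
        mem_nhdsWithin_of_mem_nhds ((isOpen_Iio.preimage continuous_fst).mem_nhds hδ)
      filter_upwards [eventually_mem_nhdsWithin, hfst] with ⟨s, y⟩ ⟨hs, hy⟩ hsδ
      have hρs := hρmem s (hIoc hs) y
      have hz := h.mapsTo s hs s₀ (hIoc hs₀) y hy
      have := huc (ρ (s, y), Ψ s s₀ y) ⟨hρs, hz⟩ (s, Ψ s s₀ y) ⟨hIoc hs, hz⟩ (by
        rw [Prod.dist_eq, dist_self, max_eq_left dist_nonneg, Real.dist_eq, abs_sub_comm,
          abs_of_nonneg (sub_nonneg.2 (min_le_left _ _))]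
        exact (sub_le_self _ hρs.1).trans_lt hsδ)
      simp only [h.trans s hs s₀ hs₀ _ hρs y hy, h.trans s hs s₀ hs₀ _ (hIoc hs) y hy,
        h.refl s hs y hy] at this
      rwa [Real.dist_eq, sub_zero, abs_of_nonneg dist_nonneg]
    have h2 : Tendsto (fun q : ℝ × E ↦ dist q.2 x) (𝓝[Ioc 0 s₀ ×ˢ L] (0, x)) (𝓝 0) := by
      have : Continuous fun q : ℝ × E ↦ dist q.2 x := by fun_prop
      simpa using (this.tendsto (0, x)).mono_left nhdsWithin_le_nhds
    refine squeeze_zero (fun _ ↦ dist_nonneg) (fun q ↦ dist_triangle _ q.2 _) ?_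
    simpa using hdist.add h2
  have hDs := hDL s₀ (hIoc hs₀)
  let r : C(D s₀, D 0) := ⟨fun x ↦ ⟨Ψ s₀ (ρ (s₀, x)) x, hG s₀ hs₀ x x.2⟩, by
    refine Continuous.subtype_mk ?_ _
    exact hGc.comp_continuous (f := fun x : D s₀ ↦ (s₀, (x : E))) (by fun_prop) fun x ↦
      ⟨hs₀, hDs x.2⟩⟩
  let i : C(D 0, D s₀) := ⟨fun x ↦ ⟨x, hD0 s₀ (hIoc hs₀) x.2⟩, by fun_prop⟩
  refine ⟨⟨r, i, ContinuousMap.Homotopic.symm ?_, ContinuousMap.Homotopic.symm ?_⟩⟩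
  · have hmem : ∀ l ∈ Icc (0 : ℝ) 1, ∀ x, (1 - l) * s₀ + l * ρ (s₀, x) ∈ Icc 0 s₀ := by
      intro l hl x
      exact (convex_Icc 0 s₀) (hIoc hs₀) (hρmem s₀ (hIoc hs₀) x) (by linarith [hl.2]) hl.1 (by ring)
    refine .of_continuousOn (fun l x ↦ Ψ s₀ ((1 - l) * s₀ + l * ρ (s₀, x)) x) ?_ ?_ ?_ ?_
    · exact h.cont.comp (f := fun q : ℝ × E ↦ (s₀, (1 - q.1) * s₀ + q.1 * ρ (s₀, q.2), q.2))
        (by fun_prop) fun q hq ↦ ⟨hs₀, hmem q.1 hq.1 q.2, hDs hq.2⟩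
    · intro l hl x hx
      have hm := hmem l hl x
      rcases hm.1.eq_or_lt with h0 | h0
      · have h1 : l = 1 := by
          by_contra hne
          have : 0 < (1 - l) * s₀ := mul_pos (sub_pos.2 (lt_of_le_of_ne hl.2 hne)) h.pos
          have := mul_nonneg hl.1 (hρmem s₀ (hIoc hs₀) x).1
          linarith
        subst h1
        have := hG s₀ hs₀ x hx
        simpa using hD0 s₀ (hIoc hs₀) this
      · exact hmono _ hm s₀ (hIoc hs₀) hm.2 (hinv s₀ hs₀ _ ⟨h0, hm.2⟩ x hx)
    · intro x
      simp [h.refl s₀ hs₀ x (hDs x.2)]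
    · intro x
      simp [r, i]
  · have h0L := hDL 0 h0mem
    refine .of_continuousOn
      (fun l x ↦ if l = 0 then x else Ψ (l * s₀) (ρ (l * s₀, x)) x) ?_ ?_ ?_ ?_
    · rintro ⟨l, x⟩ ⟨hl, hx⟩
      rcases hl.1.eq_or_lt with rfl | hl0
      · have h1 : Tendsto (fun q : ℝ × E ↦
            if q.1 = 0 then q.2 else Ψ (q.1 * s₀) (ρ (q.1 * s₀, q.2)) q.2)
            (𝓝[Icc 0 1 ×ˢ D 0] (0, x)) (𝓝 x) := by
          refine Tendsto.if (p := fun q : ℝ × E ↦ q.1 = 0) ?_ ?_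
          · exact (continuous_snd.tendsto (0, x)).mono_left (inf_le_left.trans nhdsWithin_le_nhds)
          · refine (hG0 x (h0L hx)).comp (f := fun q : ℝ × E ↦ (q.1 * s₀, q.2)) ?_
            refine tendsto_nhdsWithin_iff.2 ⟨?_, ?_⟩
            · have : Continuous fun q : ℝ × E ↦ (q.1 * s₀, q.2) := by fun_prop
              simpa using (this.tendsto (0, x)).mono_left (inf_le_left.trans nhdsWithin_le_nhds)
            · rw [eventually_inf_principal]
              filter_upwards [eventually_mem_nhdsWithin] with ⟨l, y⟩ ⟨hl, hy⟩ hl0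
              have hl0 : 0 < l := lt_of_le_of_ne hl.1 (Ne.symm hl0)
              exact ⟨⟨mul_pos hl0 h.pos, mul_le_of_le_one_left h.pos.le hl.2⟩, h0L hy⟩
        simpa [ContinuousWithinAt] using h1
      · have hmem : (l * s₀, x) ∈ Ioc 0 s₀ ×ˢ L :=
          ⟨⟨mul_pos hl0 h.pos, mul_le_of_le_one_left h.pos.le hl.2⟩, h0L hx⟩
        have h1 : ContinuousOn (fun q : ℝ × E ↦ Ψ (q.1 * s₀) (ρ (q.1 * s₀, q.2)) q.2)
            (Ioc 0 1 ×ˢ D 0) :=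
          hGc.comp (f := fun q : ℝ × E ↦ (q.1 * s₀, q.2)) (by fun_prop) fun q hq ↦
            ⟨⟨mul_pos hq.1.1 h.pos, mul_le_of_le_one_left h.pos.le hq.1.2⟩, h0L hq.2⟩
        have h2 : Ioc 0 1 ×ˢ D 0 ∈ 𝓝[Icc 0 1 ×ˢ D 0] (l, x) := by
          rw [mem_nhdsWithin]
          refine ⟨Prod.fst ⁻¹' Ioi 0, isOpen_Ioi.preimage continuous_fst, hl0, ?_⟩
          rintro ⟨a, y⟩ ⟨ha, hay⟩
          exact ⟨⟨ha, hay.1.2⟩, hay.2⟩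
        refine ((h1 (l, x) ⟨⟨hl0, hl.2⟩, hx⟩).mono_of_mem_nhdsWithin h2).congr_of_eventuallyEq ?_ ?_
        · filter_upwards [h2] with q hq
          rw [if_neg hq.1.1.ne']
        · rw [if_neg hl0.ne']
    · intro l hl x hx
      split_ifs with hl0
      · exact hx
      · have hl0 : 0 < l := lt_of_le_of_ne hl.1 (Ne.symm hl0)
        have hls : l * s₀ ∈ Ioc 0 s₀ := ⟨mul_pos hl0 h.pos, mul_le_of_le_one_left h.pos.le hl.2⟩
        exact hG _ hls x (hD0 _ (hIoc hls) hx)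
    · intro x
      simp
    · intro x
      simp [r, i]

lemma FlowOn.continuous_comp {E Y : Type*} [TopologicalSpace E] [TopologicalSpace Y] {s₀ : ℝ}
    {L : Set E} {Ψ : ℝ → ℝ → E → E} (h : FlowOn s₀ L Ψ) {τ τ' : Y → ℝ} {m : Y → E}
    (hτ : Continuous τ) (hτ' : Continuous τ') (hm : Continuous m) (h1 : ∀ y, τ y ∈ Ioc 0 s₀)
    (h2 : ∀ y, τ' y ∈ Icc 0 s₀) (h3 : ∀ y, m y ∈ L) :
    Continuous fun y ↦ Ψ (τ y) (τ' y) (m y) :=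
  h.cont.comp_continuous (hτ.prodMk (hτ'.prodMk hm)) fun y ↦ ⟨h1 y, h2 y, h3 y⟩

/-- Continuous selection of a parameter for which a map takes values in the members of a decreasing
family of sets. -/
lemma exists_continuous_parameter {E Y : Type*} [MetricSpace Y] {s₀ : ℝ}
    {U : ℝ → Set E} (hanti : ∀ s ∈ Ioc 0 s₀, ∀ s' ∈ Ioc 0 s₀, s ≤ s' → U s' ⊆ U s) {m : Y → E}
    (H : ∀ y, ∃ s ∈ Ioc 0 s₀, ∀ᶠ y' in 𝓝 y, m y' ∈ U s) :
    ∃ τ : C(Y, ℝ), ∀ y, τ y ∈ Ioc 0 s₀ ∧ m y ∈ U (τ y) := by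
  refine exists_continuous_forall_mem_convex_of_local_const
    (t := fun y ↦ {s | s ∈ Ioc 0 s₀ ∧ m y ∈ U s}) (fun y ↦ ?_) fun y ↦ ?_
  · refine Set.OrdConnected.convex ⟨fun a ha c hc z hz ↦ ?_⟩
    have hz' : z ∈ Ioc 0 s₀ := ⟨ha.1.1.trans_le hz.1, hz.2.trans hc.1.2⟩
    exact ⟨hz', hanti z hz' c hc.1 hz.2 hc.2⟩
  · obtain ⟨s, hs, h⟩ := H y
    exact ⟨s, h.mono fun y' hy' ↦ ⟨hs, hy'⟩⟩

/-- A family of sets which increases along a flow, as the parameter tends to zero, is homotopy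
equivalent to its limit `U 0`, provided that the limit can be deformed so as to avoid the points
which do not belong locally to a member of the family. -/
theorem FlowOn.homotopyEquiv_of_deformation {E : Type*} [MetricSpace E] {s₀ : ℝ} {L : Set E}
    {Ψ : ℝ → ℝ → E → E} (h : FlowOn s₀ L Ψ) {U : ℝ → Set E} (hUL : U 0 ⊆ L)
    (hanti : ∀ s ∈ Icc 0 s₀, ∀ s' ∈ Icc 0 s₀, s ≤ s' → U s' ⊆ U s)
    (hinv : ∀ s ∈ Ioc 0 s₀, ∀ s' ∈ Ioc 0 s₀, ∀ x ∈ U s, Ψ s s' x ∈ U s')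
    {B Z : Set E} (hB : B ⊆ U s₀) {φ : ℝ → E → E}
    (hφ : ContinuousOn (fun q : ℝ × E ↦ φ q.1 q.2) (Icc 0 1 ×ˢ U 0))
    (hφU : ∀ l ∈ Icc (0 : ℝ) 1, ∀ x ∈ U 0, φ l x ∈ U 0) (hφ0 : ∀ x ∈ U 0, φ 0 x = x)
    (hφB : ∀ l ∈ Icc (0 : ℝ) 1, ∀ x ∈ B, φ l x ∈ B)
    (hφZ : ∀ l ∈ Icc (0 : ℝ) 1, ∀ x ∈ U 0, x ∉ Z → φ l x ∉ Z)
    (hW : ∀ x ∈ B, ∀ᶠ x' in 𝓝[U 0] x, φ 1 x' ∈ B)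
    (hN : ∀ y ∈ U 0, y ∉ Z → ∃ s ∈ Ioc 0 s₀, ∀ᶠ x in 𝓝[U 0] y, x ∈ U s)
    (hZB : ∀ x ∈ U 0, x ∈ Z → x ∈ B)
    (hZ : ∀ x ∈ U s₀, x ∈ Z → ∀ᶠ x' in 𝓝[U s₀] x, x' ∈ B) :
    Nonempty (ContinuousMap.HomotopyEquiv (U s₀) (U 0)) := by
  have hs₀ : s₀ ∈ Ioc 0 s₀ := ⟨h.pos, le_rfl⟩
  have h0mem : (0 : ℝ) ∈ Icc 0 s₀ := ⟨le_rfl, h.pos.le⟩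
  have hIoc : Ioc 0 s₀ ⊆ Icc 0 s₀ := Ioc_subset_Icc_self
  have hU0 : ∀ s ∈ Icc 0 s₀, U s ⊆ U 0 := fun s hs ↦ hanti 0 h0mem s hs hs.1
  have hanti' : ∀ s ∈ Ioc 0 s₀, ∀ s' ∈ Ioc 0 s₀, s ≤ s' → U s' ⊆ U s := fun s hs s' hs' ↦
    hanti s (hIoc hs) s' (hIoc hs')
  have hcv : ∀ l ∈ Icc (0 : ℝ) 1, ∀ a ∈ Ioc 0 s₀, ∀ c ∈ Ioc 0 s₀, (1 - l) * a + l * c ∈ Ioc 0 s₀ :=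
    fun l hl a ha c hc ↦ (convex_Ioc 0 s₀) ha hc (by linarith [hl.2]) hl.1 (by ring)
  have hone : (1 : ℝ) ∈ Icc (0 : ℝ) 1 := ⟨zero_le_one, le_rfl⟩
  have hφ1 : Continuous fun x : U 0 ↦ φ 1 x :=
    hφ.comp_continuous (f := fun x : U 0 ↦ ((1 : ℝ), (x : E))) (by fun_prop) fun x ↦ ⟨hone, x.2⟩
  have hloc : ∀ {Y : Type _} [TopologicalSpace Y] (m : Y → E), Continuous m → (∀ y, m y ∈ U 0) →
      ∀ y, m y ∉ Z → ∃ s ∈ Ioc 0 s₀, ∀ᶠ y' in 𝓝 y, m y' ∈ U s := by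
    intro Y _ m hm hmU y hy
    obtain ⟨s, hs, hev⟩ := hN _ (hmU y) hy
    exact ⟨s, hs, (tendsto_nhdsWithin_iff.2 ⟨hm.tendsto y, Eventually.of_forall hmU⟩).eventually hev⟩
  obtain ⟨σ, hσ⟩ := exists_continuous_parameter hanti' (m := fun x : U 0 ↦ φ 1 x) (by
    intro x
    by_cases hx : (x : E) ∈ Z
    · refine ⟨s₀, hs₀, ?_⟩
      have := hW x (hZB x x.2 hx)
      rw [nhdsWithin_eq_map_subtype_coe x.2, eventually_map] at this
      exact this.mono fun x' hx' ↦ hB hx'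
    · exact hloc _ hφ1 (fun x ↦ hφU 1 hone x x.2) x (hφZ 1 hone x x.2 hx))
  have hφI : Continuous fun q : unitInterval × U s₀ ↦ φ q.1 q.2 :=
    hφ.comp_continuous (f := fun q : unitInterval × U s₀ ↦ ((q.1 : ℝ), (q.2 : E))) (by fun_prop)
      fun q ↦ ⟨q.1.2, hU0 s₀ (hIoc hs₀) q.2.2⟩
  obtain ⟨σ', hσ'⟩ := exists_continuous_parameter hanti'
    (m := fun q : unitInterval × U s₀ ↦ φ q.1 q.2) (by
    rintro ⟨l, x⟩
    by_cases hx : (x : E) ∈ Z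
    · refine ⟨s₀, hs₀, ?_⟩
      have := hZ x x.2 hx
      rw [nhdsWithin_eq_map_subtype_coe x.2, eventually_map] at this
      filter_upwards [(continuous_snd.tendsto (l, x)).eventually this] with q hq
      exact hB (hφB q.1 q.1.2 _ hq)
    · exact hloc _ hφI (fun q ↦ hφU q.1 q.1.2 _ (hU0 s₀ (hIoc hs₀) q.2.2)) (l, x)
        (hφZ l l.2 x (hU0 s₀ (hIoc hs₀) x.2) hx))
  have hφL : ∀ l ∈ Icc (0 : ℝ) 1, ∀ x ∈ U 0, φ l x ∈ L := fun l hl x hx ↦ hUL (hφU l hl x hx)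
  let i : C(U s₀, U 0) := ⟨fun x ↦ ⟨x, hU0 s₀ (hIoc hs₀) x.2⟩, by fun_prop⟩
  let r : C(U 0, U s₀) := ⟨fun x ↦ ⟨Ψ (σ x) s₀ (φ 1 x), hinv _ (hσ x).1 s₀ hs₀ _ (hσ x).2⟩, by
    refine Continuous.subtype_mk ?_ _
    exact h.continuous_comp σ.continuous continuous_const hφ1 (fun x ↦ (hσ x).1)
      (fun _ ↦ hIoc hs₀) fun x ↦ hφL 1 hone x x.2⟩
  let φ₁ : C(U 0, U 0) := ⟨fun x ↦ ⟨φ 1 x, hφU 1 hone x x.2⟩, Continuous.subtype_mk hφ1 _⟩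
  let K : C(unitInterval × U s₀, U s₀) :=
    ⟨fun q ↦ ⟨Ψ (σ' q) s₀ (φ q.1 q.2), hinv _ (hσ' q).1 s₀ hs₀ _ (hσ' q).2⟩, by
      refine Continuous.subtype_mk ?_ _
      exact h.continuous_comp σ'.continuous continuous_const hφI (fun q ↦ (hσ' q).1)
        (fun _ ↦ hIoc hs₀) fun q ↦ hφL q.1 q.1.2 _ (hU0 s₀ (hIoc hs₀) q.2.2)⟩
  have hcvI : ∀ l : unitInterval, ∀ a ∈ Ioc 0 s₀, ∀ c ∈ Ioc 0 s₀,
      (1 - (l : ℝ)) * a + l * c ∈ Ioc 0 s₀ := fun l ↦ hcv l l.2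
  have hcvU : ∀ l : unitInterval, ∀ a ∈ Ioc 0 s₀, ∀ c ∈ Ioc 0 s₀, ∀ x ∈ U a, x ∈ U c →
      x ∈ U ((1 - (l : ℝ)) * a + l * c) := by
    intro l a ha c hc x hxa hxc
    have hm := hcvI l a ha c hc
    rcases le_total a c with hac | hac
    · refine hanti' _ hm c hc ?_ hxc
      nlinarith [l.2.1, l.2.2]
    · refine hanti' _ hm a ha ?_ hxa
      nlinarith [l.2.1, l.2.2]
  refine ⟨⟨i, r, ?_, ?_⟩⟩
  · have hK : (K.comp ⟨fun x ↦ (0, x), by fun_prop⟩).Homotopic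
        (K.comp ⟨fun x ↦ (1, x), by fun_prop⟩) :=
      ⟨⟨K, fun x ↦ rfl, fun x ↦ rfl⟩⟩
    have hK0 : (K.comp ⟨fun x ↦ (0, x), by fun_prop⟩).Homotopic (ContinuousMap.id (U s₀)) := by
      have hx0 : ∀ x : U s₀, φ 0 x = x := fun x ↦ hφ0 x (hU0 s₀ (hIoc hs₀) x.2)
      refine ⟨⟨⟨fun q ↦ ⟨Ψ ((1 - q.1) * σ' (0, q.2) + q.1 * s₀) s₀ q.2, hinv _
        (hcvI q.1 _ (hσ' _).1 _ hs₀) s₀ hs₀ _ (hcvU q.1 _ (hσ' _).1 _ hs₀ _ ?_ q.2.2)⟩, ?_⟩,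
        ?_, ?_⟩⟩
      · exact hanti' _ (hσ' _).1 s₀ hs₀ (hσ' _).1.2 q.2.2
      · refine Continuous.subtype_mk ?_ _
        exact h.continuous_comp (by fun_prop) continuous_const (by fun_prop)
          (fun q ↦ hcvI q.1 _ (hσ' _).1 _ hs₀) (fun _ ↦ hIoc hs₀)
          fun q ↦ hUL (hU0 s₀ (hIoc hs₀) q.2.2)
      · intro x
        simp [K, hx0]
      · intro x
        simp [h.refl s₀ hs₀ x (hUL (hU0 s₀ (hIoc hs₀) x.2))]
    have hK1 : (K.comp ⟨fun x ↦ (1, x), by fun_prop⟩).Homotopic (r.comp i) := by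
      refine ⟨⟨⟨fun q ↦ ⟨Ψ ((1 - q.1) * σ' (1, q.2) + q.1 * σ (i q.2)) s₀ (φ 1 q.2), hinv _
        (hcvI q.1 _ (hσ' _).1 _ (hσ _).1) s₀ hs₀ _
        (hcvU q.1 _ (hσ' _).1 _ (hσ _).1 _ (hσ' _).2 (hσ (i q.2)).2)⟩, ?_⟩, ?_, ?_⟩⟩
      · refine Continuous.subtype_mk ?_ _
        refine h.continuous_comp (by fun_prop) continuous_const
          (hφ1.comp (g := fun x : U 0 ↦ φ 1 x) (f := fun q : unitInterval × U s₀ ↦ i q.2)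
            (by fun_prop))
          (fun q ↦ hcvI q.1 _ (hσ' _).1 _ (hσ _).1) (fun _ ↦ hIoc hs₀)
          fun q ↦ hφL 1 hone _ (hU0 s₀ (hIoc hs₀) q.2.2)
      · intro x
        simp [K]
      · intro x
        simp [r, i]
    exact hK1.symm.trans (hK.symm.trans hK0)
  · have h1 : φ₁.Homotopic (i.comp r) := by
      refine ⟨⟨⟨fun q ↦ ⟨Ψ (σ q.2) ((1 - q.1) * σ q.2 + q.1 * s₀) (φ 1 q.2), hU0 _
        (hIoc (hcvI q.1 _ (hσ _).1 _ hs₀)) (hinv _ (hσ _).1 _ (hcvI q.1 _ (hσ _).1 _ hs₀) _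
          (hσ _).2)⟩, ?_⟩, ?_, ?_⟩⟩
      · refine Continuous.subtype_mk ?_ _
        exact h.continuous_comp (by fun_prop) (by fun_prop) (hφ1.comp continuous_snd)
          (fun q ↦ (hσ _).1) (fun q ↦ hIoc (hcvI q.1 _ (hσ _).1 _ hs₀))
          fun q ↦ hφL 1 hone _ q.2.2
      · intro x
        simp [φ₁, h.refl _ (hσ x).1 _ (hφL 1 hone x x.2)]
      · intro x
        simp [r, i]
    have h2 : (ContinuousMap.id (U 0)).Homotopic φ₁ :=
      .of_continuousOn φ hφ hφU (fun x ↦ hφ0 x x.2) fun x ↦ rfl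
    exact (h2.trans h1).symm

section SignLevel

variable {t : ℕ} {σ τ : Fin t → SignType}

lemma signLevel_le (σ : Fin t → SignType) : signLevel σ ≤ t :=
  (Finset.card_le_univ _).trans_eq (Fintype.card_fin t)

lemma signLevel_mono (h : ∀ i, σ i = 0 → τ i = 0) : signLevel σ ≤ signLevel τ :=
  Finset.card_le_card (Finset.monotone_filter_right _ fun i _ ↦ h i)

lemma eq_zero_of_signLevel_le (h : ∀ i, σ i = 0 → τ i = 0) (hle : signLevel τ ≤ signLevel σ)
    {i : Fin t} (hi : τ i = 0) : σ i = 0 := by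
  have := Finset.eq_of_subset_of_card_le (Finset.monotone_filter_right Finset.univ
    fun i _ ↦ h i) hle
  have hi' : i ∈ Finset.univ.filter fun i ↦ τ i = 0 := by simpa using hi
  rw [← this] at hi'
  simpa using hi'

lemma signLevel_pos {i : Fin t} (hi : σ i = 0) : 1 ≤ signLevel σ :=
  Finset.card_pos.2 ⟨i, by simpa using hi⟩

end SignLevel

/-- The sign condition realized at a point. -/
noncomputable def signVector {k t : ℕ} (A : Fin t → MvPolynomial (Fin k) ℝ) (x : Fin k → ℝ) :
    Fin t → SignType :=
  fun i ↦ SignType.sign (eval x (A i))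

/-- A variant of `gvOpenRelaxation` which is meaningful when `ε` vanishes. -/
def gvHalfOpen {k t : ℕ} (A : Fin t → MvPolynomial (Fin k) ℝ) (S : Set (Fin k → ℝ)) (ε : ℕ → ℝ)
    (σ : Fin t → SignType) : Set (Fin k → ℝ) :=
  {x ∈ S | (∀ i, σ i = 0 → |eval x (A i)| < ε (2 * signLevel σ - 1) ∨ eval x (A i) = 0) ∧
           (∀ i, σ i = 1 → 0 < eval x (A i)) ∧
           (∀ i, σ i = -1 → eval x (A i) < 0)}

/-- The part of the Gabrielov-Vorobjov replacement coming from sign conditions of level at least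
`n`. -/
def gvUnion {k t : ℕ} (A : Fin t → MvPolynomial (Fin k) ℝ) (S : Set (Fin k → ℝ))
    (Sgns : Set (Fin t → SignType)) (ε : ℕ → ℝ) (n : ℕ) : Set (Fin k → ℝ) :=
  {x | ∃ σ ∈ Sgns, n ≤ signLevel σ ∧ x ∈ gvClosedRelaxation A S ε σ ∧
    ∀ σ' ∈ signCondOn A S, σ' ∉ Sgns → signLevel σ ≤ signLevel σ' → x ∉ gvHalfOpen A S ε σ'}

section Basic

variable {k t : ℕ} {A : Fin t → MvPolynomial (Fin k) ℝ} {S : Set (Fin k → ℝ)}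
  {Sgns : Set (Fin t → SignType)} {ε ε' : ℕ → ℝ} {σ τ : Fin t → SignType} {x y : Fin k → ℝ} {n n' : ℕ}

lemma mem_signRealization : x ∈ signRealization A σ ↔ signVector A x = σ :=
  funext_iff.symm

lemma signVector_mem_signCondOn
    (hSs : ∀ x ∈ S, ∀ y, signVector A y = signVector A x → y ∈ S) (hx : x ∈ S) :
    signVector A x ∈ signCondOn A S :=
  ⟨⟨x, mem_signRealization.2 rfl⟩, fun y hy ↦ hSs x hx y (mem_signRealization.1 hy)⟩

lemma signVector_eq_zero {i : Fin t} : signVector A x i = 0 ↔ eval x (A i) = 0 :=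
  sign_eq_zero_iff

lemma gvClosedRelaxation_mono (h : 1 ≤ signLevel σ → ε (2 * signLevel σ) ≤ ε' (2 * signLevel σ)) :
    gvClosedRelaxation A S ε σ ⊆ gvClosedRelaxation A S ε' σ :=
  fun _ hx ↦ ⟨hx.1, fun i hi ↦ (hx.2.1 i hi).trans (h (signLevel_pos hi)), hx.2.2⟩

lemma gvHalfOpen_mono
    (h : 1 ≤ signLevel σ → ε (2 * signLevel σ - 1) ≤ ε' (2 * signLevel σ - 1)) :
    gvHalfOpen A S ε σ ⊆ gvHalfOpen A S ε' σ :=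
  fun _ hx ↦ ⟨hx.1, fun i hi ↦ (hx.2.1 i hi).imp_left
    fun h' ↦ h'.trans_le (h (signLevel_pos hi)), hx.2.2⟩

lemma gvUnion_mono (hn : n' ≤ n)
    (h1 : ∀ j, 1 ≤ j → n ≤ j → j ≤ t → ε (2 * j) ≤ ε' (2 * j))
    (h2 : ∀ j, 1 ≤ j → n ≤ j → j ≤ t → ε' (2 * j - 1) ≤ ε (2 * j - 1)) :
    gvUnion A S Sgns ε n ⊆ gvUnion A S Sgns ε' n' := by
  rintro x ⟨σ, hσ, hl, hx, hx'⟩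
  exact ⟨σ, hσ, hn.trans hl, gvClosedRelaxation_mono (fun h ↦ h1 _ h hl (signLevel_le σ)) hx,
    fun σ' hσ' hσ'' hle hcon ↦ hx' σ' hσ' hσ'' hle
      (gvHalfOpen_mono (fun h ↦ h2 _ h (hl.trans hle) (signLevel_le σ')) hcon)⟩

lemma gvUnion_subset : gvUnion A S Sgns ε n ⊆ S := by
  rintro x ⟨σ, -, -, hx, -⟩
  exact hx.1

lemma mem_gvHalfOpen_signVector (hx : x ∈ S) : x ∈ gvHalfOpen A S ε (signVector A x) :=
  ⟨hx, fun _ hi ↦ Or.inr (signVector_eq_zero.1 hi), fun _ hi ↦ sign_eq_one_iff.1 hi,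
    fun _ hi ↦ sign_eq_neg_one_iff.1 hi⟩

lemma gvHalfOpen_eq (h : 1 ≤ signLevel σ → 0 < ε (2 * signLevel σ - 1)) :
    gvHalfOpen A S ε σ = gvOpenRelaxation A S ε σ := by
  ext x
  refine and_congr_right fun _ ↦ and_congr_left fun _ ↦ forall₂_congr fun i hi ↦ ?_
  refine or_iff_left_of_imp fun h0 ↦ ?_
  rw [h0, abs_zero]
  exact h (signLevel_pos hi)

lemma signVector_eq_of_mem_gvHalfOpen (h : 1 ≤ signLevel σ → ε (2 * signLevel σ - 1) ≤ 0)
    (hx : x ∈ gvHalfOpen A S ε σ) : signVector A x = σ := by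
  funext i
  rcases hi : σ i with _ | _ | _
  · refine signVector_eq_zero.2 ((hx.2.1 i hi).resolve_left fun h' ↦ ?_)
    exact (h'.trans_le (h (signLevel_pos hi))).not_ge (abs_nonneg _)
  · exact sign_eq_neg_one_iff.2 (hx.2.2.2 i hi)
  · exact sign_eq_one_iff.2 (hx.2.2.1 i hi)

lemma eval_eq_zero_of_mem_gvClosedRelaxation (h : 1 ≤ signLevel σ → ε (2 * signLevel σ) ≤ 0)
    (hx : x ∈ gvClosedRelaxation A S ε σ) {i : Fin t} (hi : σ i = 0) : eval x (A i) = 0 :=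
  abs_eq_zero.1 (((hx.2.1 i hi).trans (h (signLevel_pos hi))).antisymm (abs_nonneg _))

lemma eq_of_mem_gvClosedRelaxation (h : 1 ≤ signLevel σ → ε (2 * signLevel σ) ≤ 0)
    (hx : x ∈ gvClosedRelaxation A S ε σ) (hl : signLevel (signVector A x) ≤ signLevel σ) :
    signVector A x = σ := by
  have h0 : ∀ i, σ i = 0 → signVector A x i = 0 := fun i hi ↦
    signVector_eq_zero.2 (eval_eq_zero_of_mem_gvClosedRelaxation h hx hi)
  funext i
  by_cases hi0 : signVector A x i = 0
  · rw [hi0, eq_zero_of_signLevel_le h0 hl hi0]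
  have hne : eval x (A i) ≠ 0 := fun h ↦ hi0 (signVector_eq_zero.2 h)
  rcases hi : σ i with _ | _ | _
  · exact absurd (h0 i hi) hi0
  · exact sign_eq_neg_one_iff.2 (lt_of_le_of_ne (hx.2.2.2 i hi) hne)
  · exact sign_eq_one_iff.2 (lt_of_le_of_ne (hx.2.2.1 i hi) hne.symm)

lemma gvUnion_eq_of_le_zero (hSs : ∀ x ∈ S, ∀ y, signVector A y = signVector A x → y ∈ S)
    (hSgns : Sgns ⊆ signCondOn A S) (hε : ∀ j ≤ 2 * t, ε j = 0) :
    gvUnion A S Sgns ε 0 = ⋃ σ ∈ Sgns, signRealization A σ := by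
  have h1 : ∀ σ : Fin t → SignType, ε (2 * signLevel σ) = 0 := fun σ ↦
    hε _ (by have := signLevel_le σ; omega)
  have h2 : ∀ σ : Fin t → SignType, ε (2 * signLevel σ - 1) = 0 := fun σ ↦
    hε _ (by have := signLevel_le σ; omega)
  ext x
  simp only [mem_iUnion, mem_signRealization, exists_prop]
  constructor
  · rintro ⟨σ, hσ, -, hx, hx'⟩
    refine ⟨signVector A x, ?_, rfl⟩
    by_contra hcon
    refine hx' _ (signVector_mem_signCondOn hSs hx.1) hcon (signLevel_mono fun i hi ↦ ?_)
      (mem_gvHalfOpen_signVector hx.1)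
    exact signVector_eq_zero.2 (eval_eq_zero_of_mem_gvClosedRelaxation (fun _ ↦ (h1 σ).le) hx hi)
  · rintro ⟨σ, hσ, rfl⟩
    have hx : x ∈ S := (hSgns hσ).2 (mem_signRealization.2 rfl)
    refine ⟨_, hσ, Nat.zero_le _, ⟨hx, fun i hi ↦ ?_, fun i hi ↦ ?_, fun i hi ↦ ?_⟩, ?_⟩
    · rw [h1, signVector_eq_zero.1 hi, abs_zero]
    · exact (sign_eq_one_iff.1 hi).le
    · exact (sign_eq_neg_one_iff.1 hi).le
    · intro σ' _ hσ' _ hcon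
      rw [signVector_eq_of_mem_gvHalfOpen (fun _ ↦ (h2 σ').le) hcon] at hσ
      exact hσ' hσ

lemma mem_gvSeq_iff {X : Set (Fin k → ℝ)} :
    x ∈ gvSeq A S ε Sgns X n ↔
      (x ∈ X ∧ ∀ σ' ∈ signCondOn A S, σ' ∉ Sgns → signLevel σ' < n →
        x ∉ gvOpenRelaxation A S ε σ') ∨
      ∃ σ ∈ Sgns, signLevel σ < n ∧ x ∈ gvClosedRelaxation A S ε σ ∧
        ∀ σ' ∈ signCondOn A S, σ' ∉ Sgns → signLevel σ ≤ signLevel σ' → signLevel σ' < n →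
          x ∉ gvOpenRelaxation A S ε σ' := by
  induction n with
  | zero => simp [gvSeq]
  | succ n ih =>
    simp only [gvSeq, Set.mem_sdiff, mem_union, ih, mem_iUnion, Set.mem_ofPred_eq, exists_prop, not_exists,
      not_and]
    constructor
    · rintro ⟨(⟨hx, h⟩ | ⟨σ, hσ, hl, hx, h⟩) | ⟨σ, ⟨hσ, hl⟩, hx⟩, h'⟩
      · refine Or.inl ⟨hx, fun σ' h1 h2 h3 ↦ ?_⟩
        rcases (Nat.lt_succ_iff.1 h3).lt_or_eq with h3 | h3
        · exact h σ' h1 h2 h3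
        · exact h' σ' ⟨h1, h3, h2⟩
      · refine Or.inr ⟨σ, hσ, by omega, hx, fun σ' h1 h2 h4 h3 ↦ ?_⟩
        rcases (Nat.lt_succ_iff.1 h3).lt_or_eq with h3 | h3
        · exact h σ' h1 h2 h4 h3
        · exact h' σ' ⟨h1, h3, h2⟩
      · exact Or.inr ⟨σ, hσ, by omega, hx, fun σ' h1 h2 h4 h3 ↦ h' σ' ⟨h1, by omega, h2⟩⟩
    · rintro (⟨hx, h⟩ | ⟨σ, hσ, hl, hx, h⟩)
      · exact ⟨Or.inl (Or.inl ⟨hx, fun σ' h1 h2 h3 ↦ h σ' h1 h2 (by omega)⟩),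
          fun σ' ⟨h1, h3, h2⟩ ↦ h σ' h1 h2 (by omega)⟩
      · refine ⟨?_, fun σ' ⟨h1, h3, h2⟩ ↦ h σ' h1 h2 (by omega) (by omega)⟩
        rcases (Nat.lt_succ_iff.1 hl).lt_or_eq with hl | hl
        · exact Or.inl (Or.inr ⟨σ, hσ, hl, hx, fun σ' h1 h2 h4 h3 ↦ h σ' h1 h2 h4 (by omega)⟩)
        · exact Or.inr ⟨σ, ⟨hσ, hl⟩, hx⟩

lemma gvSeq_eq_gvUnion (hSgns : Sgns ⊆ signCondOn A S) (hε : ∀ j, 1 ≤ j → 0 < ε j) :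
    gvSeq A S ε Sgns (⋃ σ ∈ Sgns, signRealization A σ) (t + 1) = gvUnion A S Sgns ε 0 := by
  have hO : ∀ σ : Fin t → SignType, gvHalfOpen A S ε σ = gvOpenRelaxation A S ε σ := fun σ ↦
    gvHalfOpen_eq fun h ↦ hε _ (by omega)
  have hl : ∀ σ : Fin t → SignType, signLevel σ < t + 1 := fun σ ↦ Nat.lt_succ_of_le (signLevel_le σ)
  ext x
  rw [mem_gvSeq_iff]
  simp only [hl, forall_true_left, true_and, gvUnion, Set.mem_ofPred_eq, zero_le, hO]
  refine or_iff_right_of_imp ?_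
  rintro ⟨hx, h⟩
  simp only [mem_iUnion, mem_signRealization, exists_prop] at hx
  obtain ⟨σ, hσ, rfl⟩ := hx
  refine ⟨_, hσ, ⟨(hSgns hσ).2 (mem_signRealization.2 rfl), fun i hi ↦ ?_, fun i hi ↦ ?_,
    fun i hi ↦ ?_⟩, fun σ' h1 h2 _ ↦ h σ' h1 h2⟩
  · rw [signVector_eq_zero.1 hi, abs_zero]
    exact (hε _ (by have := signLevel_pos hi; omega)).le
  · exact (sign_eq_one_iff.1 hi).le
  · exact (sign_eq_neg_one_iff.1 hi).le

end Basic

section ClosedSets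

variable {k t : ℕ} {A : Fin t → MvPolynomial (Fin k) ℝ} {S : Set (Fin k → ℝ)}
  {ε : ℕ → ℝ} {σ : Fin t → SignType} {x y : Fin k → ℝ}

lemma isClosed_basicClosedSet (P : MvPolynomial (Fin k) ℝ) (r : SignType) :
    IsClosed (basicClosedSet P r) := by
  have h : Continuous fun x : Fin k → ℝ ↦ eval x P := MvPolynomial.continuous_eval P
  rcases r with _ | _ | _
  · exact isClosed_eq h continuous_const
  · exact isClosed_le h continuous_const
  · exact isClosed_le continuous_const h

lemma mem_basicClosedSet_of_sign_eq {P : MvPolynomial (Fin k) ℝ} {r : SignType}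
    (h : SignType.sign (eval y P) = SignType.sign (eval x P)) (hx : x ∈ basicClosedSet P r) :
    y ∈ basicClosedSet P r := by
  rcases r with _ | _ | _
  · exact sign_eq_zero_iff.1 (h.trans (sign_eq_zero_iff.2 hx))
  · exact sign_nonpos_iff.1 (h.trans_le (sign_nonpos_iff.2 hx))
  · exact sign_nonneg_iff.1 (h.symm ▸ sign_nonneg_iff.2 hx)

lemma isClosed_iUnion_iInter_basicClosedSet {nJ : ℕ} (mJ : Fin nJ → ℕ)
    (idx : ∀ j, Fin (mJ j) → Fin t) (rel : ∀ j, Fin (mJ j) → SignType) :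
    IsClosed (⋃ j, ⋂ i, basicClosedSet (A (idx j i)) (rel j i)) :=
  isClosed_iUnion_of_finite fun _ ↦ isClosed_iInter fun _ ↦ isClosed_basicClosedSet _ _

lemma mem_iUnion_iInter_basicClosedSet {nJ : ℕ} {mJ : Fin nJ → ℕ}
    {idx : ∀ j, Fin (mJ j) → Fin t} {rel : ∀ j, Fin (mJ j) → SignType}
    (hx : x ∈ ⋃ j, ⋂ i, basicClosedSet (A (idx j i)) (rel j i))
    (h : signVector A y = signVector A x) :
    y ∈ ⋃ j, ⋂ i, basicClosedSet (A (idx j i)) (rel j i) := by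
  simp only [mem_iUnion, mem_iInter] at hx ⊢
  obtain ⟨j, hj⟩ := hx
  exact ⟨j, fun i ↦ mem_basicClosedSet_of_sign_eq (congrFun h _) (hj i)⟩

lemma isOpen_setOf_gvOpenRelaxation (A : Fin t → MvPolynomial (Fin k) ℝ) (ε : ℕ → ℝ)
    (σ : Fin t → SignType) :
    IsOpen {x : Fin k → ℝ | (∀ i, σ i = 0 → |eval x (A i)| < ε (2 * signLevel σ - 1)) ∧
      (∀ i, σ i = 1 → 0 < eval x (A i)) ∧ (∀ i, σ i = -1 → eval x (A i) < 0)} := by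
  have h : ∀ i, Continuous fun x : Fin k → ℝ ↦ eval x (A i) :=
    fun i ↦ MvPolynomial.continuous_eval _
  simp only [ofPred_and, ofPred_forall]
  refine .inter ?_ (.inter ?_ ?_) <;>
    refine isOpen_iInter_of_finite fun i ↦ isOpen_iInter_of_finite fun _ ↦ ?_
  · exact isOpen_lt (h i).abs continuous_const
  · exact isOpen_lt continuous_const (h i)
  · exact isOpen_lt (h i) continuous_const

lemma eventually_mem_gvOpenRelaxation (hx : x ∈ gvOpenRelaxation A S ε σ) :
    ∀ᶠ x' in 𝓝[S] x, x' ∈ gvOpenRelaxation A S ε σ := by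
  filter_upwards [self_mem_nhdsWithin,
    mem_nhdsWithin_of_mem_nhds ((isOpen_setOf_gvOpenRelaxation A ε σ).mem_nhds hx.2)] with x' h1 h2
  exact ⟨h1, h2⟩

lemma isClosed_sdiff_gvOpenRelaxation (hS : IsClosed S) :
    IsClosed (S \ gvOpenRelaxation A S ε σ) := by
  have : S \ gvOpenRelaxation A S ε σ =
      S \ {x : Fin k → ℝ | (∀ i, σ i = 0 → |eval x (A i)| < ε (2 * signLevel σ - 1)) ∧
      (∀ i, σ i = 1 → 0 < eval x (A i)) ∧ (∀ i, σ i = -1 → eval x (A i) < 0)} := by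
    ext x
    exact and_congr_right fun hx ↦ not_congr (and_iff_right hx)
  rw [this]
  exact hS.sdiff (isOpen_setOf_gvOpenRelaxation A ε σ)

lemma isClosed_setOf_mem_gvClosedRelaxation (hS : IsClosed S) {e : ℝ → ℕ → ℝ}
    (he : ∀ j, Continuous fun ρ ↦ e ρ j) :
    IsClosed {p : ℝ × (Fin k → ℝ) | p.2 ∈ gvClosedRelaxation A S (e p.1) σ} := by
  have h : ∀ i, Continuous fun p : ℝ × (Fin k → ℝ) ↦ eval p.2 (A i) :=
    fun i ↦ (MvPolynomial.continuous_eval _).comp continuous_snd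
  have : {p : ℝ × (Fin k → ℝ) | p.2 ∈ gvClosedRelaxation A S (e p.1) σ} =
      {p | p.2 ∈ S} ∩ ((⋂ i, ⋂ (_ : σ i = 0), {p | |eval p.2 (A i)| ≤ e p.1 (2 * signLevel σ)}) ∩
        ((⋂ i, ⋂ (_ : σ i = 1), {p | 0 ≤ eval p.2 (A i)}) ∩
        ⋂ i, ⋂ (_ : σ i = -1), {p | eval p.2 (A i) ≤ 0})) := by
    ext p
    simp only [gvClosedRelaxation, mem_inter_iff, mem_iInter, Set.mem_ofPred_eq]
  rw [this]
  refine (hS.preimage continuous_snd).inter (.inter ?_ (.inter ?_ ?_)) <;>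
    refine isClosed_iInter fun i ↦ isClosed_iInter fun _ ↦ ?_
  · exact isClosed_le (h i).abs ((he _).comp continuous_fst)
  · exact isClosed_le continuous_const (h i)
  · exact isClosed_le (h i) continuous_const

lemma isClosed_gvClosedRelaxation (hS : IsClosed S) : IsClosed (gvClosedRelaxation A S ε σ) :=
  (isClosed_setOf_mem_gvClosedRelaxation hS fun _ ↦ continuous_const).preimage
    (Continuous.prodMk_right (0 : ℝ))

lemma isClosed_gvUnion (hS : IsClosed S) {Sgns : Set (Fin t → SignType)} {n : ℕ}
    (hε : ∀ j, 1 ≤ j → n ≤ j → 0 < ε (2 * j - 1)) : IsClosed (gvUnion A S Sgns ε n) := by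
  have : gvUnion A S Sgns ε n = ⋃ σ ∈ {σ ∈ Sgns | n ≤ signLevel σ}, gvClosedRelaxation A S ε σ ∩
      ⋂ σ' ∈ {σ' ∈ signCondOn A S | σ' ∉ Sgns ∧ signLevel σ ≤ signLevel σ'},
        S \ gvOpenRelaxation A S ε σ' := by
    ext x
    simp only [gvUnion, Set.mem_ofPred_eq, mem_iUnion, mem_inter_iff, mem_iInter, Set.mem_sdiff,
      exists_prop, and_assoc]
    refine exists_congr fun σ ↦ and_congr_right fun _ ↦ and_congr_right fun hl ↦
      and_congr_right fun hx ↦ forall_congr' fun σ' ↦ ?_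
    rw [and_imp, and_imp]
    refine forall₃_congr fun _ _ hl' ↦ ?_
    rw [gvHalfOpen_eq fun h ↦ hε _ h (hl.trans hl')]
    exact (and_iff_right hx.1).symm
  rw [this]
  exact (toFinite _).isClosed_biUnion fun σ _ ↦ (isClosed_gvClosedRelaxation hS).inter
    (isClosed_biInter fun σ' _ ↦ isClosed_sdiff_gvOpenRelaxation hS)

end ClosedSets

/-- Two points with two vectors of tolerances that no comparison relevant to the
Gabrielov-Vorobjov construction can tell apart. -/
structure GVCompat {k t : ℕ} (A : Fin t → MvPolynomial (Fin k) ℝ) (ε ε' : ℕ → ℝ)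
    (x y : Fin k → ℝ) : Prop where
  sign : signVector A y = signVector A x
  le : ∀ i, ∀ j ≤ 2 * t, |eval y (A i)| ≤ ε' j ↔ |eval x (A i)| ≤ ε j
  lt : ∀ i, ∀ j ≤ 2 * t, |eval y (A i)| < ε' j ↔ |eval x (A i)| < ε j

namespace GVCompat

variable {k t : ℕ} {A : Fin t → MvPolynomial (Fin k) ℝ} {S : Set (Fin k → ℝ)} {ε ε' : ℕ → ℝ}
  {x y : Fin k → ℝ} {Sgns : Set (Fin t → SignType)}

lemma mem_iff (h : GVCompat A ε ε' x y)
    (hSs : ∀ x ∈ S, ∀ y, signVector A y = signVector A x → y ∈ S) : y ∈ S ↔ x ∈ S :=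
  ⟨fun hy ↦ hSs y hy x h.sign.symm, fun hx ↦ hSs x hx y h.sign⟩

lemma mem_gvClosedRelaxation_iff (h : GVCompat A ε ε' x y)
    (hSs : ∀ x ∈ S, ∀ y, signVector A y = signVector A x → y ∈ S) (σ : Fin t → SignType) :
    y ∈ gvClosedRelaxation A S ε' σ ↔ x ∈ gvClosedRelaxation A S ε σ := by
  have hl := signLevel_le σ
  refine and_congr (h.mem_iff hSs) (and_congr (forall₂_congr fun i _ ↦ h.le i _ (by omega))
    (and_congr (forall₂_congr fun i _ ↦ ?_) (forall₂_congr fun i _ ↦ ?_)))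
  · have := congrFun h.sign i
    simp only [signVector] at this
    rw [← sign_nonneg_iff, this, sign_nonneg_iff]
  · have := congrFun h.sign i
    simp only [signVector] at this
    rw [← sign_nonpos_iff, this, sign_nonpos_iff]

lemma mem_gvHalfOpen_iff (h : GVCompat A ε ε' x y)
    (hSs : ∀ x ∈ S, ∀ y, signVector A y = signVector A x → y ∈ S) (σ : Fin t → SignType) :
    y ∈ gvHalfOpen A S ε' σ ↔ x ∈ gvHalfOpen A S ε σ := by
  have hl := signLevel_le σ
  refine and_congr (h.mem_iff hSs) (and_congr (forall₂_congr fun i _ ↦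
    or_congr (h.lt i _ (by omega)) ?_)
    (and_congr (forall₂_congr fun i _ ↦ ?_) (forall₂_congr fun i _ ↦ ?_)))
  · rw [← signVector_eq_zero, h.sign, signVector_eq_zero]
  · have := congrFun h.sign i
    simp only [signVector] at this
    rw [← sign_eq_one_iff, this, sign_eq_one_iff]
  · have := congrFun h.sign i
    simp only [signVector] at this
    rw [← sign_eq_neg_one_iff, this, sign_eq_neg_one_iff]

lemma mem_gvUnion_iff (h : GVCompat A ε ε' x y)
    (hSs : ∀ x ∈ S, ∀ y, signVector A y = signVector A x → y ∈ S) (n : ℕ) :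
    y ∈ gvUnion A S Sgns ε' n ↔ x ∈ gvUnion A S Sgns ε n := by
  simp only [gvUnion, Set.mem_ofPred_eq, h.mem_gvClosedRelaxation_iff hSs,
    h.mem_gvHalfOpen_iff hSs]

end GVCompat

/-- A flow preserving the signs of a family of polynomials and their comparisons in absolute value
with finitely many tolerances depending affinely on the parameter. -/
lemma exists_flow_gvCompat {k t : ℕ} (A : Fin t → MvPolynomial (Fin k) ℝ) {S : Set (Fin k → ℝ)}
    (hS : Bornology.IsBounded S) (a b : ℕ → ℝ) :
    ∃ s₀ L Ψ, S ⊆ L ∧ FlowOn s₀ L Ψ ∧ ∀ s ∈ Ioc 0 s₀, ∀ s' ∈ Ioc 0 s₀, ∀ x ∈ L,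
      GVCompat A (fun j ↦ a j + s * b j) (fun j ↦ a j + s' * b j) x (Ψ s s' x) := by
  classical
  obtain ⟨c, hc⟩ : ∃ c : ℕ → Polynomial (MvPolynomial (Fin k) ℝ),
      ∀ s x j, parEval s x (c j) = a j + s * b j :=
    ⟨fun j ↦ Polynomial.C (C (a j)) + Polynomial.X * Polynomial.C (C (b j)), fun s x j ↦ by
      rw [map_add, map_mul]
      simp [parEval_apply]⟩
  have hA : ∀ s x i, parEval s x (Polynomial.C (A i)) = eval x (A i) := fun s x i ↦ by
    simp [parEval_apply]
  let 𝓐 : Finset (Polynomial (MvPolynomial (Fin k) ℝ)) :=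
    (Finset.univ.image fun i ↦ Polynomial.C (A i)) ∪
    ((Finset.univ ×ˢ Finset.range (2 * t + 1)).image fun p : Fin t × ℕ ↦
      Polynomial.C (A p.1) - c p.2) ∪
    ((Finset.univ ×ˢ Finset.range (2 * t + 1)).image fun p : Fin t × ℕ ↦
      Polynomial.C (A p.1) + c p.2)
  obtain ⟨s₀, L, Ψ, hL, hΨ, hsign⟩ := exists_flow k 𝓐 S hS
  refine ⟨s₀, L, Ψ, hL, hΨ, fun s hs s' hs' x hx ↦ ?_⟩
  have h1 : ∀ i, SignType.sign (eval (Ψ s s' x) (A i)) = SignType.sign (eval x (A i)) := by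
    intro i
    have := hsign (Polynomial.C (A i)) (by simp [𝓐]) s hs s' hs' x hx
    rwa [hA, hA] at this
  have h2 : ∀ i, ∀ j ≤ 2 * t, SignType.sign (eval (Ψ s s' x) (A i) - (a j + s' * b j)) =
      SignType.sign (eval x (A i) - (a j + s * b j)) := by
    intro i j hj
    have := hsign (Polynomial.C (A i) - c j) (Finset.mem_union_left _ (Finset.mem_union_right _
      (Finset.mem_image.2 ⟨(i, j), by simpa using Nat.lt_succ_of_le hj, rfl⟩))) s hs s' hs' x hx
    rwa [map_sub (parEval _ _), map_sub (parEval _ _), hA, hA, hc, hc] at this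
  have h3 : ∀ i, ∀ j ≤ 2 * t, SignType.sign (eval (Ψ s s' x) (A i) + (a j + s' * b j)) =
      SignType.sign (eval x (A i) + (a j + s * b j)) := by
    intro i j hj
    have := hsign (Polynomial.C (A i) + c j) (Finset.mem_union_right _
      (Finset.mem_image.2 ⟨(i, j), by simpa using Nat.lt_succ_of_le hj, rfl⟩)) s hs s' hs' x hx
    rwa [map_add (parEval _ _), map_add (parEval _ _), hA, hA, hc, hc] at this
  refine ⟨funext h1, fun i j hj ↦ ?_, fun i j hj ↦ ?_⟩
  · have h2 := h2 i j hj
    have h3 := h3 i j hj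
    rw [abs_le, abs_le, neg_le_iff_add_nonneg, neg_le_iff_add_nonneg, ← sign_nonneg_iff, h3,
      sign_nonneg_iff, ← sub_nonpos (b := a j + s' * b j), ← sign_nonpos_iff, h2, sign_nonpos_iff,
      sub_nonpos]
  · have h2 := h2 i j hj
    have h3 := h3 i j hj
    rw [abs_lt, abs_lt, neg_lt_iff_pos_add, neg_lt_iff_pos_add, ← sign_eq_one_iff, h3,
      sign_eq_one_iff, ← sub_neg (b := a j + s' * b j), ← sign_eq_neg_one_iff, h2,
      sign_eq_neg_one_iff, sub_neg]

/-- The indicator function of the even numbers between `2 * m` and `2 * n`. -/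
noncomputable def evenIndicator (m n j : ℕ) : ℝ := if Even j ∧ 2 * m ≤ j ∧ j ≤ 2 * n then 1 else 0

section EvenIndicator

variable {m n j : ℕ}

lemma evenIndicator_nonneg : 0 ≤ evenIndicator m n j := by
  unfold evenIndicator
  split_ifs <;> norm_num

lemma evenIndicator_le_one : evenIndicator m n j ≤ 1 := by
  unfold evenIndicator
  split_ifs <;> norm_num

lemma evenIndicator_odd (hj : 1 ≤ j) : evenIndicator m n (2 * j - 1) = 0 :=
  if_neg fun h ↦ by
    have := h.1.two_dvd
    omega

lemma evenIndicator_of_lt (hj : j < 2 * m) : evenIndicator m n j = 0 :=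
  if_neg fun h ↦ by omega

lemma evenIndicator_of_gt (hj : 2 * n < j) : evenIndicator m n j = 0 :=
  if_neg fun h ↦ by omega

lemma evenIndicator_two_mul (h1 : m ≤ j) (h2 : j ≤ n) : evenIndicator m n (2 * j) = 1 :=
  if_pos ⟨even_two_mul j, by omega, by omega⟩

end EvenIndicator

/-- Points of closed relaxations of level `l` which lie on the boundary of a strict inequality are
in an open relaxation of higher level. -/
def GVSep {k t : ℕ} (A : Fin t → MvPolynomial (Fin k) ℝ) (S : Set (Fin k → ℝ))
    (ε : ℕ → ℝ) (l : ℕ) : Prop :=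
  ∀ σ : Fin t → SignType, signLevel σ = l → ∀ j, σ j ≠ 0 → ∀ x ∈ S,
    x ∈ gvClosedRelaxation A S ε σ → eval x (A j) = 0 →
    ∃ τ ∈ signCondOn A S, l < signLevel τ ∧ x ∈ gvOpenRelaxation A S ε τ

section Sep

variable {k t : ℕ} {A : Fin t → MvPolynomial (Fin k) ℝ} {S : Set (Fin k → ℝ)}
  {Sgns : Set (Fin t → SignType)} {ε ε' : ℕ → ℝ} {σ τ : Fin t → SignType} {x y : Fin k → ℝ}
  {m l : ℕ}

lemma gvOpenRelaxation_congr
    (h : 1 ≤ signLevel σ → ε (2 * signLevel σ - 1) = ε' (2 * signLevel σ - 1)) :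
    gvOpenRelaxation A S ε σ = gvOpenRelaxation A S ε' σ := by
  ext x
  exact and_congr_right fun _ ↦ and_congr_left fun _ ↦ forall₂_congr fun i hi ↦ by
    rw [h (signLevel_pos hi)]

lemma gvHalfOpen_congr
    (h : 1 ≤ signLevel σ → ε (2 * signLevel σ - 1) = ε' (2 * signLevel σ - 1)) :
    gvHalfOpen A S ε σ = gvHalfOpen A S ε' σ :=
  (gvHalfOpen_mono fun h' ↦ (h h').le).antisymm (gvHalfOpen_mono fun h' ↦ (h h').ge)

lemma gvClosedRelaxation_congr
    (h : 1 ≤ signLevel σ → ε (2 * signLevel σ) = ε' (2 * signLevel σ)) :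
    gvClosedRelaxation A S ε σ = gvClosedRelaxation A S ε' σ :=
  (gvClosedRelaxation_mono fun h' ↦ (h h').le).antisymm
    (gvClosedRelaxation_mono fun h' ↦ (h h').ge)

lemma GVSep.congr (h : GVSep A S ε l) (h1 : ε (2 * l) = ε' (2 * l))
    (h2 : ∀ j, l < j → ε (2 * j - 1) = ε' (2 * j - 1)) : GVSep A S ε' l := by
  intro σ hσ j hj x hx hxσ hxj
  rw [gvClosedRelaxation_congr (ε' := ε) fun _ ↦ by rw [hσ, h1]] at hxσ
  obtain ⟨τ, hτ, hl, hxτ⟩ := h σ hσ j hj x hx hxσ hxj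
  exact ⟨τ, hτ, hl, gvOpenRelaxation_congr (ε := ε) (fun _ ↦ h2 _ hl) ▸ hxτ⟩

lemma gvSep_of_le_zero (hSs : ∀ x ∈ S, ∀ y, signVector A y = signVector A x → y ∈ S)
    (h1 : ε (2 * l) ≤ 0) (h2 : ∀ j, l < j → 0 < ε (2 * j - 1)) : GVSep A S ε l := by
  rintro σ rfl j hj x hx hxσ hxj
  have hlt : signLevel σ < signLevel (signVector A x) := by
    by_contra! hle
    exact hj (eq_of_mem_gvClosedRelaxation (fun _ ↦ h1) hxσ hle ▸ signVector_eq_zero.2 hxj)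
  refine ⟨_, signVector_mem_signCondOn hSs hx, hlt, ?_⟩
  rw [← gvHalfOpen_eq fun _ ↦ h2 _ hlt]
  exact mem_gvHalfOpen_signVector hx

/-- Separation is an open condition on the tolerances of closed relaxations. -/
lemma GVSep.eventually (hS : IsCompact S) {e : ℝ → ℕ → ℝ} (he : ∀ j, Continuous fun ρ ↦ e ρ j)
    (hodd : ∀ ρ j, 1 ≤ j → e ρ (2 * j - 1) = e 0 (2 * j - 1)) (h : GVSep A S (e 0) l) :
    ∀ᶠ ρ in 𝓝 0, GVSep A S (e ρ) l := by
  have hO : ∀ ρ τ, gvOpenRelaxation A S (e ρ) τ = gvOpenRelaxation A S (e 0) τ := fun ρ τ ↦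
    gvOpenRelaxation_congr fun h' ↦ hodd ρ _ h'
  simp only [GVSep, hO]
  refine eventually_all.2 fun σ ↦ eventually_all.2 fun hσ ↦ eventually_all.2 fun j ↦
    eventually_all.2 fun hj ↦ hS.eventually_forall_of_forall_eventually fun x hx ↦ ?_
  by_cases h1 : x ∈ gvClosedRelaxation A S (e 0) σ
  swap
  · filter_upwards [(isClosed_setOf_mem_gvClosedRelaxation (σ := σ) (A := A) hS.isClosed
      he).isOpen_compl.mem_nhds (show (0, x) ∈ _ from h1)] with p hp hp'
    exact absurd hp' hp
  by_cases h2 : eval x (A j) = 0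
  swap
  · have : Continuous fun p : ℝ × (Fin k → ℝ) ↦ eval p.2 (A j) :=
      (MvPolynomial.continuous_eval _).comp continuous_snd
    filter_upwards [this.continuousAt.eventually_ne h2] with p hp _ hp'
    exact absurd hp' hp
  obtain ⟨τ, hτ, hl, hxτ⟩ := h σ hσ j hj x hx h1 h2
  have := (isOpen_setOf_gvOpenRelaxation A (e 0) τ).preimage (continuous_snd (X := ℝ))
  filter_upwards [this.mem_nhds (show (0, x) ∈ _ from hxτ.2)] with p hp hpσ _
  exact ⟨τ, hτ, hl, hpσ.1, hp⟩

/-- Enlarging the tolerances of closed relaxations of level at least `m` does not change the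
homotopy type. -/
lemma FlowOn.homotopyEquiv_gvUnion_shift (hS : IsClosed S)
    (hSs : ∀ x ∈ S, ∀ y, signVector A y = signVector A x → y ∈ S)
    {s₀ : ℝ} {L : Set (Fin k → ℝ)} {Ψ : ℝ → ℝ → (Fin k → ℝ) → Fin k → ℝ} (h : FlowOn s₀ L Ψ)
    (hSL : S ⊆ L)
    (hΨ : ∀ s ∈ Ioc 0 s₀, ∀ s' ∈ Ioc 0 s₀, ∀ x ∈ L, GVCompat A
      (fun j ↦ ε j + s * evenIndicator m t j) (fun j ↦ ε j + s' * evenIndicator m t j) x (Ψ s s' x))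
    (hε0 : ∀ j ≤ 2 * m, ε j = 0) (hε : ∀ j, 2 * m < j → 0 < ε j) :
    Nonempty (ContinuousMap.HomotopyEquiv
      (gvUnion A S Sgns (fun j ↦ ε j + s₀ * evenIndicator m t j) 0) (gvUnion A S Sgns ε 0)) := by
  set e : ℝ → ℕ → ℝ := fun ρ j ↦ ε j + ρ * evenIndicator m t j with he
  have he0 : e 0 = ε := by
    funext j
    simp [he]
  have hec : ∀ j, Continuous fun ρ ↦ e ρ j := fun j ↦ by fun_prop
  have hodd : ∀ ρ j, 1 ≤ j → e ρ (2 * j - 1) = ε (2 * j - 1) := fun ρ j hj ↦ by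
    simp [he, evenIndicator_odd hj]
  have hO : ∀ ρ σ', gvHalfOpen A S (e ρ) σ' = gvHalfOpen A S ε σ' := fun ρ σ' ↦
    gvHalfOpen_congr fun h' ↦ hodd ρ _ h'
  have hpos : ∀ σ' : Fin t → SignType, m < signLevel σ' → 0 < ε (2 * signLevel σ' - 1) :=
    fun σ' h' ↦ hε _ (by omega)
  have hT : IsClosed {p : ℝ × (Fin k → ℝ) | ∃ σ ∈ Sgns, m ≤ signLevel σ ∧
      p.2 ∈ gvClosedRelaxation A S (e p.1) σ ∧ ∀ σ' ∈ signCondOn A S, σ' ∉ Sgns →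
        signLevel σ ≤ signLevel σ' → m < signLevel σ' → p.2 ∉ gvHalfOpen A S ε σ'} := by
    have : {p : ℝ × (Fin k → ℝ) | ∃ σ ∈ Sgns, m ≤ signLevel σ ∧
      p.2 ∈ gvClosedRelaxation A S (e p.1) σ ∧ ∀ σ' ∈ signCondOn A S, σ' ∉ Sgns →
        signLevel σ ≤ signLevel σ' → m < signLevel σ' → p.2 ∉ gvHalfOpen A S ε σ'} =
        ⋃ σ ∈ {σ ∈ Sgns | m ≤ signLevel σ}, {p | p.2 ∈ gvClosedRelaxation A S (e p.1) σ} ∩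
        ⋂ σ' ∈ {σ' ∈ signCondOn A S | σ' ∉ Sgns ∧ signLevel σ ≤ signLevel σ' ∧ m < signLevel σ'},
          Prod.snd ⁻¹' (S \ gvOpenRelaxation A S ε σ') := by
      ext p
      simp only [Set.mem_ofPred_eq, mem_iUnion, mem_inter_iff, mem_iInter, Set.mem_sdiff,
        exists_prop, and_assoc, mem_preimage]
      refine exists_congr fun σ ↦ and_congr_right fun _ ↦ and_congr_right fun hl ↦
        and_congr_right fun hx ↦ forall_congr' fun σ' ↦ ?_
      rw [and_imp, and_imp, and_imp]
      refine forall₄_congr fun _ _ _ hl' ↦ ?_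
      rw [gvHalfOpen_eq fun _ ↦ hpos _ hl']
      exact (and_iff_right hx.1).symm
    rw [this]
    exact (toFinite _).isClosed_biUnion fun σ _ ↦ (isClosed_setOf_mem_gvClosedRelaxation hS
      hec).inter (isClosed_biInter fun σ' _ ↦
        (isClosed_sdiff_gvOpenRelaxation hS).preimage continuous_snd)
  have key := h.homotopyEquiv_of_tube (D := fun ρ ↦ gvUnion A S Sgns (e ρ) 0)
    (fun s _ ↦ gvUnion_subset.trans hSL)
    (fun s _ s' _ hss ↦ gvUnion_mono le_rfl (fun j _ _ _ ↦ ?_) fun j hj _ _ ↦ ?_)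
    (fun s hs s' hs' x hx ↦ ((hΨ s hs s' hs' x (hSL (gvUnion_subset hx))).mem_gvUnion_iff
      hSs 0).2 hx) hT ?_ ?_ ?_
  · rwa [he0] at key
  · exact add_le_add_right (mul_le_mul_of_nonneg_right hss evenIndicator_nonneg) _
  · rw [hodd _ _ hj, hodd _ _ hj]
  · rintro s hs s' hs' x hx ⟨σ, hσ, hl, hxσ, hx'⟩
    have hc := hΨ s hs s' hs' x hx
    refine ⟨σ, hσ, hl, (hc.mem_gvClosedRelaxation_iff hSs σ).2 hxσ, fun σ' h1 h2 h3 h4 h5 ↦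
      hx' σ' h1 h2 h3 h4 ?_⟩
    rw [← hO s']  at h5
    rw [← hO s]
    exact (hc.mem_gvHalfOpen_iff hSs σ').1 h5
  · rintro s hs x ⟨σ, hσ, -, hxσ, hx⟩ hxT
    rcases lt_or_ge (signLevel σ) m with hl | hl
    · rw [he0]
      refine ⟨σ, hσ, Nat.zero_le _, ?_, fun σ' h1 h2 h3 ↦ hO s σ' ▸ hx σ' h1 h2 h3⟩
      rwa [gvClosedRelaxation_congr (ε' := ε)
        fun _ ↦ by simp [he, evenIndicator_of_lt (show 2 * signLevel σ < 2 * m by omega)]] at hxσ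
    · exact absurd ⟨σ, hσ, hl, hxσ, fun σ' h1 h2 h3 _ ↦ hO s σ' ▸ hx σ' h1 h2 h3⟩ hxT
  · rintro x ⟨σ, hσ, hl, hxσ, hx⟩
    rw [he0]
    simp only [he0] at hxσ
    refine ⟨σ, hσ, Nat.zero_le _, hxσ, fun σ' h1 h2 h3 h4 ↦ ?_⟩
    rcases lt_or_ge m (signLevel σ') with hl' | hl'
    · exact hx σ' h1 h2 h3 hl' h4
    · have hσ' := signVector_eq_of_mem_gvHalfOpen (fun _ ↦ (hε0 _ (by omega)).le) h4
      have hσ'' := eq_of_mem_gvClosedRelaxation (fun _ ↦ (hε0 _ (by omega)).le) hxσ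
        (by rw [hσ']; omega)
      rw [← hσ', hσ''] at h2
      exact h2 hσ

end Sep

section Union

variable {k t : ℕ} {A : Fin t → MvPolynomial (Fin k) ℝ} {S : Set (Fin k → ℝ)}
  {Sgns : Set (Fin t → SignType)} {ε ε' : ℕ → ℝ} {σ τ : Fin t → SignType} {x y : Fin k → ℝ}
  {m : ℕ}

lemma mem_gvOpenRelaxation_signVector (hx : x ∈ S)
    (h : 1 ≤ signLevel (signVector A x) → 0 < ε (2 * signLevel (signVector A x) - 1)) :
    x ∈ gvOpenRelaxation A S ε (signVector A x) :=
  gvHalfOpen_eq h ▸ mem_gvHalfOpen_signVector hx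

lemma gvOpenRelaxation_subset_gvHalfOpen : gvOpenRelaxation A S ε σ ⊆ gvHalfOpen A S ε σ :=
  fun _ hx ↦ ⟨hx.1, fun i hi ↦ .inl (hx.2.1 i hi), hx.2.2⟩

lemma gvOpenRelaxation_subset_gvClosedRelaxation
    (h : 1 ≤ signLevel σ → ε (2 * signLevel σ - 1) ≤ ε' (2 * signLevel σ)) :
    gvOpenRelaxation A S ε σ ⊆ gvClosedRelaxation A S ε' σ :=
  fun _ hx ↦ ⟨hx.1, fun i hi ↦ (hx.2.1 i hi).le.trans (h (signLevel_pos hi)),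
    fun i hi ↦ (hx.2.2.1 i hi).le, fun i hi ↦ (hx.2.2.2 i hi).le⟩

lemma mem_gvUnion_succ_of_mem_gvClosedRelaxation
    (heven : ∀ j, m < j → j ≤ t → ε (2 * j) ≤ ε' (2 * j))
    (hodd : ∀ j, m < j → j ≤ t → ε' (2 * j - 1) = ε (2 * j - 1))
    (hx : x ∈ gvUnion A S Sgns ε 0) (hσ : σ ∈ Sgns) (hm : m < signLevel σ)
    (hxσ : x ∈ gvClosedRelaxation A S ε' σ) : x ∈ gvUnion A S Sgns ε' (m + 1) := by
  obtain ⟨σ₁, hσ₁, -, hxσ₁, h⟩ := hx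
  rcases lt_or_ge m (signLevel σ₁) with hl | hl
  · exact gvUnion_mono le_rfl (fun j _ hj ↦ heven j hj) (fun j _ hj hj' ↦ (hodd j hj hj').le)
      ⟨σ₁, hσ₁, hl, hxσ₁, h⟩
  · refine ⟨σ, hσ, hm, hxσ, fun σ' h1 h2 h3 h4 ↦ h σ' h1 h2 (hl.trans (hm.le.trans h3)) ?_⟩
    rwa [gvHalfOpen_congr (ε' := ε) fun _ ↦ hodd _ (hm.trans_le h3) (signLevel_le _)] at h4

/-- Points of `gvUnion A S Sgns ε 0` near the part of level greater than `m` lie in the part of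
level greater than `m` for any larger tolerances. -/
lemma eventually_mem_gvUnion_succ (heven : ∀ j, m < j → j ≤ t → ε (2 * j) < ε' (2 * j))
    (hodd : ∀ j, m < j → j ≤ t → ε' (2 * j - 1) = ε (2 * j - 1))
    (hle : ∀ j, m < j → j ≤ t → ε (2 * j - 1) ≤ ε (2 * j))
    (hsep : ∀ l, m < l → GVSep A S ε l) (hx : x ∈ gvUnion A S Sgns ε (m + 1)) :
    ∀ᶠ x' in 𝓝[gvUnion A S Sgns ε 0] x, x' ∈ gvUnion A S Sgns ε' (m + 1) := by
  obtain ⟨σ, hσ, hm, hxσ, h⟩ := hx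
  have hA : ∀ i, ContinuousWithinAt (fun x : Fin k → ℝ ↦ eval x (A i)) S x :=
    fun i ↦ (MvPolynomial.continuous_eval _).continuousWithinAt
  obtain ⟨τ, hτ, hmτ, hev⟩ : ∃ τ ∈ Sgns, m < signLevel τ ∧
      ∀ᶠ x' in 𝓝[S] x, x' ∈ gvClosedRelaxation A S ε' τ := by
    by_cases hcase : ∃ j, σ j ≠ 0 ∧ eval x (A j) = 0
    · obtain ⟨j, hj, hxj⟩ := hcase
      obtain ⟨τ, hτ, hl, hxτ⟩ := hsep _ hm σ rfl j hj x hxσ.1 hxσ hxj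
      refine ⟨τ, ?_, hm.trans hl.le, (eventually_mem_gvOpenRelaxation hxτ).mono fun x' hx' ↦ ?_⟩
      · by_contra hτ'
        exact h τ hτ hτ' hl.le (gvOpenRelaxation_subset_gvHalfOpen hxτ)
      · exact gvOpenRelaxation_subset_gvClosedRelaxation (fun _ ↦ (hle _ (hm.trans hl.le)
          (signLevel_le _)).trans (heven _ (hm.trans hl.le) (signLevel_le _)).le) hx'
    · push Not at hcase
      refine ⟨σ, hσ, hm, ?_⟩
      have h1 : ∀ᶠ x' in 𝓝[S] x, ∀ i, σ i = 0 → |eval x' (A i)| ≤ ε' (2 * signLevel σ) :=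
        eventually_all.2 fun i ↦ eventually_all.2 fun hi ↦ ((hA i).abs.eventually_lt_const
          ((hxσ.2.1 i hi).trans_lt (heven _ hm (signLevel_le _)))).mono fun _ h' ↦ h'.le
      have h2 : ∀ᶠ x' in 𝓝[S] x, ∀ i, σ i = 1 → 0 ≤ eval x' (A i) :=
        eventually_all.2 fun i ↦ eventually_all.2 fun hi ↦ ((hA i).eventually_const_lt
          ((hxσ.2.2.1 i hi).lt_of_ne' (hcase i (by simp [hi])))).mono fun _ h' ↦ h'.le
      have h3 : ∀ᶠ x' in 𝓝[S] x, ∀ i, σ i = -1 → eval x' (A i) ≤ 0 :=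
        eventually_all.2 fun i ↦ eventually_all.2 fun hi ↦ ((hA i).eventually_lt_const
          ((hxσ.2.2.2 i hi).lt_of_ne (hcase i (by simp [hi])))).mono fun _ h' ↦ h'.le
      filter_upwards [self_mem_nhdsWithin, h1, h2, h3] with x' h0 h1 h2 h3
      exact ⟨h0, h1, h2, h3⟩
  filter_upwards [self_mem_nhdsWithin, nhdsWithin_mono _ gvUnion_subset hev] with x' h1 h2
  exact mem_gvUnion_succ_of_mem_gvClosedRelaxation (fun j h h' ↦ (heven j h h').le) hodd h1 hτ hmτ h2

lemma eventually_mem_gvUnion_succ_of_lt_signLevel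
    (hSs : ∀ x ∈ S, ∀ y, signVector A y = signVector A x → y ∈ S)
    (hpos : ∀ j, m < j → 0 < ε (2 * j - 1))
    (hle : ∀ j, m < j → j ≤ t → ε (2 * j - 1) ≤ ε (2 * j)) (hx : x ∈ S)
    (hm : m < signLevel (signVector A x)) :
    ∀ᶠ x' in 𝓝[gvUnion A S Sgns ε 0] x, x' ∈ gvUnion A S Sgns ε (m + 1) := by
  have hxO := mem_gvOpenRelaxation_signVector hx fun _ ↦ hpos _ hm
  filter_upwards [self_mem_nhdsWithin,
    nhdsWithin_mono _ gvUnion_subset (eventually_mem_gvOpenRelaxation hxO)] with x' h1 h2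
  by_cases hτ : signVector A x ∈ Sgns
  · exact mem_gvUnion_succ_of_mem_gvClosedRelaxation (fun _ _ _ ↦ le_rfl) (fun _ _ _ ↦ rfl) h1 hτ hm
      (gvOpenRelaxation_subset_gvClosedRelaxation (fun _ ↦ hle _ hm (signLevel_le _)) h2)
  · obtain ⟨σ₁, hσ₁, -, hxσ₁, h⟩ := h1
    refine ⟨σ₁, hσ₁, ?_, hxσ₁, h⟩
    by_contra! hl
    exact h _ (signVector_mem_signCondOn hSs hx) hτ (by omega)
      (gvOpenRelaxation_subset_gvHalfOpen h2)

lemma eventually_notMem_gvHalfOpen (hy : signLevel (signVector A y) ≤ signLevel σ)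
    (hne : σ ≠ signVector A y) :
    ∀ᶠ s in 𝓝[>] (0 : ℝ), ∀ᶠ x in 𝓝 y, ∀ ε : ℕ → ℝ, ε (2 * signLevel σ - 1) = s →
      x ∉ gvHalfOpen A S ε σ := by
  have hA : ∀ i, ContinuousAt (fun x : Fin k → ℝ ↦ eval x (A i)) y :=
    fun i ↦ (MvPolynomial.continuous_eval _).continuousAt
  by_cases hcase : ∃ i, σ i = 0 ∧ eval y (A i) ≠ 0
  · obtain ⟨i, hi, hyi⟩ := hcase
    filter_upwards [Ioo_mem_nhdsGT (abs_pos.2 hyi)] with s hs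
    filter_upwards [(hA i).eventually_ne hyi, (hA i).abs.eventually_const_lt hs.2]
      with x h1 h2 ε hε hx
    rcases hx.2.1 i hi with h | h
    · exact lt_asymm h2 (hε ▸ h)
    · exact h1 h
  · push Not at hcase
    have h0 : ∀ i, σ i = 0 → signVector A y i = 0 := fun i hi ↦ signVector_eq_zero.2 (hcase i hi)
    obtain ⟨i, hi⟩ := Function.ne_iff.1 hne
    have hy0 : eval y (A i) ≠ 0 := fun h ↦ by
      have h' := signVector_eq_zero.2 h
      exact hi ((eq_zero_of_signLevel_le h0 hy h').trans h'.symm)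
    refine Eventually.of_forall fun s ↦ ?_
    rcases hσ : σ i with _ | _ | _
    · exact absurd (hcase i hσ) hy0
    · have : 0 < eval y (A i) := by
        refine hy0.lt_or_gt.resolve_left fun h ↦ hi (hσ.trans (sign_eq_neg_one_iff.2 h).symm)
      filter_upwards [(hA i).eventually_const_lt this] with x h1 ε _ hx
      exact lt_asymm h1 (hx.2.2.2 i hσ)
    · have : eval y (A i) < 0 := by
        refine hy0.lt_or_gt.resolve_right fun h ↦ hi (hσ.trans (sign_eq_one_iff.2 h).symm)
      filter_upwards [(hA i).eventually_lt_const this] with x h1 ε _ hx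
      exact lt_asymm h1 (hx.2.2.1 i hσ)

end Union

section Step

variable {k t : ℕ} {A : Fin t → MvPolynomial (Fin k) ℝ} {S : Set (Fin k → ℝ)}
  {Sgns : Set (Fin t → SignType)} {ε : ℕ → ℝ} {m : ℕ}

/-- Making the tolerance of open relaxations of level `m` positive does not change the homotopy
type. -/
lemma FlowOn.homotopyEquiv_gvUnion_single
    (hSs : ∀ x ∈ S, ∀ y, signVector A y = signVector A x → y ∈ S) (hm : 1 ≤ m) {s₀ s₁ ρ : ℝ}
    {L L' : Set (Fin k → ℝ)} {Ψ Ψ' : ℝ → ℝ → (Fin k → ℝ) → Fin k → ℝ} (h : FlowOn s₀ L Ψ)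
    (hSL : S ⊆ L)
    (hΨ : ∀ s ∈ Ioc 0 s₀, ∀ s' ∈ Ioc 0 s₀, ∀ x ∈ L, GVCompat A
      (fun j ↦ ε j + s * evenIndicator m t j) (fun j ↦ ε j + s' * evenIndicator m t j) x (Ψ s s' x))
    (hρ : 0 < ρ) (hρs : 2 * ρ ≤ s₀) {e : ℕ → ℝ} (he : e = fun j ↦ ε j + ρ * evenIndicator m t j)
    (h' : FlowOn s₁ L' Ψ') (hSL' : S ⊆ L')
    (hΨ' : ∀ s ∈ Ioc 0 s₁, ∀ s' ∈ Ioc 0 s₁, ∀ x ∈ L', GVCompat A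
      (fun j ↦ e j + s * Pi.single (M := fun _ ↦ ℝ) (2 * m - 1) 1 j)
      (fun j ↦ e j + s' * Pi.single (M := fun _ ↦ ℝ) (2 * m - 1) 1 j) x (Ψ' s s' x))
    (he0 : e (2 * m - 1) = 0) (hpos : ∀ j, m < j → 0 < e (2 * j - 1))
    (hle : ∀ j, m < j → j ≤ t → e (2 * j - 1) ≤ e (2 * j)) (hsep : ∀ l, m < l → GVSep A S e l) :
    Nonempty (ContinuousMap.HomotopyEquiv
      (gvUnion A S Sgns (fun j ↦ e j + s₁ * Pi.single (M := fun _ ↦ ℝ) (2 * m - 1) 1 j) 0)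
      (gvUnion A S Sgns e 0)) := by
  set E : ℝ → ℕ → ℝ := fun ρ j ↦ ε j + ρ * evenIndicator m t j with hE
  have hEe : E ρ = e := he.symm
  set u : ℝ → ℕ → ℝ := fun s j ↦ e j + s * Pi.single (M := fun _ ↦ ℝ) (2 * m - 1) 1 j with hu
  have hu0 : u 0 = e := by
    funext j
    simp [hu]
  have hum : ∀ s, u s (2 * m - 1) = s := fun s ↦ by simp [hu, he0]
  have hune : ∀ s j, j ≠ 2 * m - 1 → u s j = e j := fun s j hj ↦ by simp [hu, hj]
  have hEodd : ∀ s s' j, 1 ≤ j → E s (2 * j - 1) = E s' (2 * j - 1) := fun s s' j hj ↦ by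
    simp [hE, evenIndicator_odd hj]
  have hEmono : ∀ s s', s ≤ s' → ∀ j, E s j ≤ E s' j := fun s s' hss j ↦
    add_le_add le_rfl (mul_le_mul_of_nonneg_right hss evenIndicator_nonneg)
  have hEU : ∀ s s', s ≤ s' → ∀ n, gvUnion A S Sgns (E s) n ⊆ gvUnion A S Sgns (E s') n :=
    fun s s' hss n ↦ gvUnion_mono le_rfl (fun j _ _ _ ↦ hEmono s s' hss _)
      fun j hj _ _ ↦ (hEodd s' s j hj).le
  have humono : ∀ s s', s ≤ s' → ∀ j, u s j ≤ u s' j := by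
    intro s s' hss j
    by_cases hj : j = 2 * m - 1
    · rw [hj, hum, hum]
      exact hss
    · rw [hune s j hj, hune s' j hj]
  have huU : ∀ s s', s ≤ s' → gvUnion A S Sgns (u s') 0 ⊆ gvUnion A S Sgns (u s) 0 :=
    fun s s' hss ↦ gvUnion_mono le_rfl
      (fun j _ _ _ ↦ by rw [hune s _ (by omega), hune s' _ (by omega)])
      fun j _ _ _ ↦ humono s s' hss _
  have huS : ∀ s s', gvUnion A S Sgns (u s) (m + 1) ⊆ gvUnion A S Sgns (u s') (m + 1) :=
    fun s s' ↦ gvUnion_mono le_rfl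
      (fun j _ _ _ ↦ by rw [hune s _ (by omega), hune s' _ (by omega)])
      fun j _ _ _ ↦ by rw [hune s _ (by omega), hune s' _ (by omega)]
  have huS0 : ∀ s, gvUnion A S Sgns e (m + 1) ⊆ gvUnion A S Sgns (u s) 0 := fun s ↦
    (hu0 ▸ huS 0 s).trans (gvUnion_mono (Nat.zero_le _) (fun _ _ _ _ ↦ le_rfl) fun _ _ _ _ ↦ le_rfl)
  have hφs : ∀ l ∈ Icc (0 : ℝ) 1, ρ + l * (ρ / 2) ∈ Ioc 0 s₀ := fun l hl ↦
    ⟨by nlinarith [hl.1], by nlinarith [hl.2]⟩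
  have hφs' : ∀ l ∈ Icc (0 : ℝ) 1, ρ - l * (ρ / 2) ∈ Ioc 0 s₀ := fun l hl ↦
    ⟨by nlinarith [hl.2], by nlinarith [hl.1]⟩
  have hφ : ∀ l ∈ Icc (0 : ℝ) 1, ∀ x ∈ S, GVCompat A (E (ρ + l * (ρ / 2))) (E (ρ - l * (ρ / 2))) x
      (Ψ (ρ + l * (ρ / 2)) (ρ - l * (ρ / 2)) x) := fun l hl x hx ↦
    hΨ _ (hφs l hl) _ (hφs' l hl) x (hSL hx)
  have hφU : ∀ l ∈ Icc (0 : ℝ) 1, ∀ n, ∀ x ∈ gvUnion A S Sgns (E (ρ + l * (ρ / 2))) n,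
      Ψ (ρ + l * (ρ / 2)) (ρ - l * (ρ / 2)) x ∈ gvUnion A S Sgns e n := by
    intro l hl n x hx
    rw [← hEe]
    exact hEU _ _ (by nlinarith [hl.1]) _
      (((hφ l hl x (gvUnion_subset hx)).mem_gvUnion_iff hSs n).2 hx)
  have hφU' : ∀ l ∈ Icc (0 : ℝ) 1, ∀ n, ∀ x ∈ gvUnion A S Sgns e n,
      Ψ (ρ + l * (ρ / 2)) (ρ - l * (ρ / 2)) x ∈ gvUnion A S Sgns e n := by
    intro l hl n x hx
    refine hφU l hl n x (hEU ρ _ (by nlinarith [hl.1]) _ ?_)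
    rwa [hEe]
  have key := h'.homotopyEquiv_of_deformation (U := fun s ↦ gvUnion A S Sgns (u s) 0)
    (B := gvUnion A S Sgns e (m + 1))
    (Z := {x | signLevel (signVector A x) = m ∧ signVector A x ∉ Sgns})
    (φ := fun l x ↦ Ψ (ρ + l * (ρ / 2)) (ρ - l * (ρ / 2)) x) (gvUnion_subset.trans hSL')
    (fun s _ s' _ hss ↦ huU s s' hss)
    (fun s hs s' hs' x hx ↦ ((hΨ' s hs s' hs' x (hSL' (gvUnion_subset hx))).mem_gvUnion_iff
      hSs 0).2 hx) (huS0 s₁)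
  beta_reduce at key
  rw [hu0] at key
  refine key ?_ (fun l hl ↦ hφU' l hl 0) ?_ (fun l hl ↦ hφU' l hl _) ?_ ?_ ?_ ?_ ?_
  · refine h.cont.comp (f := fun q : ℝ × (Fin k → ℝ) ↦ (ρ + q.1 * (ρ / 2), ρ - q.1 * (ρ / 2), q.2))
      (by fun_prop) ?_
    rintro ⟨l, x⟩ ⟨hl, hx⟩
    exact ⟨hφs l hl, Ioc_subset_Icc_self (hφs' l hl), hSL (gvUnion_subset hx)⟩
  · intro x hx
    simp only [zero_mul, add_zero, sub_zero]
    exact h.refl ρ ⟨hρ, by linarith⟩ x (hSL (gvUnion_subset hx))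
  · intro l hl x hx hxZ
    simpa only [Set.mem_ofPred_eq, (hφ l hl x (gvUnion_subset hx)).sign] using hxZ
  · intro x hx
    have h1 : (1 : ℝ) ∈ Icc (0 : ℝ) 1 := ⟨zero_le_one, le_rfl⟩
    refine (eventually_mem_gvUnion_succ (ε' := E (ρ + 1 * (ρ / 2))) (fun j hj hj' ↦ ?_)
      (fun j hj _ ↦ ?_) hle hsep hx).mono fun x' hx' ↦ hφU 1 h1 _ x' hx'
    · simp only [← hEe, hE, evenIndicator_two_mul hj.le hj']
      linarith
    · rw [← hEe, hEodd _ ρ _ (by omega)]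
  · intro y hy hyZ
    have hyS := gvUnion_subset hy
    rcases lt_or_ge m (signLevel (signVector A y)) with hl | hl
    · exact ⟨s₁, ⟨h'.pos, le_rfl⟩, (eventually_mem_gvUnion_succ_of_lt_signLevel hSs hpos hle
        hyS hl).mono fun x hx ↦ huS0 s₁ hx⟩
    have hev : ∀ᶠ s in 𝓝[>] (0 : ℝ), ∀ σ : Fin t → SignType, signLevel σ = m →
        σ ≠ signVector A y → ∀ᶠ x in 𝓝 y, x ∉ gvHalfOpen A S (u s) σ := by
      refine eventually_all.2 fun σ ↦ eventually_all.2 fun hσ ↦ eventually_all.2 fun hne ↦ ?_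
      filter_upwards [eventually_notMem_gvHalfOpen (A := A) (S := S) (hl.trans hσ.ge) hne] with s hs
      filter_upwards [hs] with x hx
      exact hx (u s) (by rw [hσ, hum])
    obtain ⟨s, hs, hs₁⟩ := (hev.and (Ioc_mem_nhdsGT h'.pos)).exists
    refine ⟨s, hs₁, ?_⟩
    have hs' : ∀ᶠ x in 𝓝 y, ∀ σ : Fin t → SignType, signLevel σ = m →
        σ ≠ signVector A y → x ∉ gvHalfOpen A S (u s) σ :=
      eventually_all.2 fun σ ↦ eventually_all.2 fun hσ ↦ eventually_all.2 fun hne ↦ hs σ hσ hne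
    filter_upwards [self_mem_nhdsWithin, mem_nhdsWithin_of_mem_nhds hs'] with x hx hx'
    obtain ⟨σ, hσ, hn, hxσ, hx⟩ := hx
    refine ⟨σ, hσ, hn, ?_, fun σ' h1 h2 h3 h4 ↦ ?_⟩
    · rwa [gvClosedRelaxation_congr (ε' := e) fun _ ↦ hune s _ (by omega)]
    · by_cases hσ' : signLevel σ' = m
      · refine hx' σ' hσ' ?_ h4
        rintro rfl
        exact hyZ ⟨hσ', h2⟩
      · rw [gvHalfOpen_congr (ε' := e) fun _ ↦ hune s _ (by omega)] at h4
        exact hx σ' h1 h2 h3 h4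
  · rintro x ⟨σ, hσ, -, hxσ, hx⟩ ⟨hl, hxZ⟩
    refine ⟨σ, hσ, ?_, hxσ, hx⟩
    by_contra! hlt
    exact hx _ (signVector_mem_signCondOn hSs hxσ.1) hxZ (by omega)
      (mem_gvHalfOpen_signVector hxσ.1)
  · rintro x hx ⟨hl, hxZ⟩
    have hxS := gvUnion_subset hx
    have hxO := mem_gvOpenRelaxation_signVector (ε := u s₁) hxS fun _ ↦ by
      rw [hl, hum]
      exact h'.pos
    filter_upwards [self_mem_nhdsWithin,
      nhdsWithin_mono _ gvUnion_subset (eventually_mem_gvOpenRelaxation hxO)] with x' h1 h2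
    rw [← hu0]
    refine huS s₁ 0 ?_
    obtain ⟨σ, hσ, -, hxσ, h1⟩ := h1
    refine ⟨σ, hσ, ?_, hxσ, h1⟩
    by_contra! hlt
    exact h1 _ (signVector_mem_signCondOn hSs hxS) hxZ (by omega)
      (gvOpenRelaxation_subset_gvHalfOpen h2)

end Step

/-- Tolerances vanishing up to index `2 * m` and increasing afterwards for which the replacement
has the expected homotopy type. -/
structure GVStage {k t : ℕ} (A : Fin t → MvPolynomial (Fin k) ℝ) (S : Set (Fin k → ℝ))
    (Sgns : Set (Fin t → SignType)) (X : Set (Fin k → ℝ)) (m : ℕ) (ε : ℕ → ℝ) : Prop where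
  eq_zero : ∀ j ≤ 2 * m, ε j = 0
  pos : 0 < ε (2 * m + 1)
  lt_succ : ∀ j, 2 * m + 1 ≤ j → ε j < ε (j + 1)
  sep : ∀ l, m < l → GVSep A S ε l
  homotopyEquiv : Nonempty (ContinuousMap.HomotopyEquiv (gvUnion A S Sgns ε 0) X)

namespace GVStage

variable {k t : ℕ} {A : Fin t → MvPolynomial (Fin k) ℝ} {S : Set (Fin k → ℝ)}
  {Sgns : Set (Fin t → SignType)} {X : Set (Fin k → ℝ)} {ε : ℕ → ℝ} {m : ℕ}

lemma pos_of_lt (h : GVStage A S Sgns X m ε) {j : ℕ} (hj : 2 * m < j) : 0 < ε j := by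
  induction j, Nat.succ_le_of_lt hj using Nat.le_induction with
  | base => exact h.pos
  | succ j hj' ih => exact (ih (Nat.lt_of_succ_le hj')).trans (h.lt_succ j hj')

lemma start (hSs : ∀ x ∈ S, ∀ y, signVector A y = signVector A x → y ∈ S)
    (hSgns : Sgns ⊆ signCondOn A S) :
    GVStage A S Sgns (⋃ σ ∈ Sgns, signRealization A σ) t
      (fun j ↦ if j ≤ 2 * t then 0 else (j : ℝ)) where
  eq_zero j hj := if_pos hj
  pos := by
    rw [if_neg (by omega)]
    positivity
  lt_succ j hj := by
    rw [if_neg (by omega), if_neg (by omega)]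
    push_cast
    linarith
  sep l hl σ hσ := absurd (signLevel_le σ) (by omega)
  homotopyEquiv := by
    rw [gvUnion_eq_of_le_zero hSs hSgns fun j hj ↦ if_pos hj]
    exact ⟨ContinuousMap.HomotopyEquiv.refl _⟩

lemma exists_pred (hS : IsCompact S)
    (hSs : ∀ x ∈ S, ∀ y, signVector A y = signVector A x → y ∈ S) (hm : m + 1 ≤ t)
    (h : GVStage A S Sgns X (m + 1) ε) : ∃ ε', GVStage A S Sgns X m ε' := by
  obtain ⟨s₀, L, Ψ, hSL, hflow, hΨ⟩ :=
    exists_flow_gvCompat A hS.isBounded ε (evenIndicator (m + 1) t)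
  set E : ℝ → ℕ → ℝ := fun ρ j ↦ ε j + ρ * evenIndicator (m + 1) t j with hE
  have hE0 : E 0 = ε := by
    funext j
    simp [hE]
  have hEodd : ∀ ρ j, 1 ≤ j → E ρ (2 * j - 1) = E 0 (2 * j - 1) := fun ρ j hj ↦ by
    simp [hE, evenIndicator_odd hj]
  have hsep0 : ∀ l, m < l → GVSep A S ε l := by
    intro l hl
    rcases (Nat.succ_le_of_lt hl).eq_or_lt with rfl | hl
    · exact gvSep_of_le_zero hSs (h.eq_zero _ le_rfl).le fun j hj ↦ h.pos_of_lt (by omega)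
    · exact h.sep l hl
  have hev1 : ∀ᶠ ρ in 𝓝[>] (0 : ℝ), ∀ l : Fin (t + 1), m < l → GVSep A S (E ρ) l :=
    eventually_all.2 fun l ↦ eventually_all.2 fun hl ↦ nhdsWithin_le_nhds
      (GVSep.eventually hS (fun j ↦ by fun_prop) hEodd (hE0.symm ▸ hsep0 l hl))
  have hev2 : ∀ᶠ ρ in 𝓝[>] (0 : ℝ), ∀ j : Fin (2 * t + 1), 2 * (m + 1) < j →
      ρ < ε (j + 1) - ε j :=
    eventually_all.2 fun j ↦ eventually_all.2 fun hj ↦ nhdsWithin_le_nhds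
      (eventually_lt_nhds (sub_pos.2 (h.lt_succ j hj)))
  obtain ⟨ρ, ⟨⟨hsep, hlt⟩, hρε⟩, hρ, hρs⟩ := (((hev1.and hev2).and (nhdsWithin_le_nhds
    (eventually_lt_nhds h.pos))).and (Ioo_mem_nhdsGT (half_pos hflow.pos))).exists
  have hsep' : ∀ l, m < l → GVSep A S (E ρ) l := by
    intro l hl
    rcases le_or_gt l t with hlt | hlt
    · exact hsep ⟨l, Nat.lt_succ_of_le hlt⟩ hl
    · exact fun σ hσ ↦ absurd (signLevel_le σ) (by omega)
  obtain ⟨s₂, L', Ψ', hSL', hflow', hΨ'⟩ :=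
    exists_flow_gvCompat A hS.isBounded (E ρ) (Pi.single (M := fun _ ↦ ℝ) (2 * (m + 1) - 1) 1)
  have hs₁ : 0 < min s₂ (ρ / 2) := lt_min hflow'.pos (half_pos hρ)
  have hflow₁ := hflow'.restrict hs₁ (min_le_left _ _)
  have hs₁ρ : min s₂ (ρ / 2) < ρ := (min_le_right _ _).trans_lt (by linarith)
  set s₁ := min s₂ (ρ / 2) with hs₁_def
  have hIoc : Ioc 0 s₁ ⊆ Ioc 0 s₂ := Ioc_subset_Ioc_right (min_le_left _ _)
  have hIocρ : Ioc 0 ρ ⊆ Ioc 0 s₀ := Ioc_subset_Ioc_right (by linarith)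
  have hElt : ∀ j, 2 * (m + 1) ≤ j → E ρ j < E ρ (j + 1) := by
    intro j hj
    have h1 : ρ * evenIndicator (m + 1) t j ≤ ρ := mul_le_of_le_one_right hρ.le evenIndicator_le_one
    have h2 : 0 ≤ ρ * evenIndicator (m + 1) t (j + 1) := mul_nonneg hρ.le evenIndicator_nonneg
    rcases hj.eq_or_lt with rfl | hj
    · have := h.eq_zero _ le_rfl
      simp only [hE]
      linarith
    · rcases le_or_gt j (2 * t) with hjt | hjt
      · have := hlt ⟨j, Nat.lt_succ_of_le hjt⟩ hj
        simp only [hE] at this ⊢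
        linarith
      · have := h.lt_succ j hj
        simpa only [hE, evenIndicator_of_gt hjt, evenIndicator_of_gt (hjt.trans (Nat.lt_succ_self j)),
          mul_zero, add_zero] using this
  have hEρ0 : ∀ j < 2 * (m + 1), E ρ j = 0 := fun j hj ↦ by
    simp [hE, evenIndicator_of_lt hj, h.eq_zero j hj.le]
  have hEpos : ∀ j, m + 1 < j → 0 < E ρ (2 * j - 1) := fun j hj ↦ by
    rw [hEodd _ _ (by omega), hE0]
    exact h.pos_of_lt (by omega)
  have hdec := (hflow.restrict hρ (by linarith)).homotopyEquiv_gvUnion_shift (Sgns := Sgns)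
    hS.isClosed hSs hSL (fun s hs s' hs' ↦ hΨ s (hIocρ hs) s' (hIocρ hs')) h.eq_zero
    fun j hj ↦ h.pos_of_lt hj
  have hinc := hflow.homotopyEquiv_gvUnion_single (Sgns := Sgns) hSs (Nat.le_add_left 1 m) hSL hΨ hρ
    (by linarith) rfl hflow₁ hSL' (fun s hs s' hs' ↦ hΨ' s (hIoc hs) s' (hIoc hs'))
    (hEρ0 _ (by omega)) hEpos
    (fun j hj _ ↦ by simpa [show 2 * j - 1 + 1 = 2 * j by omega] using (hElt (2 * j - 1) (by omega)).le)
    fun l hl ↦ hsep' l (by omega)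
  refine ⟨fun j ↦ E ρ j + s₁ * Pi.single (M := fun _ ↦ ℝ) (2 * (m + 1) - 1) 1 j, ?_, ?_, ?_, ?_, ?_⟩
  · intro j hj
    simp [hEρ0 j (by omega), show j ≠ 2 * (m + 1) - 1 by omega]
  · simp [hEρ0 (2 * m + 1) (by omega), show 2 * (m + 1) - 1 = 2 * m + 1 by omega, hs₁]
  · intro j hj
    rcases hj.eq_or_lt with rfl | hj
    · have h1 : E ρ (2 * m + 1 + 1) = ρ := by
        simp [hE, show 2 * m + 1 + 1 = 2 * (m + 1) by ring, h.eq_zero _ le_rfl,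
          evenIndicator_two_mul le_rfl hm]
      simpa [hEρ0 (2 * m + 1) (by omega), show 2 * (m + 1) - 1 = 2 * m + 1 by omega, h1] using hs₁ρ
    · simpa [show j ≠ 2 * (m + 1) - 1 by omega, show j + 1 ≠ 2 * (m + 1) - 1 by omega]
        using hElt j (by omega)
  · intro l hl
    refine (hsep' l hl).congr ?_ fun j hj ↦ ?_
    · simp [show 2 * l ≠ 2 * (m + 1) - 1 by omega]
    · simp [show 2 * j - 1 ≠ 2 * (m + 1) - 1 by omega]
  · obtain ⟨f⟩ := hinc
    obtain ⟨g⟩ := hdec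
    obtain ⟨e⟩ := h.homotopyEquiv
    exact ⟨(f.trans g).trans e⟩

lemma exists_zero (hS : IsCompact S)
    (hSs : ∀ x ∈ S, ∀ y, signVector A y = signVector A x → y ∈ S)
    (hSgns : Sgns ⊆ signCondOn A S) :
    ∃ ε, GVStage A S Sgns (⋃ σ ∈ Sgns, signRealization A σ) 0 ε :=
  Nat.decreasingInduction (motive := fun m _ ↦
      ∃ ε, GVStage A S Sgns (⋃ σ ∈ Sgns, signRealization A σ) m ε)
    (fun _ hm ⟨_, h⟩ ↦ h.exists_pred hS hSs hm) ⟨_, start hSs hSgns⟩ (Nat.zero_le t)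

end GVStage

end

/-- Gabrielov-Vorobjov replacement theorem: if `S ⊆ ℝ^k` is a bounded `C`-closed set for the
family `C = (A 0,…,A (t-1))`, `Σ ⊆ Sign(C,S)` and `X = ⋃_{σ ∈ Σ} R(σ)`, then there are reals
`0 < ε_1 < ⋯ < ε_{2t}` such that `X' = X^{t+1}` is closed and bounded and homotopy
equivalent to `X`. -/
theorem gabrielov_vorobjov_replacement {k t : ℕ}
    (A : Fin t → MvPolynomial (Fin k) ℝ)
    (S : Set (Fin k → ℝ)) (hSbdd : Bornology.IsBounded S)
    (nJ : ℕ) (mJ : Fin nJ → ℕ) (idx : ∀ j, Fin (mJ j) → Fin t)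
    (rel : ∀ j, Fin (mJ j) → SignType)
    (hS : S = ⋃ j, ⋂ i, basicClosedSet (A (idx j i)) (rel j i))
    (Sgns : Set (Fin t → SignType)) (hSgns : Sgns ⊆ signCondOn A S)
    (X : Set (Fin k → ℝ)) (hX : X = ⋃ σ ∈ Sgns, signRealization A σ) :
    ∃ ε : ℕ → ℝ, 0 < ε 1 ∧ (∀ i, 1 ≤ i → i < 2 * t → ε i < ε (i + 1)) ∧
      IsClosed (gvSeq A S ε Sgns X (t + 1)) ∧
      Bornology.IsBounded (gvSeq A S ε Sgns X (t + 1)) ∧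
      Nonempty (ContinuousMap.HomotopyEquiv X (gvSeq A S ε Sgns X (t + 1))) := by
  have hScl : IsClosed S := hS ▸ isClosed_iUnion_iInter_basicClosedSet mJ idx rel
  have hSs : ∀ x ∈ S, ∀ y, signVector A y = signVector A x → y ∈ S := by
    rw [hS]
    exact fun x hx y hy ↦ mem_iUnion_iInter_basicClosedSet hx hy
  obtain ⟨ε, h⟩ := GVStage.exists_zero (Metric.isCompact_of_isClosed_isBounded hScl hSbdd) hSs hSgns
  subst hX
  have hpos : ∀ j, 1 ≤ j → 0 < ε j := fun j hj ↦ h.pos_of_lt hj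
  refine ⟨ε, h.pos, fun i hi _ ↦ h.lt_succ i hi, ?_⟩
  rw [gvSeq_eq_gvUnion hSgns hpos]
  exact ⟨isClosed_gvUnion hScl fun j _ _ ↦ hpos _ (by omega), hSbdd.subset gvUnion_subset,
    h.homotopyEquiv.map fun e ↦ e.symm⟩
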